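/- Let d > 2s and let ρ be an admissible weight with exponents (γ₀,γ). Let u₀ : ℝ^d → ℝ be nonnegative with ∫_{ℝ^d} u₀ ρ dx < ∞ and u₀ ∈ L^∞(ℝ^d). Then there exists a weak solution u of the Cauchy problem ρ u_t + (-Δ)^s(u^m) = 0 with initial datum the measure μ = u₀(x) ρ(x) dx, satisfying moreover the two energy estimates: (a) for a.e. 0 < t₁ < t₂, ∫_{t₁}^{t₂} ∥u^m(·,t)∥_{Ḣ^s}² dt + (1/(m+1)) ∫_{ℝ^d} u^{m+1}(x,t₂) ρ(x) dx = (1/(m+1)) ∫_{ℝ^d} u^{m+1}(x,t₁) ρ(x) dx; and (b) the function z := u^{(m+1)/2} has a weak time derivative w, i.e. ∫_0^∞∫_{ℝ^d} z ∂_tφ ρ dx dt = -∫_0^∞∫_{ℝ^d} w φ ρ dx dt for every smooth compactly supported φ on ℝ^d × (0,∞), with ∫_{t₁}^{t₂} ∫_{ℝ^d} w(x,t)² ρ(x) dx dt ≤ C′ ∫_{ℝ^d} u^{m+1}(x, t₁/2) ρ(x) dx for all 0 < t₁ < t₂, where C′ > 0 depends only on m, t₁ and t₂. -/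

import Mathlib

open MeasureTheory Filter Topology Set
open scoped ENNReal NNReal

noncomputable section

/-- `d`-dimensional Euclidean space. -/
abbrev Ed (d : ℕ) : Type := EuclideanSpace ℝ (Fin d)

/-- An admissible weight with exponents `(γ₀, γ)` and constants `0 < c < C`:
a measurable, everywhere positive function comparable to `|x|^{-γ₀}` near the
origin and to `|x|^{-γ}` at infinity. -/
def AdmissibleWeight (d : ℕ) (ρ : Ed d → ℝ) (γ₀ γ c C : ℝ) : Prop :=
  0 < c ∧ c < C ∧ Measurable ρ ∧ (∀ x, 0 < ρ x) ∧
    (∀ᵐ x ∂(volume : Measure (Ed d)), ‖x‖ ≤ 1 →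
      c * ‖x‖ ^ (-γ₀) ≤ ρ x ∧ ρ x ≤ C * ‖x‖ ^ (-γ₀)) ∧
    (∀ᵐ x ∂(volume : Measure (Ed d)), 1 < ‖x‖ →
      c * ‖x‖ ^ (-γ) ≤ ρ x ∧ ρ x ≤ C * ‖x‖ ^ (-γ))

/-- The Gagliardo bilinear form `E(v,w)` of order `s` with normalizing constant `κ`. -/
def gagliardoE (d : ℕ) (s κ : ℝ) (v w : Ed d → ℝ) : ℝ :=
  (κ / 2) * ∫ p : Ed d × Ed d,
    (v p.1 - v p.2) * (w p.1 - w p.2) / ‖p.1 - p.2‖ ^ ((d : ℝ) + 2 * s)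

/-- The squared homogeneous fractional Sobolev seminorm `‖v‖_{Ḣ^s}² = E(v,v)`,
with values in `[0,∞]`. -/
def gagliardoSq (d : ℕ) (s κ : ℝ) (v : Ed d → ℝ) : ℝ≥0∞ :=
  ENNReal.ofReal (κ / 2) * ∫⁻ p : Ed d × Ed d,
    ENNReal.ofReal ((v p.1 - v p.2) ^ 2 / ‖p.1 - p.2‖ ^ ((d : ℝ) + 2 * s))

/-- The weighted `L^p` norm `‖v‖_{p,ρ}`, valued in `[0,∞]`. -/
def wnorm (d : ℕ) (p : ℝ) (ρ v : Ed d → ℝ) : ℝ≥0∞ :=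
  (∫⁻ x : Ed d, ENNReal.ofReal (|v x| ^ p * ρ x)) ^ (1 / p)

/-- Smooth compactly supported test functions on `ℝ^d × (0,∞)`. -/
def IsTestFn (d : ℕ) (φ : Ed d × ℝ → ℝ) : Prop :=
  ContDiff ℝ (⊤ : ℕ∞) φ ∧ HasCompactSupport φ ∧ tsupport φ ⊆ univ ×ˢ Ioi (0 : ℝ)

/-- Conditions (i)–(iii) of the definition of weak solution of
`ρ u_t + (-Δ)^s(u^m) = 0` on `ℝ^d × (0,∞)` (no initial datum prescribed). -/
structure WeakSolCore (d : ℕ) (s m κ : ℝ) (ρ : Ed d → ℝ) (u : Ed d → ℝ → ℝ) : Prop where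
  measurable : Measurable (Function.uncurry u)
  nonneg : ∀ x t, 0 ≤ u x t
  /-- (i), first part: `ess sup_{t>0} ∫ u(·,t) ρ < ∞`. -/
  massBound : ∃ M : ℝ, ∀ᵐ t ∂(volume.restrict (Ioi (0 : ℝ))),
    Integrable (fun x : Ed d => u x t * ρ x) ∧ (∫ x : Ed d, u x t * ρ x) ≤ M
  /-- (i), second part: `u` essentially bounded on `ℝ^d × (τ,∞)` for every `τ > 0`. -/
  essBdd : ∀ τ : ℝ, 0 < τ → ∃ B : ℝ,
    ∀ᵐ p ∂(volume : Measure (Ed d × ℝ)), τ < p.2 → u p.1 p.2 ≤ B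
  /-- (ii), first part: `‖u^m(·,t)‖_{Ḣ^s} < ∞` for a.e. `t > 0`. -/
  energyFinite : ∀ᵐ t ∂(volume.restrict (Ioi (0 : ℝ))),
    gagliardoSq d s κ (fun x => u x t ^ m) < ⊤
  /-- (ii), second part: `t ↦ ‖u^m(·,t)‖_{Ḣ^s}²` locally integrable on `(0,∞)`. -/
  energyLocInt : ∀ t₁ t₂ : ℝ, 0 < t₁ → t₁ < t₂ →
    (∫⁻ t in Ioc t₁ t₂, gagliardoSq d s κ (fun x => u x t ^ m)) ≠ ⊤
  /-- (iii): the weak formulation against all test functions. -/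
  weakForm : ∀ φ : Ed d × ℝ → ℝ, IsTestFn d φ →
    -(∫ t in Ioi (0 : ℝ), ∫ x : Ed d, u x t * deriv (fun τ => φ (x, τ)) t * ρ x)
      + ∫ t in Ioi (0 : ℝ),
          gagliardoE d s κ (fun x => u x t ^ m) (fun x => φ (x, t)) = 0

/-- Condition (iv): `ρ(·)u(·,t) → μ` as `t → 0` essentially, tested against all
bounded continuous functions. -/
def HasInitialTrace (d : ℕ) (ρ : Ed d → ℝ) (u : Ed d → ℝ → ℝ)
    (μ : Measure (Ed d)) : Prop :=
  ∃ N : Set ℝ, volume N = 0 ∧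
    ∀ φ : Ed d → ℝ, Continuous φ → (∃ B : ℝ, ∀ x, |φ x| ≤ B) →
      Tendsto (fun t => ∫ x : Ed d, φ x * (u x t * ρ x))
        (𝓝[(Ioi (0 : ℝ)) \ N] 0) (𝓝 (∫ x, φ x ∂μ))

/-- Weak solution of the Cauchy problem with initial datum `μ`. -/
def IsWeakSolution (d : ℕ) (s m κ : ℝ) (ρ : Ed d → ℝ) (μ : Measure (Ed d))
    (u : Ed d → ℝ → ℝ) : Prop :=
  WeakSolCore d s m κ ρ u ∧ HasInitialTrace d ρ u μ

section PointwiseInequalities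

lemma young_conj {m : ℝ} (hm : 1 < m) {a b : ℝ} (ha : 0 ≤ a) (hb : 0 ≤ b) :
    a * b ≤ a ^ (m + 1) / (m + 1) + m / (m + 1) * b ^ (1 + 1 / m) := by
  have h : (m + 1).HolderConjugate (1 + 1 / m) := by
    rw [Real.holderConjugate_iff]
    refine ⟨by linarith, ?_⟩
    have : m ≠ 0 := by linarith
    have : m + 1 ≠ 0 := by linarith
    field_simp
    ring
  have := Real.young_inequality_of_nonneg ha hb h
  have e : b ^ (1 + 1 / m) / (1 + 1 / m) = m / (m + 1) * b ^ (1 + 1 / m) := by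
    have : m ≠ 0 := by linarith
    have : m + 1 ≠ 0 := by linarith
    field_simp
  linarith

lemma mul_le_rpow_add_rpow {m : ℝ} (hm : 1 < m) {a b : ℝ} (ha : 0 ≤ a) (hb : 0 ≤ b) :
    a * b ≤ a ^ (m + 1) + b ^ (1 + 1 / m) := by
  have h := young_conj hm ha hb
  have h1 : a ^ (m + 1) / (m + 1) ≤ a ^ (m + 1) :=
    div_le_self (Real.rpow_nonneg ha _) (by linarith)
  have h2 : m / (m + 1) * b ^ (1 + 1 / m) ≤ b ^ (1 + 1 / m) := by
    apply mul_le_of_le_one_left (Real.rpow_nonneg hb _)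
    rw [div_le_one (by linarith)]; linarith
  linarith

lemma rpow_inv_mul_self {m : ℝ} (hm : 1 < m) {a : ℝ} (ha : 0 ≤ a) :
    a ^ (1 / m) * a = a ^ (1 + 1 / m) := by
  rw [add_comm, Real.rpow_add_one' ha]; positivity

lemma rpow_inv_rpow_add_one {m : ℝ} (hm : 1 < m) {a : ℝ} (ha : 0 ≤ a) :
    (a ^ (1 / m)) ^ (m + 1) = a ^ (1 + 1 / m) := by
  rw [← Real.rpow_mul ha]; congr 1
  have : m ≠ 0 := by linarith
  field_simp

/-- Tangent inequality for the convex function `r ↦ m/(m+1) r^(1+1/m)`. -/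
lemma conj_tangent {m : ℝ} (hm : 1 < m) {a b : ℝ} (ha : 0 ≤ a) (hb : 0 ≤ b) :
    a ^ (1 / m) * (b - a) ≤ m / (m + 1) * b ^ (1 + 1 / m) - m / (m + 1) * a ^ (1 + 1 / m) := by
  have h := young_conj hm (Real.rpow_nonneg ha (1 / m)) hb
  rw [rpow_inv_rpow_add_one hm ha] at h
  have h2 := rpow_inv_mul_self hm ha
  have h3 : a ^ (1 + 1 / m) / (m + 1) = a ^ (1 + 1 / m) - m / (m + 1) * a ^ (1 + 1 / m) := by
    have : m + 1 ≠ 0 := by linarith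
    field_simp; ring
  nlinarith

lemma rpow_add_le' {r : ℝ} (hr0 : 0 ≤ r) (hr1 : r ≤ 1) {a b : ℝ} (ha : 0 ≤ a) (hb : 0 ≤ b) :
    (a + b) ^ r ≤ a ^ r + b ^ r := by
  have := NNReal.rpow_add_le_add_rpow ⟨a, ha⟩ ⟨b, hb⟩ hr0 hr1
  exact_mod_cast this

lemma add_rpow_le' {r : ℝ} (hr1 : 1 ≤ r) {a b : ℝ} (ha : 0 ≤ a) (hb : 0 ≤ b) :
    a ^ r + b ^ r ≤ (a + b) ^ r := by
  have := NNReal.add_rpow_le_rpow_add ⟨a, ha⟩ ⟨b, hb⟩ hr1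
  exact_mod_cast this

/-- First order expansion of `r ↦ m/(m+1) |r|^(1+1/m)` with a remainder of power type. -/
lemma conj_expansion {m : ℝ} (hm : 1 < m) {a : ℝ} (ha : 0 ≤ a) (b : ℝ) :
    m / (m + 1) * |a + b| ^ (1 + 1 / m) - m / (m + 1) * a ^ (1 + 1 / m)
      ≤ a ^ (1 / m) * b + 2 * |b| ^ (1 + 1 / m) := by
  have hm0 : 0 < m := by linarith
  have h1m : 1 / m ≤ 1 := by rw [div_le_one hm0]; exact hm.le
  have h1m0 : 0 ≤ 1 / m := by positivity
  have hbp : 0 ≤ |b| ^ (1 + 1 / m) := by positivity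
  rcases le_or_gt 0 (a + b) with hab | hab
  · rw [abs_of_nonneg hab]
    have h := conj_tangent hm hab ha
    have h1 : (a + b) ^ (1 / m) * b ≤ a ^ (1 / m) * b + |b| ^ (1 + 1 / m) := by
      rw [← rpow_inv_mul_self hm (abs_nonneg b)]
      rcases le_or_gt 0 b with hb | hb
      · rw [abs_of_nonneg hb]
        have := rpow_add_le' h1m0 h1m ha hb
        nlinarith
      · rw [abs_of_neg hb]
        have := rpow_add_le' h1m0 h1m hab (neg_nonneg.2 hb.le)
        rw [add_neg_cancel_right] at this
        nlinarith
    have : (a + b) ^ (1 / m) * (a - (a + b)) = -((a + b) ^ (1 / m) * b) := by ring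
    linarith
  · have hb : b < 0 := by linarith
    have h1 : |a + b| ≤ |b| := by
      rw [abs_of_neg hab, abs_of_neg hb]; linarith
    have h2 : |a + b| ^ (1 + 1 / m) ≤ |b| ^ (1 + 1 / m) :=
      Real.rpow_le_rpow (abs_nonneg _) h1 (by positivity)
    have h3 : a ^ (1 / m) ≤ |b| ^ (1 / m) :=
      Real.rpow_le_rpow ha (by rw [abs_of_neg hb]; linarith) h1m0
    have h4 : a ^ (1 / m) * |b| ≤ |b| ^ (1 + 1 / m) := by
      rw [← rpow_inv_mul_self hm (abs_nonneg b)]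
      exact mul_le_mul_of_nonneg_right h3 (abs_nonneg _)
    rw [abs_of_neg hb] at h4
    have h5 : 0 ≤ m / (m + 1) * a ^ (1 + 1 / m) := by positivity
    have h6 : m / (m + 1) * |a + b| ^ (1 + 1 / m) ≤ |b| ^ (1 + 1 / m) := by
      calc _ ≤ 1 * |a + b| ^ (1 + 1 / m) := by
            gcongr; rw [div_le_one (by linarith)]; linarith
        _ ≤ _ := by rw [one_mul]; exact h2
    rw [← abs_of_neg hb] at h4
    have : |b| = -b := abs_of_neg hb
    nlinarith

lemma rpow_sub_le_mul {r B : ℝ} (hr : 1 ≤ r) {a b : ℝ} (ha : 0 ≤ a) (hab : a ≤ b)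
    (hB : b ≤ B) : b ^ r - a ^ r ≤ r * B ^ (r - 1) * (b - a) := by
  rcases eq_or_lt_of_le hab with rfl | hlt
  · simp
  have hb : 0 < b := by linarith
  have h := one_add_mul_self_le_rpow_one_add (s := a / b - 1) (by
    have : 0 ≤ a / b := by positivity
    linarith) hr
  rw [add_sub_cancel, Real.div_rpow ha hb.le] at h
  have hbr : 0 < b ^ r := by positivity
  have h2 : b ^ r + r * (a / b - 1) * b ^ r ≤ a ^ r := by
    have := mul_le_mul_of_nonneg_right h hbr.le
    rw [div_mul_cancel₀ _ hbr.ne'] at this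
    linarith
  have h3 : b ^ r = b ^ (r - 1) * b := by
    rw [← Real.rpow_add_one' hb.le (by linarith)]; congr 1; ring
  have h4 : r * (a / b - 1) * b ^ r = r * b ^ (r - 1) * (a - b) := by
    rw [h3]; field_simp
  have h5 : b ^ (r - 1) ≤ B ^ (r - 1) := Real.rpow_le_rpow hb.le hB (by linarith)
  have h6 : r * b ^ (r - 1) * (b - a) ≤ r * B ^ (r - 1) * (b - a) := by
    have : 0 ≤ b - a := by linarith
    gcongr
  nlinarith

lemma abs_rpow_sub_le {r B : ℝ} (hr : 1 ≤ r) {a b : ℝ} (ha : 0 ≤ a) (hb : 0 ≤ b)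
    (haB : a ≤ B) (hbB : b ≤ B) : |a ^ r - b ^ r| ≤ r * B ^ (r - 1) * |a - b| := by
  rcases le_total a b with h | h
  · rw [abs_sub_comm, abs_sub_comm a b, abs_of_nonneg, abs_of_nonneg (by linarith)]
    · exact rpow_sub_le_mul hr ha h hbB
    · exact sub_nonneg.2 (Real.rpow_le_rpow ha h (by linarith))
  · rw [abs_of_nonneg, abs_of_nonneg (by linarith)]
    · exact rpow_sub_le_mul hr hb h haB
    · exact sub_nonneg.2 (Real.rpow_le_rpow hb h (by linarith))

/-- `r ↦ m/(m+1) r^(1+1/m)` is uniformly convex on bounded intervals. -/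
lemma conj_midpoint_gap {m : ℝ} (hm : 1 < m) {B : ℝ} (hB : 0 < B) :
    ∃ c : ℝ, 0 < c ∧ ∀ a b : ℝ, 0 ≤ a → 0 ≤ b → a ≤ B ^ m → b ≤ B ^ m →
      m / (m + 1) * ((a + b) / 2) ^ (1 + 1 / m) + c * (a - b) ^ 2 ≤
        (m / (m + 1) * a ^ (1 + 1 / m) + m / (m + 1) * b ^ (1 + 1 / m)) / 2 := by
  have hm0 : 0 < m := by linarith
  set c : ℝ := 1 / (m * B ^ (m - 1)) with hc
  have hcpos : 0 < c := by positivity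
  set k : ℝ → ℝ := fun r => m / (m + 1) * r ^ (1 + 1 / m) - c / 2 * r ^ 2 with hk
  have hconv : ConvexOn ℝ (Icc 0 (B ^ m)) k := by
    have hd : ∀ r : ℝ, HasDerivAt k (r ^ (1 / m) - c * r) r := by
      intro r
      have h1 := (Real.hasDerivAt_rpow_const (x := r) (p := 1 + 1 / m)
        (Or.inr (by have : 0 < 1 / m := by positivity
                    linarith))).const_mul (m / (m + 1))
      have h2 := (hasDerivAt_pow 2 r).const_mul (c / 2)
      have e : m / (m + 1) * ((1 + 1 / m) * r ^ (1 + 1 / m - 1)) - c / 2 * ((2 : ℕ) * r ^ (2 - 1))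
          = r ^ (1 / m) - c * r := by
        have : m + 1 ≠ 0 := by linarith
        rw [add_sub_cancel_left]
        field_simp
        simp; ring
      rw [← e]
      exact h1.sub h2
    apply MonotoneOn.convexOn_of_deriv (convex_Icc _ _)
    · exact fun r _ => (hd r).continuousAt.continuousWithinAt
    · exact fun r _ => (hd r).differentiableAt.differentiableWithinAt
    · rw [interior_Icc]
      intro x hx y hy hxy
      rw [(hd x).deriv, (hd y).deriv]
      have hx0 : 0 ≤ x := hx.1.le
      have hy0 : 0 ≤ y := hy.1.le
      have hyB : y ^ (1 / m) ≤ B := by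
        have := Real.rpow_le_rpow hy0 hy.2.le (z := 1 / m) (by positivity)
        rwa [← Real.rpow_mul hB.le, mul_one_div_cancel hm0.ne', Real.rpow_one] at this
      have h := rpow_sub_le_mul hm.le (Real.rpow_nonneg hx0 (1 / m))
        (Real.rpow_le_rpow hx0 hxy (by positivity)) hyB
      rw [← Real.rpow_mul hx0, ← Real.rpow_mul hy0, one_div_mul_cancel hm0.ne', Real.rpow_one,
        Real.rpow_one] at h
      have h2 : c * (y - x) ≤ y ^ (1 / m) - x ^ (1 / m) := by
        rw [hc, one_div_mul_eq_div, div_le_iff₀ (by positivity)]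
        linarith
      linarith
  refine ⟨c / 8, by positivity, fun a b ha hb haB hbB => ?_⟩
  have h := hconv.2 ⟨ha, haB⟩ ⟨hb, hbB⟩ (show (0 : ℝ) ≤ 1 / 2 by norm_num)
    (show (0 : ℝ) ≤ 1 / 2 by norm_num) (by norm_num)
  simp only [smul_eq_mul, hk] at h
  have e : 1 / 2 * a + 1 / 2 * b = (a + b) / 2 := by ring
  rw [e] at h
  nlinarith

/-- Tangent inequality for `r ↦ r^(m+1)/(m+1)`. -/
lemma power_tangent {m : ℝ} (hm : 1 < m) {a b : ℝ} (ha : 0 ≤ a) (hb : 0 ≤ b) :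
    (a - b) * b ^ m ≤ 1 / (m + 1) * a ^ (m + 1) - 1 / (m + 1) * b ^ (m + 1) := by
  have hm0 : 0 < m := by linarith
  have h := young_conj hm ha (Real.rpow_nonneg hb m)
  have e : (b ^ m) ^ (1 + 1 / m) = b ^ (m + 1) := by
    rw [← Real.rpow_mul hb]; congr 1; field_simp
  have e2 : b * b ^ m = b ^ (m + 1) := by
    rw [mul_comm, ← Real.rpow_add_one' hb (by linarith)]
  rw [e] at h
  have e3 : m / (m + 1) * b ^ (m + 1) = b ^ (m + 1) - 1 / (m + 1) * b ^ (m + 1) := by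
    have : m + 1 ≠ 0 := by linarith
    field_simp; ring
  have e4 : a ^ (m + 1) / (m + 1) = 1 / (m + 1) * a ^ (m + 1) := by ring
  nlinarith

private lemma half_power_aux {m : ℝ} (hm : 1 < m) {a b : ℝ} (hb : 0 ≤ b) (hab : b ≤ a) :
    (a ^ ((m + 1) / 2) - b ^ ((m + 1) / 2)) ^ 2
      ≤ (m + 1) / 2 * ((a ^ m - b ^ m) * (a - b)) := by
  have ha : 0 ≤ a := hb.trans hab
  set q := (m + 1) / 2 with hq
  have hq1 : 1 ≤ q := by rw [hq]; linarith
  have h1 : a ^ q - b ^ q ≤ q * a ^ (q - 1) * (a - b) := rpow_sub_le_mul hq1 hb hab le_rfl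
  have h0 : 0 ≤ a ^ q - b ^ q := sub_nonneg.2 (Real.rpow_le_rpow hb hab (by linarith))
  have h2 : a ^ (q - 1) * (a ^ q - b ^ q) ≤ a ^ m - b ^ m := by
    have e1 : ∀ c : ℝ, 0 ≤ c → c ^ (q - 1) * c ^ q = c ^ m := by
      intro c hc
      rw [← Real.rpow_add_of_nonneg hc (by linarith) (by linarith)]; congr 1; rw [hq]; ring
    have h3 : b ^ (q - 1) ≤ a ^ (q - 1) := Real.rpow_le_rpow hb hab (by linarith)
    have h4 : b ^ (q - 1) * b ^ q ≤ a ^ (q - 1) * b ^ q := by gcongr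
    rw [e1 b hb] at h4
    rw [mul_sub, e1 a ha]; linarith
  calc (a ^ q - b ^ q) ^ 2 = (a ^ q - b ^ q) * (a ^ q - b ^ q) := sq _
    _ ≤ (q * a ^ (q - 1) * (a - b)) * (a ^ q - b ^ q) := by gcongr
    _ = q * (a - b) * (a ^ (q - 1) * (a ^ q - b ^ q)) := by ring
    _ ≤ q * (a - b) * (a ^ m - b ^ m) := by
        have : 0 ≤ a - b := by linarith
        gcongr
    _ = _ := by ring

lemma half_power_sq_le {m : ℝ} (hm : 1 < m) {a b : ℝ} (ha : 0 ≤ a) (hb : 0 ≤ b) :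
    (a ^ ((m + 1) / 2) - b ^ ((m + 1) / 2)) ^ 2
      ≤ (m + 1) / 2 * ((a ^ m - b ^ m) * (a - b)) := by
  rcases le_total b a with h | h
  · exact half_power_aux hm hb h
  · have := half_power_aux hm ha h
    nlinarith

private lemma monotone_aux {m : ℝ} (hm : 1 < m) {a b : ℝ} (hb : 0 ≤ b) (hab : b ≤ a) :
    |a - b| ^ (m + 1) ≤ (a ^ m - b ^ m) * (a - b) := by
  have h0 : 0 ≤ a - b := by linarith
  rw [abs_of_nonneg h0, Real.rpow_add_one' h0 (by linarith)]
  have := add_rpow_le' hm.le hb h0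
  rw [add_sub_cancel] at this
  gcongr
  linarith

lemma abs_sub_rpow_le {m : ℝ} (hm : 1 < m) {a b : ℝ} (ha : 0 ≤ a) (hb : 0 ≤ b) :
    |a - b| ^ (m + 1) ≤ (a ^ m - b ^ m) * (a - b) := by
  rcases le_total b a with h | h
  · exact monotone_aux hm hb h
  · have := monotone_aux hm ha h
    rw [abs_sub_comm] at this
    linarith

end PointwiseInequalities

section MeasureTools

variable {α : Type*} [MeasurableSpace α]

lemma ENNReal.liminf_add_liminf_le (P Q : ℕ → ℝ≥0∞) :
    liminf P atTop + liminf Q atTop ≤ liminf (fun n => P n + Q n) atTop := by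
  simp only [liminf_eq_iSup_iInf_of_nat]
  rw [ENNReal.iSup_add_iSup_of_monotone]
  · refine iSup_mono fun n => le_iInf₂ fun i hi => ?_
    exact add_le_add (iInf₂_le i hi) (iInf₂_le i hi)
  · exact fun a b hab => biInf_mono fun i hi => hab.trans hi
  · exact fun a b hab => biInf_mono fun i hi => hab.trans hi

lemma lintegral_ofReal_le_liminf {μ : Measure α} {F : ℕ → α → ℝ} {f : α → ℝ}
    (hF : ∀ n, Measurable (F n)) (h : ∀ᵐ x ∂μ, Tendsto (fun n => F n x) atTop (𝓝 (f x))) :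
    ∫⁻ x, ENNReal.ofReal (f x) ∂μ ≤ liminf (fun n => ∫⁻ x, ENNReal.ofReal (F n x) ∂μ) atTop := by
  calc _ = ∫⁻ x, liminf (fun n => ENNReal.ofReal (F n x)) atTop ∂μ := by
        apply lintegral_congr_ae
        filter_upwards [h] with x hx
        exact ((ENNReal.continuous_ofReal.tendsto _).comp hx).liminf_eq.symm
    _ ≤ _ := lintegral_liminf_le fun n => (hF n).ennreal_ofReal

/-- A pointwise limit of a sequence of functions with values in `[0, M]`. -/
def limClip (M : ℝ) (F : ℕ → α → ℝ) (x : α) : ℝ :=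
  max 0 (min M (limsup (fun n => F n x) atTop))

lemma measurable_limClip {M : ℝ} {F : ℕ → α → ℝ} (hF : ∀ n, Measurable (F n)) :
    Measurable (limClip M F) :=
  measurable_const.max (measurable_const.min (Measurable.limsup hF))

lemma limClip_nonneg (M : ℝ) (F : ℕ → α → ℝ) (x : α) : 0 ≤ limClip M F x := le_max_left _ _

lemma limClip_le {M : ℝ} (hM : 0 ≤ M) (F : ℕ → α → ℝ) (x : α) : limClip M F x ≤ M :=
  max_le hM (min_le_left _ _)

lemma tendsto_limClip {M : ℝ} {F : ℕ → α → ℝ} {x : α} (h0 : ∀ n, 0 ≤ F n x)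
    (hM : ∀ n, F n x ≤ M) (h : ∃ l, Tendsto (fun n => F n x) atTop (𝓝 l)) :
    Tendsto (fun n => F n x) atTop (𝓝 (limClip M F x)) := by
  obtain ⟨l, hl⟩ := h
  have : limClip M F x = l := by
    rw [limClip, hl.limsup_eq, min_eq_right (le_of_tendsto' hl hM),
      max_eq_right (ge_of_tendsto' hl h0)]
  rwa [this]

lemma integrable_of_lintegral_ofReal_ne_top {μ : Measure α} {f : α → ℝ} (hf : Measurable f)
    (h0 : ∀ x, 0 ≤ f x) (h : ∫⁻ x, ENNReal.ofReal (f x) ∂μ ≠ ⊤) : Integrable f μ :=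
  (lintegral_ofReal_ne_top_iff_integrable hf.aestronglyMeasurable (Eventually.of_forall h0)).1 h

lemma lintegral_ofReal_eq {μ : Measure α} {f : α → ℝ} (hf : Integrable f μ)
    (h0 : ∀ x, 0 ≤ f x) : ∫⁻ x, ENNReal.ofReal (f x) ∂μ = ENNReal.ofReal (∫ x, f x ∂μ) :=
  (ofReal_integral_eq_lintegral_ofReal hf (Eventually.of_forall h0)).symm

end MeasureTools

section JumpForms

variable {Ω : Type*} [MeasurableSpace Ω]

/-- The increment of a function, as a function of two points. -/
def incr (v : Ω → ℝ) (p : Ω × Ω) : ℝ := v p.1 - v p.2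

/-- The symmetric form of pure jump type with jump measure `Λ`. -/
def jumpForm (Λ : Measure (Ω × Ω)) (v w : Ω → ℝ) : ℝ := ∫ p, incr v p * incr w p ∂Λ

/-- Functions of finite energy which are integrable to the power `1 + 1/m`. -/
structure FormTest (ν : Measure Ω) (Λ : Measure (Ω × Ω)) (m : ℝ) (ψ : Ω → ℝ) : Prop where
  meas : Measurable ψ
  int : Integrable (fun x => |ψ x| ^ (1 + 1 / m)) ν
  energy : Integrable (fun p => incr ψ p ^ 2) Λ

/-- `u` solves the stationary equation `A (u ^ m) = g`, where `A` is the operator of `jumpForm Λ`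
with respect to the measure `ν`. -/
structure StatSol (ν : Measure Ω) (Λ : Measure (Ω × Ω)) (m : ℝ) (u g : Ω → ℝ) : Prop where
  meas_u : Measurable u
  nonneg : ∀ x, 0 ≤ u x
  int_u : Integrable (fun x => u x ^ (m + 1)) ν
  energy : Integrable (fun p => incr (fun x => u x ^ m) p ^ 2) Λ
  meas_g : Measurable g
  int_g : Integrable (fun x => |g x| ^ (m + 1)) ν
  eqn : ∀ ψ, FormTest ν Λ m ψ → jumpForm Λ (fun x => u x ^ m) ψ = ∫ x, g x * ψ x ∂ν

variable {ν : Measure Ω} {Λ : Measure (Ω × Ω)} {m : ℝ}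

lemma measurable_incr {v : Ω → ℝ} (hv : Measurable v) : Measurable (incr v) :=
  (hv.comp measurable_fst).sub (hv.comp measurable_snd)

lemma integrable_mul_of_sq {α : Type*} [MeasurableSpace α] {μ : Measure α} {f g : α → ℝ}
    (hf : Measurable f) (hg : Measurable g)
    (hf2 : Integrable (fun x => f x ^ 2) μ) (hg2 : Integrable (fun x => g x ^ 2) μ) :
    Integrable (fun x => f x * g x) μ := by
  refine (hf2.add hg2).mono' (hf.mul hg).aestronglyMeasurable (Eventually.of_forall fun x => ?_)
  rw [Real.norm_eq_abs, abs_le]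
  constructor <;> simp only [Pi.add_apply] <;> nlinarith [sq_nonneg (f x + g x), sq_nonneg (f x - g x)]

lemma integrable_mul_of_conj {α : Type*} [MeasurableSpace α] {μ : Measure α} {f g : α → ℝ}
    (hm : 1 < m) (hf : Measurable f) (hg : Measurable g)
    (hf2 : Integrable (fun x => |f x| ^ (m + 1)) μ)
    (hg2 : Integrable (fun x => |g x| ^ (1 + 1 / m)) μ) :
    Integrable (fun x => f x * g x) μ := by
  refine (hf2.add hg2).mono' (hf.mul hg).aestronglyMeasurable (Eventually.of_forall fun x => ?_)
  rw [Real.norm_eq_abs, abs_mul]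
  exact mul_le_rpow_add_rpow hm (abs_nonneg _) (abs_nonneg _)

lemma FormTest.neg {ψ : Ω → ℝ} (h : FormTest ν Λ m ψ) : FormTest ν Λ m (fun x => -ψ x) where
  meas := h.meas.neg
  int := by simpa using h.int
  energy := by
    convert h.energy using 2 with p
    simp only [incr]; ring

lemma jumpForm_neg_right (v ψ : Ω → ℝ) : jumpForm Λ v (fun x => -ψ x) = -jumpForm Λ v ψ := by
  rw [jumpForm, jumpForm, ← integral_neg]
  congr 1; ext p; simp only [incr]; ring

/-- The density of the convex functional whose Euler-Lagrange equation is the resolvent equation. -/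
def resDens (m : ℝ) (f v : Ω → ℝ) (x : Ω) : ℝ :=
  m / (m + 1) * |v x| ^ (1 + 1 / m) - f x * v x + f x ^ (m + 1) / (m + 1)

/-- The convex functional whose Euler-Lagrange equation is the resolvent equation. -/
def resFun (ν : Measure Ω) (Λ : Measure (Ω × Ω)) (m h : ℝ) (f v : Ω → ℝ) : ℝ≥0∞ :=
  ∫⁻ x, ENNReal.ofReal (resDens m f v x) ∂ν
    + ∫⁻ p, ENNReal.ofReal (h / 2 * incr v p ^ 2) ∂Λ

lemma resDens_nonneg (hm : 1 < m) {f v : Ω → ℝ} (hf : ∀ x, 0 ≤ f x) (x : Ω) :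
    0 ≤ resDens m f v x := by
  have h := young_conj hm (hf x) (abs_nonneg (v x))
  have h2 : f x * v x ≤ f x * |v x| := mul_le_mul_of_nonneg_left (le_abs_self _) (hf x)
  simp only [resDens]; linarith

lemma measurable_resDens {f v : Ω → ℝ} (hf : Measurable f) (hv : Measurable v) :
    Measurable (resDens m f v) := by
  unfold resDens
  fun_prop

/-- Truncation to `[0, B ^ m]`. -/
def trunc (M r : ℝ) : ℝ := max 0 (min M r)

lemma trunc_nonneg (M r : ℝ) : 0 ≤ trunc M r := le_max_left _ _

lemma trunc_le {M : ℝ} (hM : 0 ≤ M) (r : ℝ) : trunc M r ≤ M := max_le hM (min_le_left _ _)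

lemma abs_trunc_sub_le (M r s : ℝ) : |trunc M r - trunc M s| ≤ |r - s| := by
  unfold trunc
  calc _ ≤ |min M r - min M s| := abs_max_sub_max_le_abs' _ _ _
    _ ≤ _ := abs_min_sub_min_le_abs' _ _ _
where
  abs_max_sub_max_le_abs' (a b c : ℝ) : |max c a - max c b| ≤ |a - b| := by
    simpa using abs_max_sub_max_le_max c a c b
  abs_min_sub_min_le_abs' (c a b : ℝ) : |min c a - min c b| ≤ |a - b| := by
    simpa using abs_min_sub_min_le_max c a c b

lemma resFun_trunc_le (hm : 1 < m) {h B : ℝ} (hh : 0 < h) (hB : 0 ≤ B) {f w : Ω → ℝ}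
    (hf : ∀ x, 0 ≤ f x) (hfB : ∀ x, f x ≤ B) :
    resFun ν Λ m h f (fun x => trunc (B ^ m) (w x)) ≤ resFun ν Λ m h f w := by
  have hm0 : 0 < m := by linarith
  refine add_le_add (lintegral_mono fun x => ENNReal.ofReal_le_ofReal ?_)
    (lintegral_mono fun p => ENNReal.ofReal_le_ofReal ?_)
  · simp only [resDens]
    have hM : 0 ≤ B ^ m := by positivity
    suffices m / (m + 1) * |trunc (B ^ m) (w x)| ^ (1 + 1 / m) - f x * trunc (B ^ m) (w x)
        ≤ m / (m + 1) * |w x| ^ (1 + 1 / m) - f x * w x by linarith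
    rcases le_or_gt (w x) 0 with h0 | h0
    · have : trunc (B ^ m) (w x) = 0 := by
        rw [trunc, max_eq_left ((min_le_right _ _).trans h0)]
      rw [this, abs_zero, Real.zero_rpow (by positivity)]
      have h1 : 0 ≤ m / (m + 1) * |w x| ^ (1 + 1 / m) := by positivity
      have h2 : f x * w x ≤ 0 := mul_nonpos_of_nonneg_of_nonpos (hf x) h0
      linarith
    · rcases le_or_gt (w x) (B ^ m) with h1 | h1
      · have : trunc (B ^ m) (w x) = w x := by
          rw [trunc, min_eq_right h1, max_eq_right h0.le]
        rw [this]
      · have : trunc (B ^ m) (w x) = B ^ m := by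
          rw [trunc, min_eq_left h1.le, max_eq_right hM]
        rw [this, abs_of_nonneg hM, abs_of_pos h0]
        have h2 := conj_tangent hm hM h0.le
        rw [← Real.rpow_mul hB, mul_one_div_cancel hm0.ne', Real.rpow_one] at h2
        have h3 : f x * (w x - B ^ m) ≤ B * (w x - B ^ m) :=
          mul_le_mul_of_nonneg_right (hfB x) (by linarith)
        linarith
  · have := abs_trunc_sub_le (B ^ m) (w p.1) (w p.2)
    have h2 := sq_le_sq.2 this
    simp only [incr]
    exact mul_le_mul_of_nonneg_left h2 (by positivity)

lemma resFun_midpoint (hm : 1 < m) {h B : ℝ} (hh : 0 < h) (hB : 0 < B) {f : Ω → ℝ}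
    (hf : ∀ x, 0 ≤ f x) (hfm : Measurable f) :
    ∃ c : ℝ, 0 < c ∧ ∀ v w : Ω → ℝ, Measurable v → Measurable w →
      (∀ x, 0 ≤ v x) → (∀ x, v x ≤ B ^ m) → (∀ x, 0 ≤ w x) → (∀ x, w x ≤ B ^ m) →
      resFun ν Λ m h f (fun x => (v x + w x) / 2) + resFun ν Λ m h f (fun x => (v x + w x) / 2)
        + ∫⁻ x, ENNReal.ofReal (c * (v x - w x) ^ 2) ∂ν
        ≤ resFun ν Λ m h f v + resFun ν Λ m h f w := by
  obtain ⟨c, hc, hgap⟩ := conj_midpoint_gap hm hB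
  refine ⟨2 * c, by positivity, fun v w hv hw hv0 hvB hw0 hwB => ?_⟩
  set M : Ω → ℝ := fun x => (v x + w x) / 2 with hM
  have hMm : Measurable M := (hv.add hw).div_const 2
  have h1 : ∫⁻ x, ENNReal.ofReal (resDens m f M x) ∂ν + ∫⁻ x, ENNReal.ofReal (resDens m f M x) ∂ν
      + ∫⁻ x, ENNReal.ofReal (2 * c * (v x - w x) ^ 2) ∂ν
      ≤ ∫⁻ x, ENNReal.ofReal (resDens m f v x) ∂ν
        + ∫⁻ x, ENNReal.ofReal (resDens m f w x) ∂ν := by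
    have mM := (measurable_resDens (m := m) hfm hMm).ennreal_ofReal
    have mv := (measurable_resDens (m := m) hfm hv).ennreal_ofReal
    rw [← lintegral_add_left mM, ← lintegral_add_left mv,
      ← lintegral_add_left (show Measurable fun x => ENNReal.ofReal (resDens m f M x)
        + ENNReal.ofReal (resDens m f M x) from mM.add mM)]
    refine lintegral_mono fun x => ?_
    have n1 := resDens_nonneg hm hf (v := M) x
    have n2 := resDens_nonneg hm hf (v := v) x
    have n3 := resDens_nonneg hm hf (v := w) x
    rw [← ENNReal.ofReal_add n1 n1, ← ENNReal.ofReal_add (by positivity) (by positivity),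
      ← ENNReal.ofReal_add n2 n3]
    apply ENNReal.ofReal_le_ofReal
    have := hgap (v x) (w x) (hv0 x) (hw0 x) (hvB x) (hwB x)
    simp only [resDens, hM]
    rw [abs_of_nonneg (hv0 x), abs_of_nonneg (hw0 x),
      abs_of_nonneg (by have := hv0 x; have := hw0 x; positivity)]
    nlinarith
  have h2 : ∫⁻ p, ENNReal.ofReal (h / 2 * incr M p ^ 2) ∂Λ
      + ∫⁻ p, ENNReal.ofReal (h / 2 * incr M p ^ 2) ∂Λ
      ≤ ∫⁻ p, ENNReal.ofReal (h / 2 * incr v p ^ 2) ∂Λ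
        + ∫⁻ p, ENNReal.ofReal (h / 2 * incr w p ^ 2) ∂Λ := by
    have mM := (((measurable_incr hMm).pow_const 2).const_mul (h / 2)).ennreal_ofReal
    have mv := (((measurable_incr hv).pow_const 2).const_mul (h / 2)).ennreal_ofReal
    rw [← lintegral_add_left mM, ← lintegral_add_left mv]
    refine lintegral_mono fun p => ?_
    rw [← ENNReal.ofReal_add (by positivity) (by positivity),
      ← ENNReal.ofReal_add (by positivity) (by positivity)]
    apply ENNReal.ofReal_le_ofReal
    have e : incr M p = (incr v p + incr w p) / 2 := by simp only [incr, hM]; ring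
    rw [e]
    nlinarith [sq_nonneg (incr v p - incr w p), mul_nonneg hh.le (sq_nonneg (incr v p - incr w p))]
  simp only [resFun]
  calc _ = (∫⁻ x, ENNReal.ofReal (resDens m f M x) ∂ν
            + ∫⁻ x, ENNReal.ofReal (resDens m f M x) ∂ν
            + ∫⁻ x, ENNReal.ofReal (2 * c * (v x - w x) ^ 2) ∂ν)
          + (∫⁻ p, ENNReal.ofReal (h / 2 * incr M p ^ 2) ∂Λ
            + ∫⁻ p, ENNReal.ofReal (h / 2 * incr M p ^ 2) ∂Λ) := by ring
    _ ≤ _ := add_le_add h1 h2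
    _ = _ := by ring

end JumpForms

section Minimizer

lemma ae_tendsto_of_lintegral_sq_le {α : Type*} [MeasurableSpace α] {μ : Measure α}
    {F : ℕ → α → ℝ} (hF : ∀ n, Measurable (F n))
    (h : ∀ N n k, N ≤ n → N ≤ k →
      ∫⁻ x, ENNReal.ofReal ((F n x - F k x) ^ 2) ∂μ ≤ ENNReal.ofReal ((1 / 4) ^ N)) :
    ∀ᵐ x ∂μ, ∃ l, Tendsto (fun n => F n x) atTop (𝓝 l) := by
  refine Lp.ae_tendsto_of_cauchy_eLpNorm' (p := 2) (B := fun N => ENNReal.ofReal (2 * (1 / 2) ^ N))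
    (fun n => (hF n).aestronglyMeasurable) (by norm_num) ?_ ?_
  · rw [← ENNReal.ofReal_tsum_of_nonneg (fun n => by positivity)
      ((summable_geometric_of_lt_one (by norm_num) (by norm_num)).mul_left 2)]
    exact ENNReal.ofReal_ne_top
  · intro N n k hn hk
    have e : eLpNorm' (F n - F k) 2 μ
        = (∫⁻ x, ENNReal.ofReal ((F n x - F k x) ^ 2) ∂μ) ^ (1 / 2 : ℝ) := by
      rw [eLpNorm'_eq_lintegral_enorm]
      congr 1
      refine lintegral_congr fun x => ?_
      rw [Pi.sub_apply, Real.enorm_eq_ofReal_abs, ENNReal.ofReal_rpow_of_nonneg (abs_nonneg _)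
        (by norm_num), Real.rpow_two, sq_abs]
    rw [e]
    calc _ ≤ (ENNReal.ofReal ((1 / 4) ^ N)) ^ (1 / 2 : ℝ) :=
          ENNReal.rpow_le_rpow (h N n k hn hk) (by norm_num)
      _ = ENNReal.ofReal ((1 / 2) ^ N) := by
          rw [ENNReal.ofReal_rpow_of_nonneg (by positivity) (by norm_num)]
          congr 1
          rw [← Real.sqrt_eq_rpow, show (1 / 4 : ℝ) ^ N = ((1 / 2) ^ N) ^ 2 by
            rw [← pow_mul, mul_comm, pow_mul]; norm_num]
          exact Real.sqrt_sq (by positivity)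
      _ < _ := by
          refine (ENNReal.ofReal_lt_ofReal_iff (by positivity)).2 ?_
          have : (0 : ℝ) < (1 / 2) ^ N := by positivity
          linarith

variable {Ω : Type*} [MeasurableSpace Ω] {ν : Measure Ω} {Λ : Measure (Ω × Ω)} {m : ℝ}

/-- The coordinate projections pull null sets of `ν` back to null sets of `Λ`, and bounded
functions of finite energy are dense in `L¹`. -/
structure JumpSpace (ν : Measure Ω) (Λ : Measure (Ω × Ω)) (m : ℝ) : Prop where
  fst : Measure.QuasiMeasurePreserving Prod.fst Λ ν
  snd : Measure.QuasiMeasurePreserving Prod.snd Λ ν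
  dense : ∀ f : Ω → ℝ, Integrable f ν → ∀ ε : ℝ, 0 < ε → ∃ ψ, FormTest ν Λ m ψ ∧
    (∃ C, ∀ x, |ψ x| ≤ C) ∧ Integrable (fun x => |f x - ψ x|) ν ∧ ∫ x, |f x - ψ x| ∂ν ≤ ε

lemma JumpSpace.ae_tendsto_incr (hJ : JumpSpace ν Λ m) {F : ℕ → Ω → ℝ} {f : Ω → ℝ}
    (h : ∀ᵐ x ∂ν, Tendsto (fun n => F n x) atTop (𝓝 (f x))) :
    ∀ᵐ p ∂Λ, Tendsto (fun n => incr (F n) p) atTop (𝓝 (incr f p)) := by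
  filter_upwards [hJ.fst.ae h, hJ.snd.ae h] with p h1 h2
  exact h1.sub h2

lemma integrable_rpow_of_le {r B : ℝ} (hr : 1 ≤ r) {f : Ω → ℝ}
    (hfm : Measurable f) (hf : ∀ x, 0 ≤ f x) (hfB : ∀ x, f x ≤ B) (hfi : Integrable f ν) :
    Integrable (fun x => f x ^ r) ν := by
  refine (hfi.const_mul (B ^ (r - 1))).mono' (hfm.pow_const r).aestronglyMeasurable
    (Eventually.of_forall fun x => ?_)
  rw [Real.norm_eq_abs, abs_of_nonneg (Real.rpow_nonneg (hf x) _)]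
  rcases (hf x).eq_or_lt with h | h
  · rw [← h, Real.zero_rpow (by linarith), mul_zero]
  · calc f x ^ r = f x ^ (r - 1) * f x := by
          conv_rhs => rw [← Real.rpow_one (f x), ← Real.rpow_mul (hf x), ← Real.rpow_add h]
          congr 1; ring
      _ ≤ _ := by
        refine mul_le_mul_of_nonneg_right (Real.rpow_le_rpow (hf x) (hfB x) (by linarith)) (hf x)

lemma resFun_zero_ne_top (hm : 1 < m) {h B : ℝ} {f : Ω → ℝ}
    (hfm : Measurable f) (hf : ∀ x, 0 ≤ f x) (hfB : ∀ x, f x ≤ B) (hfi : Integrable f ν) :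
    resFun ν Λ m h f (fun _ => 0) ≠ ⊤ := by
  have hm0 : 0 < m := by linarith
  have e : resDens m f (fun _ => 0) = fun x => f x ^ (m + 1) / (m + 1) := by
    ext x
    simp only [resDens, abs_zero]
    rw [Real.zero_rpow (by positivity)]; ring
  simp only [resFun, e, incr, sub_self]
  norm_num
  have := (integrable_rpow_of_le (by linarith : 1 ≤ m + 1) hfm hf hfB hfi).div_const (m + 1)
  exact this.lintegral_lt_top.ne

lemma resFun_le_liminf (hJ : JumpSpace ν Λ m) {h : ℝ} {f : Ω → ℝ} (hfm : Measurable f) (hm : 1 < m)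
    {F : ℕ → Ω → ℝ} {v : Ω → ℝ} (hF : ∀ n, Measurable (F n))
    (hv : ∀ᵐ x ∂ν, Tendsto (fun n => F n x) atTop (𝓝 (v x))) :
    resFun ν Λ m h f v ≤ liminf (fun n => resFun ν Λ m h f (F n)) atTop := by
  have hm0 : 0 < m := by linarith
  refine le_trans (add_le_add ?_ ?_) (ENNReal.liminf_add_liminf_le _ _)
  · refine lintegral_ofReal_le_liminf (fun n => measurable_resDens hfm (hF n)) ?_
    filter_upwards [hv] with x hx
    have : Tendsto (fun n => |F n x| ^ (1 + 1 / m)) atTop (𝓝 (|v x| ^ (1 + 1 / m))) :=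
      hx.abs.rpow_const (Or.inr (by positivity))
    exact ((this.const_mul _).sub (hx.const_mul _)).add_const _
  · refine lintegral_ofReal_le_liminf
      (fun n => ((measurable_incr (hF n)).pow_const 2).const_mul _) ?_
    filter_upwards [hJ.ae_tendsto_incr hv] with p hp
    exact (hp.pow 2).const_mul _

lemma exists_resFun_min (hJ : JumpSpace ν Λ m) (hm : 1 < m) {h B : ℝ} (hh : 0 < h) (hB : 0 < B)
    {f : Ω → ℝ} (hfm : Measurable f) (hf : ∀ x, 0 ≤ f x) (hfB : ∀ x, f x ≤ B)
    (hfi : Integrable f ν) :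
    ∃ v : Ω → ℝ, Measurable v ∧ (∀ x, 0 ≤ v x) ∧ (∀ x, v x ≤ B ^ m) ∧
      resFun ν Λ m h f v ≠ ⊤ ∧
      ∀ w : Ω → ℝ, Measurable w → resFun ν Λ m h f v ≤ resFun ν Λ m h f w := by
  have hBm : 0 ≤ B ^ m := by positivity
  obtain ⟨c, hc, hmid⟩ := resFun_midpoint (ν := ν) (Λ := Λ) hm hh hB hf hfm
  set j : ℝ≥0∞ := ⨅ w : {w : Ω → ℝ // Measurable w}, resFun ν Λ m h f w with hj
  have hj_le : ∀ w : Ω → ℝ, Measurable w → j ≤ resFun ν Λ m h f w :=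
    fun w hw => iInf_le (fun w : {w : Ω → ℝ // Measurable w} => resFun ν Λ m h f w) ⟨w, hw⟩
  have hjtop : j ≠ ⊤ := ne_top_of_le_ne_top (resFun_zero_ne_top hm hfm hf hfB hfi)
    (hj_le _ measurable_const)
  have hex : ∀ n : ℕ, ∃ v : Ω → ℝ, Measurable v ∧ (∀ x, 0 ≤ v x) ∧ (∀ x, v x ≤ B ^ m) ∧
      resFun ν Λ m h f v ≤ j + ENNReal.ofReal (c / 2 * (1 / 4) ^ n) := by
    intro n
    have : j < j + ENNReal.ofReal (c / 2 * (1 / 4) ^ n) :=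
      ENNReal.lt_add_right hjtop (by rw [Ne, ENNReal.ofReal_eq_zero, not_le]; positivity)
    obtain ⟨⟨w, hw⟩, hlt⟩ := iInf_lt_iff.1 this
    refine ⟨fun x => trunc (B ^ m) (w x), ?_, fun x => trunc_nonneg _ _, fun x => trunc_le hBm _,
      (resFun_trunc_le hm hh hB.le hf hfB).trans hlt.le⟩
    exact measurable_const.max (measurable_const.min hw)
  choose F hF hF0 hFB hFj using hex
  have hlim : ∀ᵐ x ∂ν, ∃ l, Tendsto (fun n => F n x) atTop (𝓝 l) := by
    refine ae_tendsto_of_lintegral_sq_le hF fun N n k hn hk => ?_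
    have h1 := hmid (F n) (F k) (hF n) (hF k) (hF0 n) (hFB n) (hF0 k) (hFB k)
    have h2 := hj_le (fun x => (F n x + F k x) / 2) (((hF n).add (hF k)).div_const 2)
    have mono : ∀ i, N ≤ i → resFun ν Λ m h f (F i) ≤ j + ENNReal.ofReal (c / 2 * (1 / 4) ^ N) := by
      intro i hi
      refine (hFj i).trans (add_le_add le_rfl (ENNReal.ofReal_le_ofReal ?_))
      exact mul_le_mul_of_nonneg_left
        (pow_le_pow_of_le_one (by norm_num) (by norm_num) hi) (by positivity)
    have h3 : j + j + ∫⁻ x, ENNReal.ofReal (c * (F n x - F k x) ^ 2) ∂ν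
        ≤ j + j + ENNReal.ofReal (c * (1 / 4) ^ N) := by
      calc _ ≤ _ := add_le_add (add_le_add h2 h2) le_rfl
        _ ≤ _ := h1
        _ ≤ _ := add_le_add (mono n hn) (mono k hk)
        _ = j + j + (ENNReal.ofReal (c / 2 * (1 / 4) ^ N)
            + ENNReal.ofReal (c / 2 * (1 / 4) ^ N)) := by ring
        _ = _ := by
          rw [← ENNReal.ofReal_add (by positivity) (by positivity)]
          congr 2; ring
    have h4 := (ENNReal.add_le_add_iff_left (by simp [hjtop])).1 h3
    have e : ∀ x, ENNReal.ofReal (c * (F n x - F k x) ^ 2)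
        = ENNReal.ofReal c * ENNReal.ofReal ((F n x - F k x) ^ 2) :=
      fun x => ENNReal.ofReal_mul hc.le
    simp only [e] at h4
    rw [lintegral_const_mul' _ _ ENNReal.ofReal_ne_top,
      ENNReal.ofReal_mul hc.le] at h4
    exact (ENNReal.mul_le_mul_iff_right (by rw [Ne, ENNReal.ofReal_eq_zero, not_le]; exact hc)
      ENNReal.ofReal_ne_top).1 h4
  have hle : resFun ν Λ m h f (limClip (B ^ m) F) ≤ j := by
    refine (resFun_le_liminf hJ hfm hm hF (hlim.mono fun x hx =>
      tendsto_limClip (fun n => hF0 n x) (fun n => hFB n x) hx)).trans ?_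
    have ht : Tendsto (fun n : ℕ => j + ENNReal.ofReal (c / 2 * (1 / 4) ^ n)) atTop (𝓝 (j + 0)) := by
      refine tendsto_const_nhds.add ?_
      rw [← ENNReal.ofReal_zero]
      refine (ENNReal.continuous_ofReal.tendsto _).comp ?_
      simpa using (tendsto_pow_atTop_nhds_zero_of_lt_one (by norm_num : (0 : ℝ) ≤ 1 / 4)
        (by norm_num)).const_mul (c / 2)
    rw [add_zero] at ht
    calc _ ≤ liminf (fun n : ℕ => j + ENNReal.ofReal (c / 2 * (1 / 4) ^ n)) atTop :=
          liminf_le_liminf (Eventually.of_forall hFj)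
      _ = j := ht.liminf_eq
  exact ⟨limClip (B ^ m) F, measurable_limClip hF, limClip_nonneg _ _, limClip_le hBm _,
    ne_top_of_le_ne_top hjtop hle, fun w hw => hle.trans (hj_le w hw)⟩

end Minimizer

section EulerLagrange

variable {Ω : Type*} [MeasurableSpace Ω] {ν : Measure Ω} {Λ : Measure (Ω × Ω)} {m : ℝ}

lemma integral_add_add {α : Type*} [MeasurableSpace α] {μ : Measure α} {f g k : α → ℝ}
    (hf : Integrable f μ) (hg : Integrable g μ) (hk : Integrable k μ) :
    ∫ x, f x + g x + k x ∂μ = ∫ x, f x ∂μ + ∫ x, g x ∂μ + ∫ x, k x ∂μ := by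
  rw [← integral_add hf hg]
  exact integral_add (hf.add hg) hk

lemma resFun_variation (hm : 1 < m) {h B : ℝ} (hh : 0 < h)
    {f v : Ω → ℝ} (hfm : Measurable f) (hf : ∀ x, 0 ≤ f x) (hfB : ∀ x, f x ≤ B)
    (hfi : Integrable f ν) (hv : FormTest ν Λ m v) (hv0 : ∀ x, 0 ≤ v x)
    (hui : Integrable (fun x => |v x ^ (1 / m)| ^ (m + 1)) ν)
    (hri : Integrable (resDens m f v) ν)
    (hmin : ∀ w : Ω → ℝ, Measurable w → resFun ν Λ m h f v ≤ resFun ν Λ m h f w)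
    {ψ : Ω → ℝ} (hψ : FormTest ν Λ m ψ) :
    0 ≤ ∫ x, (v x ^ (1 / m) - f x) * ψ x ∂ν + h * jumpForm Λ v ψ := by
  have hm0 : 0 < m := by linarith
  set P := ∫ x, |ψ x| ^ (1 + 1 / m) ∂ν with hP
  set E := ∫ p, incr ψ p ^ 2 ∂Λ with hE
  set L := ∫ x, (v x ^ (1 / m) - f x) * ψ x ∂ν + h * jumpForm Λ v ψ with hL
  have huψ : Integrable (fun x => v x ^ (1 / m) * ψ x) ν :=
    integrable_mul_of_conj hm (hv.meas.pow_const _) hψ.meas hui hψ.int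
  have hfψ : Integrable (fun x => f x * ψ x) ν := by
    refine integrable_mul_of_conj hm hfm hψ.meas ?_ hψ.int
    simpa only [abs_of_nonneg (hf _)] using
      integrable_rpow_of_le (by linarith : 1 ≤ m + 1) hfm hf hfB hfi
  have hdψ : Integrable (fun x => (v x ^ (1 / m) - f x) * ψ x) ν := by
    simp only [sub_mul]; exact huψ.sub hfψ
  have hvψ : Integrable (fun p => incr v p * incr ψ p) Λ :=
    integrable_mul_of_sq (measurable_incr hv.meas) (measurable_incr hψ.meas) hv.energy hψ.energy
  have key : ∀ t : ℝ, 0 < t → 0 ≤ L + (2 * P * t ^ (1 / m) + h / 2 * E * t) := by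
    intro t ht
    have h1 := hmin (fun x => v x + t * ψ x) (hv.meas.add (hψ.meas.const_mul t))
    have iG : Integrable (fun x => resDens m f v x + t * ((v x ^ (1 / m) - f x) * ψ x)
        + 2 * t ^ (1 + 1 / m) * |ψ x| ^ (1 + 1 / m)) ν :=
      (hri.add (hdψ.const_mul t)).add (hψ.int.const_mul _)
    have iE : Integrable (fun p => h / 2 * incr v p ^ 2 + h * t * (incr v p * incr ψ p)
        + h / 2 * t ^ 2 * incr ψ p ^ 2) Λ :=
      ((hv.energy.const_mul _).add (hvψ.const_mul _)).add (hψ.energy.const_mul _)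
    have pG : ∀ x, resDens m f (fun x => v x + t * ψ x) x
        ≤ resDens m f v x + t * ((v x ^ (1 / m) - f x) * ψ x)
        + 2 * t ^ (1 + 1 / m) * |ψ x| ^ (1 + 1 / m) := by
      intro x
      have h2 := conj_expansion hm (hv0 x) (t * ψ x)
      rw [abs_mul, abs_of_pos ht, Real.mul_rpow ht.le (abs_nonneg _)] at h2
      simp only [resDens, abs_of_nonneg (hv0 x)]
      linarith
    have pE : ∀ p, h / 2 * incr (fun x => v x + t * ψ x) p ^ 2
        = h / 2 * incr v p ^ 2 + h * t * (incr v p * incr ψ p)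
        + h / 2 * t ^ 2 * incr ψ p ^ 2 := by
      intro p; simp only [incr]; ring
    have nG : ∀ x, 0 ≤ resDens m f v x + t * ((v x ^ (1 / m) - f x) * ψ x)
        + 2 * t ^ (1 + 1 / m) * |ψ x| ^ (1 + 1 / m) :=
      fun x => (resDens_nonneg hm hf x).trans (pG x)
    have nE : ∀ p, 0 ≤ h / 2 * incr v p ^ 2 + h * t * (incr v p * incr ψ p)
        + h / 2 * t ^ 2 * incr ψ p ^ 2 := fun p => by rw [← pE]; positivity
    have h2 : resFun ν Λ m h f (fun x => v x + t * ψ x) ≤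
        ENNReal.ofReal (∫ x, resDens m f v x + t * ((v x ^ (1 / m) - f x) * ψ x)
          + 2 * t ^ (1 + 1 / m) * |ψ x| ^ (1 + 1 / m) ∂ν)
        + ENNReal.ofReal (∫ p, h / 2 * incr v p ^ 2 + h * t * (incr v p * incr ψ p)
          + h / 2 * t ^ 2 * incr ψ p ^ 2 ∂Λ) := by
      rw [← lintegral_ofReal_eq iG nG, ← lintegral_ofReal_eq iE nE, resFun]
      refine add_le_add (lintegral_mono fun x => ENNReal.ofReal_le_ofReal (pG x)) ?_
      simp only [pE]; exact le_rfl
    have h3 := h1.trans h2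
    rw [resFun, lintegral_ofReal_eq hri (resDens_nonneg hm hf),
      lintegral_ofReal_eq (hv.energy.const_mul _) (fun p => by positivity),
      ← ENNReal.ofReal_add (integral_nonneg (resDens_nonneg hm hf))
        (integral_nonneg fun p => by positivity),
      ← ENNReal.ofReal_add (integral_nonneg nG) (integral_nonneg nE),
      ENNReal.ofReal_le_ofReal_iff (add_nonneg (integral_nonneg nG) (integral_nonneg nE)),
      integral_add_add hri (hdψ.const_mul t) (hψ.int.const_mul _),
      integral_add_add (hv.energy.const_mul _) (hvψ.const_mul _) (hψ.energy.const_mul _)] at h3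
    simp only [integral_const_mul] at h3
    have e1 : t ^ (1 + 1 / m) = t * t ^ (1 / m) := by
      rw [Real.rpow_add ht, Real.rpow_one]
    have e2 : jumpForm Λ v ψ = ∫ p, incr v p * incr ψ p ∂Λ := rfl
    rw [e1, ← e2, ← hP, ← hE] at h3
    have h4 : 0 ≤ t * (L + (2 * P * t ^ (1 / m) + h / 2 * E * t)) := by
      rw [hL]; linarith
    exact nonneg_of_mul_nonneg_right h4 ht
  have ht : Tendsto (fun t : ℝ => L + (2 * P * t ^ (1 / m) + h / 2 * E * t)) (𝓝[>] 0)
      (𝓝 (L + (2 * P * 0 + h / 2 * E * 0))) := by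
    have i1 : Tendsto (fun t : ℝ => t) (𝓝[>] 0) (𝓝 0) := nhdsWithin_le_nhds
    have i2 : Tendsto (fun t : ℝ => t ^ (1 / m)) (𝓝[>] 0) (𝓝 0) := by
      have := i1.rpow_const (p := 1 / m) (Or.inr (by positivity))
      rwa [Real.zero_rpow (by positivity)] at this
    exact tendsto_const_nhds.add ((i2.const_mul _).add (i1.const_mul _))
  have := ge_of_tendsto ht (eventually_nhdsWithin_of_forall fun t ht => key t ht)
  simpa using this

theorem exists_resolvent (hJ : JumpSpace ν Λ m) (hm : 1 < m) {h B : ℝ} (hh : 0 < h) (hB : 0 < B)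
    {f : Ω → ℝ} (hfm : Measurable f) (hf : ∀ x, 0 ≤ f x) (hfB : ∀ x, f x ≤ B)
    (hfi : Integrable f ν) :
    ∃ u : Ω → ℝ, (∀ x, u x ≤ B) ∧ StatSol ν Λ m u (fun x => (f x - u x) / h) := by
  have hm0 : 0 < m := by linarith
  obtain ⟨v, hvm, hv0, hvB, hvtop, hmin⟩ := exists_resFun_min hJ hm hh hB hfm hf hfB hfi
  have htop := ENNReal.add_ne_top.1 hvtop
  have hfp := integrable_rpow_of_le (by linarith : 1 ≤ m + 1) hfm hf hfB hfi
  have hri : Integrable (resDens m f v) ν := integrable_of_lintegral_ofReal_ne_top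
    (measurable_resDens hfm hvm) (resDens_nonneg hm hf) htop.1
  have hen : Integrable (fun p => incr v p ^ 2) Λ := by
    have := (integrable_of_lintegral_ofReal_ne_top
      (((measurable_incr hvm).pow_const 2).const_mul (h / 2)) (fun p => by positivity)
      htop.2).const_mul (2 / h)
    refine this.congr (Eventually.of_forall fun p => ?_)
    field_simp
  have hfv : Integrable (fun x => f x * v x) ν := by
    refine (hfi.mul_const (B ^ m)).mono' (hfm.mul hvm).aestronglyMeasurable
      (Eventually.of_forall fun x => ?_)
    rw [Real.norm_eq_abs, abs_of_nonneg (mul_nonneg (hf x) (hv0 x))]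
    exact mul_le_mul_of_nonneg_left (hvB x) (hf x)
  have hvp : Integrable (fun x => |v x| ^ (1 + 1 / m)) ν := by
    have := ((hri.add hfv).sub (hfp.div_const (m + 1))).const_mul ((m + 1) / m)
    refine this.congr (Eventually.of_forall fun x => ?_)
    simp only [Pi.sub_apply, Pi.add_apply, resDens]
    field_simp
    ring
  have hv : FormTest ν Λ m v := ⟨hvm, hvp, hen⟩
  have e1 : ∀ x, |v x ^ (1 / m)| ^ (m + 1) = |v x| ^ (1 + 1 / m) := fun x => by
    rw [abs_of_nonneg (Real.rpow_nonneg (hv0 x) _), rpow_inv_rpow_add_one hm (hv0 x),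
      abs_of_nonneg (hv0 x)]
  have hui : Integrable (fun x => |v x ^ (1 / m)| ^ (m + 1)) ν := by simpa only [e1] using hvp
  have e2 : (fun x => (v x ^ (1 / m)) ^ m) = v := by
    ext x
    rw [← Real.rpow_mul (hv0 x), one_div_mul_cancel hm0.ne', Real.rpow_one]
  have hum : Measurable fun x => v x ^ (1 / m) := hvm.pow_const _
  refine ⟨fun x => v x ^ (1 / m), fun x => ?_, hum, fun x => Real.rpow_nonneg (hv0 x) _, ?_, ?_,
    (hfm.sub hum).div_const h, ?_, fun ψ hψ => ?_⟩
  · calc v x ^ (1 / m) ≤ (B ^ m) ^ (1 / m) :=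
        Real.rpow_le_rpow (hv0 x) (hvB x) (by positivity)
      _ = B := by rw [← Real.rpow_mul hB.le, mul_one_div_cancel hm0.ne', Real.rpow_one]
  · refine hui.congr (Eventually.of_forall fun x => ?_)
    simp only [abs_of_nonneg (Real.rpow_nonneg (hv0 x) _)]
  · simpa only [e2] using hen
  · refine ((hfp.add hui).div_const (h ^ (m + 1))).mono'
      (((hfm.sub hum).div_const h).abs.pow_const _).aestronglyMeasurable
      (Eventually.of_forall fun x => ?_)
    have hu0 : 0 ≤ v x ^ (1 / m) := Real.rpow_nonneg (hv0 x) _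
    simp only [Pi.add_apply]
    rw [Real.norm_eq_abs, abs_of_nonneg (by positivity), abs_div, abs_of_pos hh,
      Real.div_rpow (abs_nonneg _) hh.le, abs_of_nonneg hu0]
    gcongr
    have h0 := hf x
    rcases le_total (f x) (v x ^ (1 / m)) with hle | hle
    · rw [abs_of_nonpos (by linarith)]
      have : (-(f x - v x ^ (1 / m))) ^ (m + 1) ≤ (v x ^ (1 / m)) ^ (m + 1) :=
        Real.rpow_le_rpow (by linarith) (by linarith) (by linarith)
      linarith [Real.rpow_nonneg h0 (m + 1)]
    · rw [abs_of_nonneg (by linarith)]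
      have : (f x - v x ^ (1 / m)) ^ (m + 1) ≤ (f x) ^ (m + 1) :=
        Real.rpow_le_rpow (by linarith) (by linarith) (by linarith)
      linarith [Real.rpow_nonneg hu0 (m + 1)]
  · rw [e2]
    have h1 := resFun_variation hm hh hfm hf hfB hfi hv hv0 hui hri hmin hψ
    have h2 := resFun_variation hm hh hfm hf hfB hfi hv hv0 hui hri hmin hψ.neg
    rw [jumpForm_neg_right] at h2
    simp only [mul_neg, integral_neg] at h2
    have e3 : ∫ x, (f x - v x ^ (1 / m)) / h * ψ x ∂ν
        = -(1 / h) * ∫ x, (v x ^ (1 / m) - f x) * ψ x ∂ν := by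
      rw [← integral_const_mul]; congr 1; ext x; ring
    rw [e3]
    have : h * jumpForm Λ v ψ = -∫ x, (v x ^ (1 / m) - f x) * ψ x ∂ν := by linarith
    field_simp
    linarith

end EulerLagrange

section Accretivity

/-- Truncation to `[-1, 1]`. -/
def clip (r : ℝ) : ℝ := max (-1) (min 1 r)

lemma abs_clip_le_one (r : ℝ) : |clip r| ≤ 1 :=
  abs_le.2 ⟨le_max_left _ _, max_le (by norm_num) (min_le_left _ _)⟩

lemma monotone_clip : Monotone clip := fun _ _ h => max_le_max le_rfl (min_le_min le_rfl h)

lemma clip_zero : clip 0 = 0 := by norm_num [clip]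

lemma abs_clip_sub_le (r s : ℝ) : |clip r - clip s| ≤ |r - s| := by
  unfold clip
  calc _ ≤ |min 1 r - min 1 s| := by
        simpa using abs_max_sub_max_le_max (-1) (min 1 r) (-1) (min 1 s)
    _ ≤ _ := by simpa using abs_min_sub_min_le_max 1 r 1 s

lemma measurable_clip : Measurable clip := measurable_const.max (measurable_const.min measurable_id)

lemma tendsto_clip_nat_mul (r : ℝ) :
    Tendsto (fun n : ℕ => clip (n * r)) atTop (𝓝 (SignType.sign r : ℝ)) := by
  rcases lt_trichotomy r 0 with h | h | h
  · rw [sign_neg h]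
    refine tendsto_const_nhds.congr' ?_
    have := (tendsto_natCast_atTop_atTop (R := ℝ)).atTop_mul_const_of_neg h
    filter_upwards [this.eventually_le_atBot (-1)] with n hn
    rw [clip, min_eq_right (by linarith), max_eq_left hn]
    simp
  · subst h; simp [clip_zero]
  · rw [sign_pos h]
    refine tendsto_const_nhds.congr' ?_
    have := (tendsto_natCast_atTop_atTop (R := ℝ)).atTop_mul_const h
    filter_upwards [this.eventually_ge_atTop 1] with n hn
    rw [clip, min_eq_left hn, max_eq_right (by norm_num)]
    simp

lemma abs_sub_rpow_le_two_mul {p : ℝ} (hp : 0 ≤ p) (a b : ℝ) :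
    |a - b| ^ p ≤ 2 ^ p * (|a| ^ p + |b| ^ p) := by
  have h1 : |a - b| ≤ 2 * max |a| |b| := by
    have := abs_sub a b
    linarith [le_max_left |a| |b|, le_max_right |a| |b|]
  have h2 : |a - b| ^ p ≤ (2 * max |a| |b|) ^ p := Real.rpow_le_rpow (abs_nonneg _) h1 hp
  rw [Real.mul_rpow (by norm_num) (le_max_of_le_left (abs_nonneg _))] at h2
  refine h2.trans (mul_le_mul_of_nonneg_left ?_ (by positivity))
  rcases le_total |a| |b| with h | h
  · rw [max_eq_right h]; linarith [Real.rpow_nonneg (abs_nonneg a) p]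
  · rw [max_eq_left h]; linarith [Real.rpow_nonneg (abs_nonneg b) p]

variable {Ω : Type*} [MeasurableSpace Ω] {ν : Measure Ω} {Λ : Measure (Ω × Ω)} {m : ℝ}

lemma FormTest.sub (hm : 1 < m) {ψ φ : Ω → ℝ} (hψ : FormTest ν Λ m ψ) (hφ : FormTest ν Λ m φ) :
    FormTest ν Λ m (fun x => ψ x - φ x) where
  meas := hψ.meas.sub hφ.meas
  int := by
    have : 0 ≤ 1 + 1 / m := by positivity
    refine ((hψ.int.add hφ.int).const_mul (2 ^ (1 + 1 / m))).mono'
      ((hψ.meas.sub hφ.meas).abs.pow_const _).aestronglyMeasurable (Eventually.of_forall fun x => ?_)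
    rw [Real.norm_eq_abs, abs_of_nonneg (Real.rpow_nonneg (abs_nonneg _) _)]
    exact abs_sub_rpow_le_two_mul this _ _
  energy := by
    refine ((hψ.energy.add hφ.energy).const_mul 2).mono'
      ((measurable_incr (hψ.meas.sub hφ.meas)).pow_const _).aestronglyMeasurable
      (Eventually.of_forall fun p => ?_)
    rw [Real.norm_eq_abs, abs_of_nonneg (sq_nonneg _)]
    simp only [incr, Pi.add_apply]
    nlinarith [sq_nonneg ((ψ p.1 - ψ p.2) + (φ p.1 - φ p.2))]

lemma FormTest.clip_mul (hm : 1 < m) {ψ : Ω → ℝ} (hψ : FormTest ν Λ m ψ) (k : ℝ) :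
    FormTest ν Λ m (fun x => clip (k * ψ x)) where
  meas := measurable_clip.comp (hψ.meas.const_mul k)
  int := by
    have : 0 ≤ 1 + 1 / m := by positivity
    refine (hψ.int.const_mul (|k| ^ (1 + 1 / m))).mono'
      ((measurable_clip.comp (hψ.meas.const_mul k)).abs.pow_const _).aestronglyMeasurable
      (Eventually.of_forall fun x => ?_)
    rw [Real.norm_eq_abs, abs_of_nonneg (Real.rpow_nonneg (abs_nonneg _) _),
      ← Real.mul_rpow (abs_nonneg _) (abs_nonneg _), ← abs_mul]
    refine Real.rpow_le_rpow (abs_nonneg _) ?_ this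
    simpa [clip_zero] using abs_clip_sub_le (k * ψ x) 0
  energy := by
    refine (hψ.energy.const_mul (k ^ 2)).mono'
      ((measurable_incr (measurable_clip.comp (hψ.meas.const_mul k))).pow_const _).aestronglyMeasurable
      (Eventually.of_forall fun p => ?_)
    rw [Real.norm_eq_abs, abs_of_nonneg (sq_nonneg _), ← mul_pow]
    refine sq_le_sq.2 ?_
    simp only [incr, mul_sub]
    exact abs_clip_sub_le _ _

lemma StatSol.formTest (hm : 1 < m) {u g : Ω → ℝ} (h : StatSol ν Λ m u g) :
    FormTest ν Λ m (fun x => u x ^ m) where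
  meas := h.meas_u.pow_const m
  int := by
    refine h.int_u.congr (Eventually.of_forall fun x => ?_)
    have := h.nonneg x
    have hm0 : m ≠ 0 := by linarith
    simp only
    rw [abs_of_nonneg (Real.rpow_nonneg this _), ← Real.rpow_mul this]
    congr 1; field_simp
  energy := h.energy

lemma StatSol.int_abs_u {u g : Ω → ℝ} (h : StatSol ν Λ m u g) :
    Integrable (fun x => |u x| ^ (m + 1)) ν := by
  simpa only [abs_of_nonneg (h.nonneg _)] using h.int_u

lemma jumpForm_sub_left {v w ψ : Ω → ℝ} (hv : FormTest ν Λ m v) (hw : FormTest ν Λ m w)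
    (hψ : FormTest ν Λ m ψ) :
    jumpForm Λ v ψ - jumpForm Λ w ψ = jumpForm Λ (fun x => v x - w x) ψ := by
  rw [jumpForm, jumpForm, jumpForm, ← integral_sub
    (integrable_mul_of_sq (measurable_incr hv.meas) (measurable_incr hψ.meas) hv.energy hψ.energy)
    (integrable_mul_of_sq (measurable_incr hw.meas) (measurable_incr hψ.meas) hw.energy hψ.energy)]
  congr 1; ext p; simp only [incr]; ring

theorem StatSol.accretive (hm : 1 < m) {u₁ g₁ u₂ g₂ : Ω → ℝ} (h₁ : StatSol ν Λ m u₁ g₁)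
    (h₂ : StatSol ν Λ m u₂ g₂) {l : ℝ} (hl : 0 ≤ l) :
    ∫⁻ x, ENNReal.ofReal |u₁ x - u₂ x| ∂ν
      ≤ ∫⁻ x, ENNReal.ofReal |u₁ x - u₂ x + l * (g₁ x - g₂ x)| ∂ν := by
  have hm0 : 0 < m := by linarith
  set ψ : ℕ → Ω → ℝ := fun n x => clip (n * (u₁ x ^ m - u₂ x ^ m)) with hψ
  have hψt : ∀ n, FormTest ν Λ m (ψ n) := fun n =>
    ((h₁.formTest hm).sub hm (h₂.formTest hm)).clip_mul hm n
  have hlim : ∀ x, Tendsto (fun n => (u₁ x - u₂ x) * ψ n x) atTop (𝓝 |u₁ x - u₂ x|) := by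
    intro x
    have hs : (SignType.sign (u₁ x ^ m - u₂ x ^ m) : ℝ) = SignType.sign (u₁ x - u₂ x) := by
      rcases lt_trichotomy (u₁ x) (u₂ x) with h | h | h
      · rw [sign_neg (sub_neg.2 (Real.rpow_lt_rpow (h₁.nonneg x) h hm0)), sign_neg (sub_neg.2 h)]
      · rw [h]; simp
      · rw [sign_pos (sub_pos.2 (Real.rpow_lt_rpow (h₂.nonneg x) h hm0)), sign_pos (sub_pos.2 h)]
    have := (tendsto_clip_nat_mul (u₁ x ^ m - u₂ x ^ m)).const_mul (u₁ x - u₂ x)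
    rwa [hs, mul_comm _ ((SignType.sign (u₁ x - u₂ x) : ℝ)), sign_mul_self] at this
  refine (lintegral_ofReal_le_liminf (F := fun n x => (u₁ x - u₂ x) * ψ n x)
    (fun n => (h₁.meas_u.sub h₂.meas_u).mul (hψt n).meas) (Eventually.of_forall hlim)).trans ?_
  refine (liminf_le_liminf (v := fun _ => ∫⁻ x, ENNReal.ofReal
    |u₁ x - u₂ x + l * (g₁ x - g₂ x)| ∂ν) (Eventually.of_forall fun n => ?_)).trans_eq
    tendsto_const_nhds.liminf_eq
  have hT := hψt n
  have i1 := integrable_mul_of_conj hm h₁.meas_u hT.meas h₁.int_abs_u hT.int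
  have i2 := integrable_mul_of_conj hm h₂.meas_u hT.meas h₂.int_abs_u hT.int
  have j1 := integrable_mul_of_conj hm h₁.meas_g hT.meas h₁.int_g hT.int
  have j2 := integrable_mul_of_conj hm h₂.meas_g hT.meas h₂.int_g hT.int
  have iu : Integrable (fun x => (u₁ x - u₂ x) * ψ n x) ν := by
    simp only [sub_mul]; exact i1.sub i2
  have ig : Integrable (fun x => (g₁ x - g₂ x) * ψ n x) ν := by
    simp only [sub_mul]; exact j1.sub j2
  have hnn : ∀ x, 0 ≤ (u₁ x - u₂ x) * ψ n x := by
    intro x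
    rcases le_total (u₂ x) (u₁ x) with h | h
    · refine mul_nonneg (sub_nonneg.2 h) ?_
      rw [← clip_zero]
      exact monotone_clip (mul_nonneg (Nat.cast_nonneg _)
        (sub_nonneg.2 (Real.rpow_le_rpow (h₂.nonneg x) h hm0.le)))
    · refine mul_nonneg_of_nonpos_of_nonpos (sub_nonpos.2 h) ?_
      rw [← clip_zero]
      exact monotone_clip (mul_nonpos_of_nonneg_of_nonpos (Nat.cast_nonneg _)
        (sub_nonpos.2 (Real.rpow_le_rpow (h₁.nonneg x) h hm0.le)))
  have hG : 0 ≤ ∫ x, (g₁ x - g₂ x) * ψ n x ∂ν := by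
    have e : ∫ x, (g₁ x - g₂ x) * ψ n x ∂ν
        = jumpForm Λ (fun x => u₁ x ^ m - u₂ x ^ m) (ψ n) := by
      rw [← jumpForm_sub_left (h₁.formTest hm) (h₂.formTest hm) hT, h₁.eqn _ hT, h₂.eqn _ hT,
        ← integral_sub j1 j2]
      simp only [sub_mul]
    rw [e, jumpForm]
    refine integral_nonneg fun p => ?_
    simp only [Pi.zero_apply, incr, hψ]
    rcases le_total (u₁ p.1 ^ m - u₂ p.1 ^ m) (u₁ p.2 ^ m - u₂ p.2 ^ m) with h | h
    · exact mul_nonneg_of_nonpos_of_nonpos (sub_nonpos.2 h) (sub_nonpos.2 (monotone_clip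
        (mul_le_mul_of_nonneg_left h (Nat.cast_nonneg _))))
    · exact mul_nonneg (sub_nonneg.2 h) (sub_nonneg.2 (monotone_clip
        (mul_le_mul_of_nonneg_left h (Nat.cast_nonneg _))))
  calc ∫⁻ x, ENNReal.ofReal ((u₁ x - u₂ x) * ψ n x) ∂ν
      = ENNReal.ofReal (∫ x, (u₁ x - u₂ x) * ψ n x ∂ν) := lintegral_ofReal_eq iu hnn
    _ ≤ ENNReal.ofReal (∫ x, (u₁ x - u₂ x + l * (g₁ x - g₂ x)) * ψ n x ∂ν) := by
        refine ENNReal.ofReal_le_ofReal ?_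
        have : ∫ x, (u₁ x - u₂ x + l * (g₁ x - g₂ x)) * ψ n x ∂ν
            = ∫ x, (u₁ x - u₂ x) * ψ n x ∂ν + l * ∫ x, (g₁ x - g₂ x) * ψ n x ∂ν := by
          rw [← integral_const_mul, ← integral_add iu (ig.const_mul l)]
          congr 1; ext x; ring
        rw [this]
        linarith [mul_nonneg hl hG]
    _ ≤ ‖∫ x, (u₁ x - u₂ x + l * (g₁ x - g₂ x)) * ψ n x ∂ν‖ₑ := by
        rw [Real.enorm_eq_ofReal_abs]; exact ENNReal.ofReal_le_ofReal (le_abs_self _)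
    _ ≤ ∫⁻ x, ‖(u₁ x - u₂ x + l * (g₁ x - g₂ x)) * ψ n x‖ₑ ∂ν :=
        enorm_integral_le_lintegral_enorm _
    _ ≤ _ := by
        refine lintegral_mono fun x => ?_
        rw [Real.enorm_eq_ofReal_abs, abs_mul]
        exact ENNReal.ofReal_le_ofReal (mul_le_of_le_one_right (abs_nonneg _) (abs_clip_le_one _))

lemma statSol_zero (hm : 1 < m) : StatSol ν Λ m (fun _ => 0) (fun _ => 0) where
  meas_u := measurable_const
  nonneg := fun _ => le_rfl
  int_u := by simp [Real.zero_rpow (by linarith : m + 1 ≠ 0)]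
  energy := by simp [incr]
  meas_g := measurable_const
  int_g := by simp [Real.zero_rpow (by linarith : m + 1 ≠ 0)]
  eqn := fun ψ _ => by simp [jumpForm, incr]

lemma StatSol.lintegral_le (hm : 1 < m) {f u : Ω → ℝ} {h : ℝ} (hh : 0 < h)
    (hu : StatSol ν Λ m u (fun x => (f x - u x) / h)) :
    ∫⁻ x, ENNReal.ofReal (u x) ∂ν ≤ ∫⁻ x, ENNReal.ofReal |f x| ∂ν := by
  have := hu.accretive hm (statSol_zero hm) hh.le
  simp only [sub_zero, mul_div_cancel₀ _ hh.ne', add_sub_cancel, abs_of_nonneg (hu.nonneg _)] at this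
  exact this

end Accretivity

section Consistency

variable {Ω : Type*} [MeasurableSpace Ω] {ν : Measure Ω} {Λ : Measure (Ω × Ω)} {m : ℝ}

/-- `u` is the resolvent of `f` with step `h`, and is bounded by `B`. -/
structure Resolvent (ν : Measure Ω) (Λ : Measure (Ω × Ω)) (m h B : ℝ) (f u : Ω → ℝ) : Prop where
  sol : StatSol ν Λ m u (fun x => (f x - u x) / h)
  le : ∀ x, u x ≤ B
  int : Integrable u ν

/-- Measurable integrable functions with values in `[0, B]`. -/
structure Datum (ν : Measure Ω) (B : ℝ) (f : Ω → ℝ) : Prop where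
  meas : Measurable f
  nonneg : ∀ x, 0 ≤ f x
  le : ∀ x, f x ≤ B
  int : Integrable f ν

lemma Resolvent.datum {h B : ℝ} {f u : Ω → ℝ} (hu : Resolvent ν Λ m h B f u) : Datum ν B u :=
  ⟨hu.sol.meas_u, hu.sol.nonneg, hu.le, hu.int⟩

lemma Datum.int_rpow {B r : ℝ} {f : Ω → ℝ} (hf : Datum ν B f) (hr : 1 ≤ r) :
    Integrable (fun x => f x ^ r) ν :=
  integrable_rpow_of_le hr hf.meas hf.nonneg hf.le hf.int

lemma Datum.exists_resolvent (hJ : JumpSpace ν Λ m) (hm : 1 < m) {h B : ℝ} (hh : 0 < h)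
    (hB : 0 < B) {f : Ω → ℝ} (hf : Datum ν B f) : ∃ u, Resolvent ν Λ m h B f u := by
  obtain ⟨u, huB, hu⟩ := _root_.exists_resolvent hJ hm hh hB hf.meas hf.nonneg hf.le hf.int
  refine ⟨u, hu, huB, integrable_of_lintegral_ofReal_ne_top hu.meas_u hu.nonneg ?_⟩
  refine ne_top_of_le_ne_top ?_ (hu.lintegral_le hm hh)
  exact hf.int.abs.lintegral_lt_top.ne

lemma Resolvent.integral_le (hm : 1 < m) {h B : ℝ} (hh : 0 < h) {f u : Ω → ℝ} (hf : Datum ν B f)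
    (hu : Resolvent ν Λ m h B f u) : ∫ x, u x ∂ν ≤ ∫ x, f x ∂ν := by
  have := hu.sol.lintegral_le hm hh
  simp only [abs_of_nonneg (hf.nonneg _)] at this
  rw [lintegral_ofReal_eq hu.int hu.sol.nonneg, lintegral_ofReal_eq hf.int hf.nonneg] at this
  exact (ENNReal.ofReal_le_ofReal_iff (integral_nonneg hf.nonneg)).1 this

/-- Products of an integrable function and a bounded one. -/
lemma integrable_mul_bdd {α : Type*} [MeasurableSpace α] {μ : Measure α} {f g : α → ℝ} {C : ℝ}
    (hf : Integrable f μ) (hg : Measurable g) (hC : ∀ x, |g x| ≤ C) :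
    Integrable (fun x => f x * g x) μ :=
  hf.mul_bdd hg.aestronglyMeasurable (Eventually.of_forall hC)

lemma Resolvent.eqn_mul {h B : ℝ} (hh : 0 < h) {f u : Ω → ℝ} (hu : Resolvent ν Λ m h B f u)
    {ψ : Ω → ℝ} (hψ : FormTest ν Λ m ψ) :
    ∫ x, (f x - u x) * ψ x ∂ν = h * jumpForm Λ (fun x => u x ^ m) ψ := by
  rw [hu.sol.eqn ψ hψ, ← integral_const_mul]
  congr 1; ext x; field_simp

/-- The energy `Φ(u) = 1/(m+1) ∫ u^(m+1)`. -/
def potential (ν : Measure Ω) (m : ℝ) (u : Ω → ℝ) : ℝ := 1 / (m + 1) * ∫ x, u x ^ (m + 1) ∂ν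

lemma potential_nonneg (hm : 1 < m) {u : Ω → ℝ} (hu : ∀ x, 0 ≤ u x) : 0 ≤ potential ν m u :=
  mul_nonneg (by positivity) (integral_nonneg fun x => Real.rpow_nonneg (hu x) _)

lemma Datum.rpow_le {B : ℝ} {f : Ω → ℝ} (hf : Datum ν B f) {r : ℝ} (hr : 0 ≤ r) (x : Ω) :
    |f x ^ r| ≤ B ^ r := by
  rw [abs_of_nonneg (Real.rpow_nonneg (hf.nonneg x) _)]
  exact Real.rpow_le_rpow (hf.nonneg x) (hf.le x) hr

lemma Datum.int_sub_mul_rpow (hm : 1 < m) {B : ℝ} {f g u : Ω → ℝ} (hf : Datum ν B f)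
    (hg : Datum ν B g) (hu : Datum ν B u) :
    Integrable (fun x => (f x - g x) * u x ^ m) ν :=
  integrable_mul_bdd (hf.int.sub hg.int) (hu.meas.pow_const m) (hu.rpow_le (by linarith))

lemma Resolvent.energy_le (hm : 1 < m) {h B : ℝ} (hh : 0 < h) {f u : Ω → ℝ} (hf : Datum ν B f)
    (hu : Resolvent ν Λ m h B f u) :
    h * jumpForm Λ (fun x => u x ^ m) (fun x => u x ^ m) ≤ potential ν m f - potential ν m u := by
  rw [← hu.eqn_mul hh (hu.sol.formTest hm), potential, potential, ← integral_const_mul,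
    ← integral_const_mul, ← integral_sub ((hf.int_rpow (by linarith)).const_mul _)
      ((hu.datum.int_rpow (by linarith)).const_mul _)]
  refine integral_mono (hf.int_sub_mul_rpow hm hu.datum hu.datum)
    (((hf.int_rpow (by linarith)).const_mul _).sub
      ((hu.datum.int_rpow (by linarith)).const_mul _)) fun x => ?_
  exact power_tangent hm (hf.nonneg x) (hu.sol.nonneg x)

lemma jumpForm_self_nonneg (v : Ω → ℝ) : 0 ≤ jumpForm Λ v v :=
  integral_nonneg fun p => mul_self_nonneg (incr v p)

lemma jumpForm_le {v ψ : Ω → ℝ} (hv : FormTest ν Λ m v) (hψ : FormTest ν Λ m ψ) {c : ℝ}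
    (hc : 0 < c) :
    jumpForm Λ v ψ ≤ c / 2 * jumpForm Λ v v + 1 / (2 * c) * jumpForm Λ ψ ψ := by
  simp only [jumpForm]
  have e1 : Integrable (fun p => incr v p * incr v p) Λ := by simpa only [sq] using hv.energy
  have e2 : Integrable (fun p => incr ψ p * incr ψ p) Λ := by simpa only [sq] using hψ.energy
  rw [← integral_const_mul, ← integral_const_mul,
    ← integral_add (e1.const_mul _) (e2.const_mul _)]
  refine integral_mono (integrable_mul_of_sq (measurable_incr hv.meas) (measurable_incr hψ.meas)
    hv.energy hψ.energy) ((e1.const_mul _).add (e2.const_mul _)) fun p => ?_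
  simp only
  have : 0 ≤ 1 / (2 * c) * (c * incr v p - incr ψ p) ^ 2 := by positivity
  have e : 1 / (2 * c) * (c * incr v p - incr ψ p) ^ 2
    = c / 2 * (incr v p * incr v p) + 1 / (2 * c) * (incr ψ p * incr ψ p)
      - incr v p * incr ψ p := by field_simp; ring
  linarith

lemma Resolvent.dist_rpow_le (hm : 1 < m) {h B : ℝ} (hh : 0 < h) (hB : 0 ≤ B) {f u : Ω → ℝ}
    (hf : Datum ν B f) (hu : Resolvent ν Λ m h B f u) {ψ : Ω → ℝ} (hψ : FormTest ν Λ m ψ)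
    {C ε : ℝ} (hψC : ∀ x, |ψ x| ≤ C) (hε : 0 < ε)
    (hi : Integrable (fun x => |f x ^ m - ψ x|) ν) (hle : ∫ x, |f x ^ m - ψ x| ∂ν ≤ ε) :
    ∫⁻ x, ENNReal.ofReal (|u x - f x| ^ (m + 1)) ∂ν
      ≤ ENNReal.ofReal (ε * (B + potential ν m f / 2) + h * (jumpForm Λ ψ ψ / (2 * ε))) := by
  have hm0 : 0 < m := by linarith
  have i1 := hf.int_sub_mul_rpow hm hu.datum hu.datum
  have i2 := hf.int_sub_mul_rpow hm hu.datum hf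
  have i3 : Integrable (fun x => (f x - u x) * ψ x) ν :=
    integrable_mul_bdd (hf.int.sub hu.int) hψ.meas hψC
  have i4 : Integrable (fun x => (u x ^ m - f x ^ m) * (u x - f x)) ν :=
    (i2.sub i1).congr (Eventually.of_forall fun x => by simp only [Pi.sub_apply]; ring)
  have h1 : ∫⁻ x, ENNReal.ofReal (|u x - f x| ^ (m + 1)) ∂ν
      ≤ ENNReal.ofReal (∫ x, (u x ^ m - f x ^ m) * (u x - f x) ∂ν) := by
    have hp : ∀ x, |u x - f x| ^ (m + 1) ≤ (u x ^ m - f x ^ m) * (u x - f x) :=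
      fun x => abs_sub_rpow_le hm (hu.sol.nonneg x) (hf.nonneg x)
    rw [← lintegral_ofReal_eq i4 fun x =>
      (Real.rpow_nonneg (abs_nonneg _) _).trans (hp x)]
    exact lintegral_mono fun x => ENNReal.ofReal_le_ofReal (hp x)
  refine h1.trans (ENNReal.ofReal_le_ofReal ?_)
  have e1 : ∫ x, (u x ^ m - f x ^ m) * (u x - f x) ∂ν
      = ∫ x, (f x - u x) * f x ^ m ∂ν - ∫ x, (f x - u x) * u x ^ m ∂ν := by
    rw [← integral_sub i2 i1]; congr 1; ext x; ring
  have e2 := hu.eqn_mul hh (hu.sol.formTest hm)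
  have e3 := hu.eqn_mul hh hψ
  have e4 : ∫ x, (f x - u x) * f x ^ m ∂ν
      ≤ ∫ x, (f x - u x) * ψ x ∂ν + B * ∫ x, |f x ^ m - ψ x| ∂ν := by
    rw [← integral_const_mul, ← integral_add i3 (hi.const_mul _)]
    refine integral_mono i2 (i3.add (hi.const_mul _)) fun x => ?_
    have hd : |f x - u x| ≤ B := by
      rw [abs_le]; constructor <;> linarith [hf.nonneg x, hf.le x, hu.sol.nonneg x, hu.le x]
    have : (f x - u x) * (f x ^ m - ψ x) ≤ B * |f x ^ m - ψ x| := by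
      refine (le_abs_self _).trans ?_
      rw [abs_mul]
      exact mul_le_mul_of_nonneg_right hd (abs_nonneg _)
    simp only
    linarith
  have hBε : B * ∫ x, |f x ^ m - ψ x| ∂ν ≤ B * ε :=
    mul_le_mul_of_nonneg_left hle hB
  have e5 := jumpForm_le (hu.sol.formTest hm) hψ hε
  have e6 := hu.energy_le hm hh hf
  have e7 : 0 ≤ potential ν m u := potential_nonneg hm hu.sol.nonneg
  have e8 : 0 ≤ h * jumpForm Λ (fun x => u x ^ m) (fun x => u x ^ m) :=
    mul_nonneg hh.le (jumpForm_self_nonneg _)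
  have e9 := mul_le_mul_of_nonneg_left e5 hh.le
  have e10 : ε / 2 * (h * jumpForm Λ (fun x => u x ^ m) (fun x => u x ^ m))
      ≤ ε / 2 * potential ν m f := mul_le_mul_of_nonneg_left (by linarith) (by positivity)
  have e11 : h * (1 / (2 * ε) * jumpForm Λ ψ ψ) = h * (jumpForm Λ ψ ψ / (2 * ε)) := by ring
  rw [mul_add, e11] at e9
  nlinarith

lemma ae_tendsto_zero_of_lintegral_le {α : Type*} [MeasurableSpace α] {μ : Measure α}
    {F : ℕ → α → ℝ} (hF : ∀ n, Measurable (F n)) (h0 : ∀ n x, 0 ≤ F n x)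
    (h : ∀ n, ∫⁻ x, ENNReal.ofReal (F n x) ∂μ ≤ ENNReal.ofReal ((1 / 2) ^ n)) :
    ∀ᵐ x ∂μ, Tendsto (fun n => F n x) atTop (𝓝 0) := by
  have h1 : ∫⁻ x, ∑' n, ENNReal.ofReal (F n x) ∂μ ≠ ⊤ := by
    rw [lintegral_tsum fun n => (hF n).ennreal_ofReal.aemeasurable]
    refine ne_top_of_le_ne_top ?_ (ENNReal.tsum_le_tsum h)
    rw [← ENNReal.ofReal_tsum_of_nonneg (fun n => by positivity)
      (summable_geometric_of_lt_one (by norm_num) (by norm_num))]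
    exact ENNReal.ofReal_ne_top
  filter_upwards [ae_lt_top (Measurable.tsum fun n => (hF n).ennreal_ofReal) h1] with x hx
  have := ENNReal.tendsto_atTop_zero_of_tsum_ne_top hx.ne
  have h2 := (ENNReal.tendsto_toReal ENNReal.zero_ne_top).comp this
  simpa only [Function.comp_def, ENNReal.toReal_ofReal (h0 _ _), ENNReal.toReal_zero] using h2

lemma Datum.exists_resolvent_near_rpow (hJ : JumpSpace ν Λ m) (hm : 1 < m) {B : ℝ} (hB : 0 < B)
    {f : Ω → ℝ} (hf : Datum ν B f) {δ : ℝ} (hδ : 0 < δ) :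
    ∃ h u, 0 < h ∧ Resolvent ν Λ m h B f u ∧
      ∫⁻ x, ENNReal.ofReal (|u x - f x| ^ (m + 1)) ∂ν ≤ ENNReal.ofReal δ := by
  have hP := potential_nonneg (ν := ν) hm hf.nonneg
  set K := B + potential ν m f / 2 with hK
  have hK0 : 0 < K := by positivity
  set ε := δ / (2 * K) with hε
  have hε0 : 0 < ε := by positivity
  obtain ⟨ψ, hψ, ⟨C, hC⟩, hi, hle⟩ := hJ.dense _ (hf.int_rpow hm.le) ε hε0
  set D := jumpForm Λ ψ ψ / (2 * ε) with hD
  have hD0 : 0 ≤ D := div_nonneg (jumpForm_self_nonneg _) (by positivity)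
  have hh0 : 0 < δ / (2 * (D + 1)) := by positivity
  obtain ⟨u, hu⟩ := hf.exists_resolvent hJ hm hh0 hB
  refine ⟨_, u, hh0, hu, (hu.dist_rpow_le hm hh0 hB.le hf hψ hC hε0 hi hle).trans
    (ENNReal.ofReal_le_ofReal ?_)⟩
  have a1 : ε * K = δ / 2 := by rw [hε]; field_simp
  have a2 : δ / (2 * (D + 1)) * D ≤ δ / 2 := by
    rw [div_mul_eq_mul_div, div_le_div_iff₀ (by positivity) (by positivity)]
    nlinarith
  rw [← hD, ← hK]
  linarith

theorem Datum.exists_resolvent_near (hJ : JumpSpace ν Λ m) (hm : 1 < m) {B : ℝ} (hB : 0 < B)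
    {f : Ω → ℝ} (hf : Datum ν B f) {η : ℝ} (hη : 0 < η) :
    ∃ h u, 0 < h ∧ Resolvent ν Λ m h B f u ∧ ∫ x, |f x - u x| ∂ν ≤ η := by
  have hm0 : 0 < m := by linarith
  choose h u hh hu hd using fun n : ℕ =>
    hf.exists_resolvent_near_rpow hJ hm hB (δ := (1 / 2) ^ n) (by positivity)
  have hlim := ae_tendsto_zero_of_lintegral_le
    (fun n => (((hu n).sol.meas_u.sub hf.meas).abs.pow_const (m + 1)))
    (fun n x => Real.rpow_nonneg (abs_nonneg _) _) hd
  have hpos : Tendsto (fun n => ∫ x, max (f x - u n x) 0 ∂ν) atTop (𝓝 (∫ _, (0 : ℝ) ∂ν)) := by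
    refine tendsto_integral_of_dominated_convergence f
      (fun n => ((hf.meas.sub (hu n).sol.meas_u).max measurable_const).aestronglyMeasurable)
      hf.int (fun n => Eventually.of_forall fun x => ?_) ?_
    · rw [Real.norm_eq_abs, abs_of_nonneg (le_max_right _ _)]
      exact max_le (by linarith [(hu n).sol.nonneg x]) (hf.nonneg x)
    · filter_upwards [hlim] with x hx
      have h1 := hx.rpow_const (p := 1 / (m + 1)) (Or.inr (by positivity))
      simp only [← Real.rpow_mul (abs_nonneg _)] at h1
      rw [mul_one_div_cancel (by positivity), Real.zero_rpow (by positivity)] at h1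
      simp only [Real.rpow_one] at h1
      refine squeeze_zero (fun n => le_max_right _ _) (fun n => ?_) h1
      refine max_le ?_ (abs_nonneg _)
      rw [Pi.sub_apply, abs_sub_comm]; exact le_abs_self _
  simp only [integral_zero] at hpos
  obtain ⟨n, hn⟩ := (hpos.eventually_le_const (by positivity : 0 < η / 2)).exists
  refine ⟨h n, u n, hh n, hu n, ?_⟩
  have hle := (hu n).integral_le hm (hh n) hf
  have i1 : Integrable (fun x => max (f x - u n x) 0) ν :=
    (hf.int.sub (hu n).int).pos_part
  have e : ∫ x, |f x - u n x| ∂ν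
      = ∫ x, u n x ∂ν - ∫ x, f x ∂ν + 2 * ∫ x, max (f x - u n x) 0 ∂ν := by
    rw [← integral_const_mul, ← integral_sub (hu n).int hf.int,
      ← integral_add (f := fun x => u n x - f x) ((hu n).int.sub hf.int) (i1.const_mul 2)]
    congr 1; ext x
    rcases le_total (f x) (u n x) with hx | hx
    · rw [max_eq_right (by linarith), abs_of_nonpos (by linarith)]; ring
    · rw [max_eq_left (by linarith), abs_of_nonneg (by linarith)]; ring
  rw [e]; linarith

end Consistency

section Kobayashi

/-- The comparison function of Kobayashi's estimate. -/
def kobSqrt (h k : ℝ) (i j : ℕ) : ℝ := √((i * h - j * k) ^ 2 + i * h ^ 2 + j * k ^ 2)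

lemma kobSqrt_rec {h k : ℝ} (hh : 0 < h) (hk : 0 < k) (i j : ℕ) :
    h / (h + k) * kobSqrt h k (i + 1) j + k / (h + k) * kobSqrt h k i (j + 1)
      ≤ kobSqrt h k (i + 1) (j + 1) := by
  have hs : 0 < h + k := by positivity
  set X := kobSqrt h k (i + 1) j with hX
  set Y := kobSqrt h k i (j + 1) with hY
  have hX2 : X ^ 2 = ((i + 1) * h - j * k) ^ 2 + (i + 1) * h ^ 2 + j * k ^ 2 := by
    rw [hX, kobSqrt, Real.sq_sqrt (by positivity)]; push_cast; ring
  have hY2 : Y ^ 2 = (i * h - (j + 1) * k) ^ 2 + i * h ^ 2 + (j + 1) * k ^ 2 := by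
    rw [hY, kobSqrt, Real.sq_sqrt (by positivity)]; push_cast; ring
  refine Real.le_sqrt_of_sq_le ?_
  have e : (h / (h + k) * X + k / (h + k) * Y) ^ 2
      = h / (h + k) * X ^ 2 + k / (h + k) * Y ^ 2 - h * k / (h + k) ^ 2 * (X - Y) ^ 2 := by
    field_simp; ring
  have e2 : h / (h + k) * X ^ 2 + k / (h + k) * Y ^ 2
      = (((i + 1 : ℕ) : ℝ) * h - ((j + 1 : ℕ) : ℝ) * k) ^ 2 + ((i + 1 : ℕ) : ℝ) * h ^ 2
        + ((j + 1 : ℕ) : ℝ) * k ^ 2 := by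
    rw [hX2, hY2]; push_cast; field_simp; ring
  have : 0 ≤ h * k / (h + k) ^ 2 * (X - Y) ^ 2 := by positivity
  linarith

lemma kobayashi_bound {h k c L : ℝ} (hh : 0 < h) (hk : 0 < k) (hL : 0 ≤ L) {a : ℕ → ℕ → ℝ}
    (hrec : ∀ i j, a (i + 1) (j + 1) ≤ h / (h + k) * a (i + 1) j + k / (h + k) * a i (j + 1))
    (hi : ∀ i, a i 0 ≤ c + L * (i * h)) (hj : ∀ j, a 0 j ≤ c + L * (j * k)) (i j : ℕ) :
    a i j ≤ c + L * kobSqrt h k i j := by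
  have hs : 0 < h + k := by positivity
  induction i generalizing j with
  | zero =>
    refine (hj j).trans ?_
    gcongr
    refine Real.le_sqrt_of_sq_le ?_
    have : 0 ≤ (j : ℝ) * k ^ 2 := by positivity
    push_cast; nlinarith
  | succ i ihi =>
    induction j with
    | zero =>
      refine (hi _).trans ?_
      gcongr
      refine Real.le_sqrt_of_sq_le ?_
      have : 0 ≤ ((i + 1 : ℕ) : ℝ) * h ^ 2 := by positivity
      push_cast at this ⊢; nlinarith
    | succ j ihj =>
      have h1 := mul_le_mul_of_nonneg_left ihj (by positivity : 0 ≤ h / (h + k))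
      have h2 := mul_le_mul_of_nonneg_left (ihi (j + 1)) (by positivity : 0 ≤ k / (h + k))
      have h3 := mul_le_mul_of_nonneg_left (kobSqrt_rec hh hk i j) hL
      have h4 : h / (h + k) * c + k / (h + k) * c = c := by field_simp
      calc _ ≤ _ := hrec i j
        _ ≤ _ := add_le_add h1 h2
        _ = c + L * (h / (h + k) * kobSqrt h k (i + 1) j
            + k / (h + k) * kobSqrt h k i (j + 1)) := by linear_combination h4
        _ ≤ _ := by linarith

end Kobayashi

section Scheme

variable {Ω : Type*} [MeasurableSpace Ω] {ν : Measure Ω} {Λ : Measure (Ω × Ω)} {m : ℝ}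

/-- The `L¹` distance. -/
def dist1 (ν : Measure Ω) (f g : Ω → ℝ) : ℝ := ∫ x, |f x - g x| ∂ν

lemma dist1_comm (f g : Ω → ℝ) : dist1 ν f g = dist1 ν g f := by
  simp only [dist1, abs_sub_comm]

lemma integrable_abs_sub {f g : Ω → ℝ} (hf : Integrable f ν) (hg : Integrable g ν) :
    Integrable (fun x => |f x - g x|) ν := (hf.sub hg).abs

lemma dist1_triangle {f g k : Ω → ℝ} (hf : Integrable f ν) (hg : Integrable g ν)
    (hk : Integrable k ν) : dist1 ν f k ≤ dist1 ν f g + dist1 ν g k := by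
  simp only [dist1]
  rw [← integral_add (integrable_abs_sub hf hg) (integrable_abs_sub hg hk)]
  exact integral_mono (integrable_abs_sub hf hk)
    ((integrable_abs_sub hf hg).add (integrable_abs_sub hg hk))
    fun x => abs_sub_le _ _ _

lemma dist1_le_of_accretive (hm : 1 < m) {B : ℝ} {u₁ g₁ u₂ g₂ : Ω → ℝ}
    (h₁ : StatSol ν Λ m u₁ g₁) (h₂ : StatSol ν Λ m u₂ g₂) (d₁ : Datum ν B u₁) (d₂ : Datum ν B u₂)
    (i₁ : Integrable g₁ ν) (i₂ : Integrable g₂ ν) {l : ℝ} (hl : 0 ≤ l) :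
    dist1 ν u₁ u₂ ≤ ∫ x, |u₁ x - u₂ x + l * (g₁ x - g₂ x)| ∂ν := by
  have h := h₁.accretive hm h₂ hl
  rw [lintegral_ofReal_eq (integrable_abs_sub d₁.int d₂.int) fun _ => abs_nonneg _,
    lintegral_ofReal_eq (f := fun x => |u₁ x - u₂ x + l * (g₁ x - g₂ x)|)
      ((d₁.int.sub d₂.int).add ((i₁.sub i₂).const_mul l)).abs fun _ => abs_nonneg _,
    ENNReal.ofReal_le_ofReal_iff (integral_nonneg fun _ => abs_nonneg _)] at h
  exact h

/-- Solutions of the implicit Euler scheme with step `h`. -/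
structure Scheme (ν : Measure Ω) (Λ : Measure (Ω × Ω)) (m h B : ℝ) (U : ℕ → Ω → ℝ) : Prop where
  zero : Datum ν B (U 0)
  step : ∀ n, Resolvent ν Λ m h B (U n) (U (n + 1))

lemma Datum.exists_scheme (hJ : JumpSpace ν Λ m) (hm : 1 < m) {h B : ℝ} (hh : 0 < h)
    (hB : 0 < B) {f : Ω → ℝ} (hf : Datum ν B f) : ∃ U, Scheme ν Λ m h B U ∧ U 0 = f := by
  choose J hR using fun f : {f : Ω → ℝ // Datum ν B f} => f.2.exists_resolvent hJ hm hh hB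
  set V : ℕ → {f : Ω → ℝ // Datum ν B f} :=
    fun n => Nat.rec ⟨f, hf⟩ (fun _ g => ⟨J g, (hR g).datum⟩) n with hV
  exact ⟨fun n => (V n).1, ⟨hf, fun n => hR (V n)⟩, rfl⟩

lemma Scheme.datum {h B : ℝ} {U : ℕ → Ω → ℝ} (hU : Scheme ν Λ m h B U) : ∀ n, Datum ν B (U n)
  | 0 => hU.zero
  | n + 1 => (hU.step n).datum

lemma Scheme.dist1_rec (hm : 1 < m) {h k B : ℝ} (hh : 0 < h) (hk : 0 < k) {U W : ℕ → Ω → ℝ}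
    (hU : Scheme ν Λ m h B U) (hW : Scheme ν Λ m k B W) (i j : ℕ) :
    dist1 ν (U (i + 1)) (W (j + 1)) ≤ h / (h + k) * dist1 ν (U (i + 1)) (W j)
      + k / (h + k) * dist1 ν (U i) (W (j + 1)) := by
  have hs : 0 < h + k := by positivity
  have iU := fun n => (hU.datum n).int
  have iW := fun n => (hW.datum n).int
  have h1 := dist1_le_of_accretive hm (hU.step i).sol (hW.step j).sol (hU.datum _) (hW.datum _)
    (((iU i).sub (iU (i + 1))).div_const h) (((iW j).sub (iW (j + 1))).div_const k)
    (by positivity : 0 ≤ h * k / (h + k))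
  refine h1.trans ?_
  have j1 : Integrable (fun x => |U (i + 1) x - W j x|) ν := ((iU _).sub (iW _)).abs
  have j2 : Integrable (fun x => |U i x - W (j + 1) x|) ν := ((iU _).sub (iW _)).abs
  simp only [dist1]
  rw [← integral_const_mul, ← integral_const_mul,
    ← integral_add (j1.const_mul _) (j2.const_mul _)]
  refine integral_mono_of_nonneg (Eventually.of_forall fun _ => abs_nonneg _)
    ((j1.const_mul _).add (j2.const_mul _)) (Eventually.of_forall fun x => ?_)
  simp only
  have e : U (i + 1) x - W (j + 1) x + h * k / (h + k)
      * ((U i x - U (i + 1) x) / h - (W j x - W (j + 1) x) / k)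
      = h / (h + k) * (U (i + 1) x - W j x) + k / (h + k) * (U i x - W (j + 1) x) := by
    field_simp; ring
  rw [e]
  refine (abs_add_le _ _).trans_eq ?_
  rw [abs_mul, abs_mul, abs_of_pos (div_pos hh hs), abs_of_pos (div_pos hk hs)]

lemma Scheme.dist1_stat_le (hm : 1 < m) {h B : ℝ} (hh : 0 < h) {U : ℕ → Ω → ℝ}
    (hU : Scheme ν Λ m h B U) {y g : Ω → ℝ} (hy : StatSol ν Λ m y g) (dy : Datum ν B y)
    (ig : Integrable g ν) (i : ℕ) :
    dist1 ν (U i) y ≤ dist1 ν (U 0) y + (∫ x, |g x| ∂ν) * (i * h) := by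
  induction i with
  | zero => simp
  | succ i ih =>
    have iU := fun n => (hU.datum n).int
    have h1 := dist1_le_of_accretive hm (hU.step i).sol hy (hU.datum _) dy
      (((iU i).sub (iU (i + 1))).div_const h) ig hh.le
    have j1 : Integrable (fun x => |U i x - y x|) ν := ((iU _).sub dy.int).abs
    have h2 : ∫ x, |U (i + 1) x - y x + h * ((U i x - U (i + 1) x) / h - g x)| ∂ν
        ≤ dist1 ν (U i) y + h * ∫ x, |g x| ∂ν := by
      rw [dist1, ← integral_const_mul, ← integral_add j1 (ig.abs.const_mul h)]
      refine integral_mono_of_nonneg (Eventually.of_forall fun _ => abs_nonneg _)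
        (j1.add (ig.abs.const_mul h)) (Eventually.of_forall fun x => ?_)
      have e : U (i + 1) x - y x + h * ((U i x - U (i + 1) x) / h - g x)
          = (U i x - y x) - h * g x := by field_simp; ring
      simp only
      rw [e]
      refine (abs_sub _ _).trans_eq ?_
      rw [abs_mul, abs_of_pos hh]
    push_cast
    linarith

theorem Scheme.kobayashi (hm : 1 < m) {h k h₀ B η : ℝ} (hh : 0 < h) (hk : 0 < k)
    {U W : ℕ → Ω → ℝ} (hU : Scheme ν Λ m h B U) (hW : Scheme ν Λ m k B W) (h0 : U 0 = W 0)
    {y : Ω → ℝ} (hy : Resolvent ν Λ m h₀ B (U 0) y) (hη : dist1 ν (U 0) y ≤ η) (i j : ℕ) :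
    dist1 ν (U i) (W j)
      ≤ 2 * η + (∫ x, |(U 0 x - y x) / h₀| ∂ν) * kobSqrt h k i j := by
  have iU := fun n => (hU.datum n).int
  have iW := fun n => (hW.datum n).int
  have ig : Integrable (fun x => (U 0 x - y x) / h₀) ν := ((iU 0).sub hy.int).div_const h₀
  refine kobayashi_bound (a := fun i j => dist1 ν (U i) (W j)) hh hk
    (integral_nonneg fun _ => abs_nonneg _) (hU.dist1_rec hm hh hk hW) (fun i => ?_)
    (fun j => ?_) i j
  · have := hU.dist1_stat_le hm hh hy.sol hy.datum ig i
    have h2 := dist1_triangle (iU i) hy.int (iW 0)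
    rw [dist1_comm y, ← h0] at h2
    simp only [← h0]
    linarith
  · have hg := hW.dist1_stat_le hm hk hy.sol hy.datum ig j
    have h2 := dist1_triangle (iU 0) hy.int (iW j)
    rw [dist1_comm y] at h2
    rw [← h0] at hg
    simp only
    linarith

end Scheme

section Grid

/-- The index of the interval of length `h` that contains `t`. -/
def grid (h t : ℝ) : ℕ := ⌈t / h⌉₊

lemma le_grid_mul {h : ℝ} (hh : 0 < h) (t : ℝ) : max t 0 ≤ grid h t * h := by
  refine max_le ?_ (by positivity)
  rw [← div_le_iff₀ hh]; exact Nat.le_ceil _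

lemma grid_mul_lt {h : ℝ} (hh : 0 < h) (t : ℝ) : grid h t * h < max t 0 + h := by
  have e : grid h t = grid h (max t 0) := by
    rcases le_total t 0 with ht | ht
    · rw [max_eq_right ht, grid, grid, Nat.ceil_eq_zero.2 (div_nonpos_of_nonpos_of_nonneg ht hh.le)]
      simp
    · rw [max_eq_left ht]
  have h1 := Nat.ceil_lt_add_one (div_nonneg (le_max_right t 0) hh.le)
  rw [e, ← lt_div_iff₀ hh, add_div, div_self hh.ne']
  exact h1

lemma grid_of_nonpos {h t : ℝ} (hh : 0 < h) (ht : t ≤ 0) : grid h t = 0 :=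
  Nat.ceil_eq_zero.2 (div_nonpos_of_nonpos_of_nonneg ht hh.le)

lemma grid_sub {h t : ℝ} (hh : 0 < h) (ht : 0 < t) : grid h t = grid h (t - h) + 1 := by
  have : 0 < grid h t := Nat.ceil_pos.2 (div_pos ht hh)
  have e : grid h (t - h) = grid h t - 1 := by
    rw [grid, sub_div, div_self hh.ne', Nat.ceil_sub_one, grid]
  omega

lemma grid_mono {h : ℝ} (hh : 0 < h) : Monotone (grid h) := fun s t hst =>
  Nat.ceil_mono (by gcongr)

lemma measurable_grid (h : ℝ) : Measurable (grid h) :=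
  Nat.measurable_ceil.comp (measurable_id.div_const h)

lemma kobSqrt_grid_le {h k δ T s t : ℝ} (hh : 0 < h) (hk : 0 < k) (hδ : δ ≤ 1) (hhδ : h < δ)
    (hkδ : k < δ) (hT : 0 ≤ T) (hs : s ≤ T) (ht : t ≤ T) (hst : |s - t| < δ) :
    kobSqrt h k (grid h s) (grid k t) ≤ √(δ * (6 + 2 * T)) := by
  refine Real.sqrt_le_sqrt ?_
  have h1 := le_grid_mul hh s
  have h2 := grid_mul_lt hh s
  have h3 := le_grid_mul hk t
  have h4 := grid_mul_lt hk t
  have h5 : |max s 0 - max t 0| < δ := (abs_max_sub_max_le_abs s t 0).trans_lt hst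
  have h6 : max s 0 ≤ T := max_le hs hT
  have h7 : max t 0 ≤ T := max_le ht hT
  have h8 : 0 ≤ max s 0 := le_max_right _ _
  have h9 : 0 ≤ max t 0 := le_max_right _ _
  set a := (grid h s : ℝ) * h
  set b := (grid k t : ℝ) * k
  rw [abs_lt] at h5
  have hab : |a - b| ≤ 2 * δ := by rw [abs_le]; constructor <;> linarith
  have e1 : (a - b) ^ 2 ≤ (2 * δ) ^ 2 := sq_le_sq' (by linarith [abs_le.1 hab]) (abs_le.1 hab).2
  have e2 : (grid h s : ℝ) * h ^ 2 = a * h := by ring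
  have e3 : (grid k t : ℝ) * k ^ 2 = b * k := by ring
  rw [e2, e3]
  have ha : a * h ≤ (T + 1) * δ := mul_le_mul (by linarith) hhδ.le hh.le (by linarith)
  have hb : b * k ≤ (T + 1) * δ := mul_le_mul (by linarith) hkδ.le hk.le (by linarith)
  nlinarith

end Grid

section Limit

variable {Ω : Type*} [MeasurableSpace Ω] {ν : Measure Ω} {Λ : Measure (Ω × Ω)} {m : ℝ}

lemma Datum.exists_modulus (hJ : JumpSpace ν Λ m) (hm : 1 < m) {B : ℝ} (hB : 0 < B)
    {f : Ω → ℝ} (hf : Datum ν B f) {T ε : ℝ} (hT : 0 ≤ T) (hε : 0 < ε) :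
    ∃ δ, 0 < δ ∧ ∀ h k U W, 0 < h → h < δ → 0 < k → k < δ → Scheme ν Λ m h B U →
      Scheme ν Λ m k B W → U 0 = f → W 0 = f → ∀ s t, s ≤ T → t ≤ T → |s - t| < δ →
      dist1 ν (U (grid h s)) (W (grid k t)) ≤ ε := by
  obtain ⟨h₀, y, _, hy, hd⟩ := hf.exists_resolvent_near hJ hm hB (η := ε / 4) (by positivity)
  set L := ∫ x, |(f x - y x) / h₀| ∂ν with hL
  have hL0 : 0 ≤ L := integral_nonneg fun _ => abs_nonneg _
  set δ := min 1 ((ε / (2 * (L + 1))) ^ 2 / (6 + 2 * T)) with hδ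
  refine ⟨δ, lt_min one_pos (by positivity), ?_⟩
  intro h k U W hh hhδ hk hkδ hU hW hU0 hW0 s t hs ht hst
  have hk1 := hU.kobayashi hm hh hk hW (hU0.trans hW0.symm) (hU0 ▸ hy) (hU0 ▸ hd)
    (grid h s) (grid k t)
  rw [hU0, ← hL] at hk1
  have h1 := kobSqrt_grid_le hh hk (min_le_left _ _) hhδ hkδ hT hs ht hst
  have h2 : √(δ * (6 + 2 * T)) ≤ ε / (2 * (L + 1)) := by
    refine Real.sqrt_le_iff.2 ⟨by positivity, ?_⟩
    calc δ * (6 + 2 * T) ≤ (ε / (2 * (L + 1))) ^ 2 / (6 + 2 * T) * (6 + 2 * T) := by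
          gcongr; exact min_le_right _ _
      _ = _ := by field_simp
  have h3 : L * (ε / (2 * (L + 1))) ≤ ε / 2 := by
    rw [mul_div_assoc', div_le_div_iff₀ (by positivity) (by norm_num)]; nlinarith
  have h4 := mul_le_mul_of_nonneg_left (h1.trans h2) hL0
  linarith

/-- `u` is the limit of implicit Euler schemes `U n` with steps `h n → 0`. -/
structure EulerLimit (ν : Measure Ω) (Λ : Measure (Ω × Ω)) (m B : ℝ) (h : ℕ → ℝ)
    (U : ℕ → ℕ → Ω → ℝ) (u : ℝ → Ω → ℝ) : Prop where
  pos : ∀ n, 0 < h n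
  lim : Tendsto h atTop (𝓝 0)
  scheme : ∀ n, Scheme ν Λ m (h n) B (U n)
  start : ∀ n, U n 0 = U 0 0
  meas : Measurable (fun p : Ω × ℝ => u p.2 p.1)
  datum : ∀ t, Datum ν B (u t)
  ae_lim : ∀ t, ∀ᵐ x ∂ν, Tendsto (fun n => U n (grid (h n) t) x) atTop (𝓝 (u t x))
  modulus : ∀ t ε, 0 < ε → ∃ δ, 0 < δ ∧ ∃ N, ∀ n ≥ N, ∀ s, |s - t| < δ →
    dist1 ν (U n (grid (h n) s)) (u t) ≤ ε

lemma exists_step_sequence {δ : ℕ → ℝ} (hδ : ∀ n, 0 < δ n) :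
    ∃ h : ℕ → ℝ, (∀ n, 0 < h n) ∧ Tendsto h atTop (𝓝 0) ∧ ∀ N n, N ≤ n → h n < δ N := by
  set h : ℕ → ℝ := fun n => Nat.rec (min 1 (δ 0) / 2) (fun k r => min r (δ (k + 1)) / 2) n with hh
  have h0 : h 0 = min 1 (δ 0) / 2 := rfl
  have hs : ∀ n, h (n + 1) = min (h n) (δ (n + 1)) / 2 := fun n => rfl
  have hpos : ∀ n, 0 < h n := by
    intro n
    induction n with
    | zero => rw [h0]; have := lt_min one_pos (hδ 0); positivity
    | succ n ih => rw [hs]; have := lt_min ih (hδ (n + 1)); positivity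
  have hle : ∀ n, h (n + 1) ≤ h n / 2 := fun n => by
    rw [hs]; have := min_le_left (h n) (δ (n + 1)); linarith
  have hanti : Antitone h := antitone_nat_of_succ_le fun n => by linarith [hle n, hpos n]
  have hlt : ∀ n, h n < δ n := by
    intro n
    cases n with
    | zero => rw [h0]; have := min_le_right 1 (δ 0); linarith [hδ 0]
    | succ n => rw [hs]; have := min_le_right (h n) (δ (n + 1)); linarith [hδ (n + 1)]
  have hgeo : ∀ n, h n ≤ h 0 * (1 / 2) ^ n := by
    intro n
    induction n with
    | zero => simp
    | succ n ih => rw [pow_succ]; linarith [hle n]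
  refine ⟨h, hpos, ?_, fun N n hn => (hanti hn).trans_lt (hlt N)⟩
  refine squeeze_zero (fun n => (hpos n).le) hgeo ?_
  simpa using (tendsto_pow_atTop_nhds_zero_of_lt_one (by norm_num : (0 : ℝ) ≤ 1 / 2)
    (by norm_num)).const_mul (h 0)

lemma dist1_le_of_ae_tendsto {f g : Ω → ℝ} {G : ℕ → Ω → ℝ} {N : ℕ} {ε : ℝ} (hε : 0 ≤ ε)
    (hf : Measurable f) (hfi : Integrable f ν) (hG : ∀ n, Measurable (G n))
    (hGi : ∀ n, Integrable (G n) ν) (hgi : Integrable g ν)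
    (hlim : ∀ᵐ x ∂ν, Tendsto (fun n => G n x) atTop (𝓝 (g x)))
    (hle : ∀ n ≥ N, dist1 ν f (G n) ≤ ε) : dist1 ν f g ≤ ε := by
  have h1 := lintegral_ofReal_le_liminf (μ := ν) (F := fun n x => |f x - G n x|)
    (f := fun x => |f x - g x|) (fun n => (hf.sub (hG n)).abs)
    (by filter_upwards [hlim] with x hx; exact (hx.const_sub _).abs)
  rw [lintegral_ofReal_eq (integrable_abs_sub hfi hgi) fun _ => abs_nonneg _] at h1
  refine (ENNReal.ofReal_le_ofReal_iff hε).1 (h1.trans ?_)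
  refine liminf_le_of_frequently_le' (Eventually.frequently ?_)
  filter_upwards [eventually_ge_atTop N] with n hn
  rw [lintegral_ofReal_eq (integrable_abs_sub hfi (hGi n)) fun _ => abs_nonneg _]
  exact ENNReal.ofReal_le_ofReal (hle n hn)

lemma exists_joint_limit {B : ℝ} (hB : 0 ≤ B) {y : ℕ → ℝ → Ω → ℝ}
    (hy : ∀ n, Measurable (fun p : Ω × ℝ => y n p.2 p.1)) (h0 : ∀ n t x, 0 ≤ y n t x)
    (hle : ∀ n t x, y n t x ≤ B)
    (hex : ∀ t, ∀ᵐ x ∂ν, ∃ l, Tendsto (fun n => y n t x) atTop (𝓝 l)) :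
    ∃ u : ℝ → Ω → ℝ, Measurable (fun p : Ω × ℝ => u p.2 p.1) ∧ (∀ t x, 0 ≤ u t x) ∧
      (∀ t x, u t x ≤ B) ∧ ∀ t, ∀ᵐ x ∂ν, Tendsto (fun n => y n t x) atTop (𝓝 (u t x)) := by
  refine ⟨fun t x => limClip B (fun n (p : Ω × ℝ) => y n p.2 p.1) (x, t), measurable_limClip hy,
    fun t x => limClip_nonneg _ _ _, fun t x => limClip_le hB _ _, fun t => ?_⟩
  filter_upwards [hex t] with x hx
  exact tendsto_limClip (F := fun n (p : Ω × ℝ) => y n p.2 p.1) (x := (x, t))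
    (fun n => h0 n t x) (fun n => hle n t x) hx

theorem Datum.exists_eulerLimit (hJ : JumpSpace ν Λ m) (hm : 1 < m) {B : ℝ} (hB : 0 < B)
    {f : Ω → ℝ} (hf : Datum ν B f) :
    ∃ h U u, EulerLimit ν Λ m B h U u ∧ U 0 0 = f := by
  choose δ hδ hmod using fun n : ℕ =>
    hf.exists_modulus hJ hm hB (T := n) (ε := (1 / 4) ^ n / B) (by positivity) (by positivity)
  obtain ⟨h, hpos, hlim, hlt⟩ := exists_step_sequence hδ
  choose U hU hU0 using fun n => hf.exists_scheme hJ hm (hpos n) hB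
  set y : ℕ → ℝ → Ω → ℝ := fun n t => U n (grid (h n) t) with hy
  have hyd : ∀ n t, Datum ν B (y n t) := fun n t => (hU n).datum _
  have key : ∀ N n k : ℕ, N ≤ n → N ≤ k → ∀ s t : ℝ, s ≤ N → t ≤ N → |s - t| < δ N →
      dist1 ν (y n s) (y k t) ≤ (1 / 4) ^ N / B := fun N n k hn hk s t hs ht hst =>
    hmod N _ _ _ _ (hpos n) (hlt N n hn) (hpos k) (hlt N k hk) (hU n) (hU k) (hU0 n) (hU0 k)
      s t hs ht hst
  have hex : ∀ t : ℝ, ∀ᵐ x ∂ν, ∃ l, Tendsto (fun n => y n t x) atTop (𝓝 l) := by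
    intro t
    obtain ⟨N₀, hN₀⟩ := exists_nat_ge t
    have h1 := ae_tendsto_of_lintegral_sq_le (μ := ν) (F := fun n => y (n + N₀) t)
      (fun n => (hyd _ _).meas) (fun N n k hn hk => ?_)
    · filter_upwards [h1] with x ⟨l, hl⟩
      exact ⟨l, (tendsto_add_atTop_iff_nat N₀).1 hl⟩
    · have h2 := key (N + N₀) (n + N₀) (k + N₀) (by omega) (by omega) t t
        (hN₀.trans (by push_cast; linarith [(N.cast_nonneg : (0 : ℝ) ≤ N)]))
        (hN₀.trans (by push_cast; linarith [(N.cast_nonneg : (0 : ℝ) ≤ N)])) (by simpa using hδ _)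
      have i1 := integrable_abs_sub (hyd (n + N₀) t).int (hyd (k + N₀) t).int
      calc _ ≤ ∫⁻ x, ENNReal.ofReal (B * |y (n + N₀) t x - y (k + N₀) t x|) ∂ν := by
            refine lintegral_mono fun x => ENNReal.ofReal_le_ofReal ?_
            rw [← sq_abs, sq]
            refine mul_le_mul_of_nonneg_right ?_ (abs_nonneg _)
            rw [abs_le]
            constructor <;> linarith [(hyd (n + N₀) t).nonneg x, (hyd (n + N₀) t).le x,
              (hyd (k + N₀) t).nonneg x, (hyd (k + N₀) t).le x]
        _ = ENNReal.ofReal (B * dist1 ν (y (n + N₀) t) (y (k + N₀) t)) := by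
            rw [lintegral_ofReal_eq (i1.const_mul B) fun x => by positivity, integral_const_mul,
              dist1]
        _ ≤ _ := by
            refine ENNReal.ofReal_le_ofReal ?_
            rw [le_div_iff₀ hB, mul_comm] at h2
            refine h2.trans ?_
            exact pow_le_pow_of_le_one (by norm_num) (by norm_num) (by omega)
  have hmeas : ∀ n, Measurable (fun p : Ω × ℝ => y n p.2 p.1) := fun n =>
    measurable_from_prod_countable_left (f := fun q : Ω × ℕ => U n q.2 q.1)
      (fun k => ((hU n).datum k).meas) |>.comp
      (measurable_fst.prodMk ((measurable_grid (h n)).comp measurable_snd))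
  obtain ⟨u, humeas, hu0, huB, hul⟩ := exists_joint_limit hB.le hmeas (fun n t => (hyd n t).nonneg)
    (fun n t => (hyd n t).le) hex
  have hum : ∀ t, Measurable (u t) := fun t => humeas.comp (measurable_id.prodMk measurable_const)
  have hui : ∀ t, Integrable (u t) ν := by
    intro t
    obtain ⟨N₀, hN₀⟩ := exists_nat_ge t
    refine integrable_of_lintegral_ofReal_ne_top (hum t) (hu0 t) ?_
    refine ne_top_of_le_ne_top (ENNReal.ofReal_ne_top (r := ∫ x, f x ∂ν))
      ((lintegral_ofReal_le_liminf (fun n => (hyd n t).meas) (hul t)).trans ?_)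
    refine liminf_le_of_frequently_le' (Frequently.of_forall fun n => ?_)
    rw [lintegral_ofReal_eq (hyd n t).int (hyd n t).nonneg]
    refine ENNReal.ofReal_le_ofReal ?_
    have : ∀ k, ∫ x, U n k x ∂ν ≤ ∫ x, f x ∂ν := by
      intro k
      induction k with
      | zero => rw [hU0]
      | succ k ih => exact (((hU n).step k).integral_le hm (hpos n) ((hU n).datum k)).trans ih
    exact this _
  refine ⟨h, U, u, ⟨hpos, hlim, hU, fun n => (hU0 n).trans (hU0 0).symm, humeas, fun t => ⟨hum t, hu0 t, huB t, hui t⟩, hul, fun t ε hε => ?_⟩, hU0 0⟩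
  obtain ⟨N₁, hN₁⟩ := exists_nat_ge (t + 1)
  obtain ⟨N₂, hN₂⟩ := exists_pow_lt_of_lt_one (mul_pos hε hB) (by norm_num : (1 / 4 : ℝ) < 1)
  set N := max N₁ N₂
  have hNt : t + 1 ≤ N := hN₁.trans (by exact_mod_cast le_max_left _ _)
  refine ⟨min 1 (δ N), lt_min one_pos (hδ N), N, fun n hn s hs => ?_⟩
  refine dist1_le_of_ae_tendsto (N := N) hε.le (hyd n s).meas (hyd n s).int
    (fun k => (hyd k t).meas) (fun k => (hyd k t).int) (hui t) (hul t) fun k hk => ?_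
  have hs1 := hs.trans_le (min_le_left _ _)
  refine (key N n k hn hk s t (by linarith [(abs_lt.1 hs1).2]) (by linarith)
    (hs.trans_le (min_le_right _ _))).trans ?_
  rw [div_le_iff₀ hB]
  exact (pow_le_pow_of_le_one (by norm_num) (by norm_num) (le_max_right _ _)).trans hN₂.le

end Limit

section WeakConvergence

lemma abs_mul_le_min_add {d g R : ℝ} (hR : 0 < R) :
    |d * g| ≤ min |d| (R * |g|) * |g| + d ^ 2 / R := by
  rw [abs_mul, ← sq_abs d]
  have hd := abs_nonneg d
  have hg := abs_nonneg g
  rcases le_total |d| (R * |g|) with h | h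
  · rw [min_eq_left h]
    have : 0 ≤ |d| ^ 2 / R := by positivity
    linarith
  · rw [min_eq_right h]
    have : |d| * |g| ≤ |d| ^ 2 / R := by
      rw [le_div_iff₀ hR]; nlinarith
    have : 0 ≤ R * |g| * |g| := by positivity
    linarith

/-- Bounded sequences in `L²` converging almost everywhere converge weakly. -/
lemma tendsto_integral_mul_of_ae_tendsto {α : Type*} [MeasurableSpace α] {μ : Measure α}
    {f : ℕ → α → ℝ} {f' g : α → ℝ} {M : ℝ} (hf : ∀ n, Measurable (f n)) (hf' : Measurable f')
    (hg : Measurable g) (hf2 : ∀ n, Integrable (fun x => f n x ^ 2) μ)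
    (hM : ∀ n, ∫ x, f n x ^ 2 ∂μ ≤ M) (hf'2 : Integrable (fun x => f' x ^ 2) μ)
    (hg2 : Integrable (fun x => g x ^ 2) μ)
    (hlim : ∀ᵐ x ∂μ, Tendsto (fun n => f n x) atTop (𝓝 (f' x))) :
    Tendsto (fun n => ∫ x, f n x * g x ∂μ) atTop (𝓝 (∫ x, f' x * g x ∂μ)) := by
  set A := 2 * M + 2 * ∫ x, f' x ^ 2 ∂μ with hA
  have hM0 : 0 ≤ M := (integral_nonneg fun x => sq_nonneg _).trans (hM 0)
  have hF0 : 0 ≤ ∫ x, f' x ^ 2 ∂μ := integral_nonneg fun x => sq_nonneg _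
  have hA0 : 0 ≤ A := by positivity
  have idd : ∀ n, Integrable (fun x => 2 * f n x ^ 2 + 2 * f' x ^ 2) μ := fun n =>
    ((hf2 n).const_mul 2).add (hf'2.const_mul 2)
  have hdle : ∀ n x, (f n x - f' x) ^ 2 ≤ 2 * f n x ^ 2 + 2 * f' x ^ 2 := fun n x => by
    nlinarith [sq_nonneg (f n x + f' x)]
  have hdi : ∀ n, Integrable (fun x => (f n x - f' x) ^ 2) μ := fun n =>
    (idd n).mono' (((hf n).sub hf').pow_const 2).aestronglyMeasurable
      (Eventually.of_forall fun x => by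
        rw [Real.norm_of_nonneg (sq_nonneg _)]; exact hdle n x)
  have hdA : ∀ n, ∫ x, (f n x - f' x) ^ 2 ∂μ ≤ A := fun n => by
    refine (integral_mono (hdi n) (idd n) (hdle n)).trans ?_
    rw [integral_add ((hf2 n).const_mul 2) (hf'2.const_mul 2), integral_const_mul,
      integral_const_mul]
    linarith [hM n]
  rw [Metric.tendsto_atTop]
  intro ε hε
  set R := 2 * (A + 1) / ε with hR
  have hR0 : 0 < R := by positivity
  have hdom : Tendsto (fun n => ∫ x, min |f n x - f' x| (R * |g x|) * |g x| ∂μ) atTop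
      (𝓝 (∫ _, (0 : ℝ) ∂μ)) := by
    refine tendsto_integral_of_dominated_convergence (fun x => R * g x ^ 2)
      (fun n => ((((hf n).sub hf').abs.min (hg.abs.const_mul R)).mul hg.abs).aestronglyMeasurable)
      (hg2.const_mul R) (fun n => Eventually.of_forall fun x => ?_) ?_
    · rw [Real.norm_of_nonneg (by positivity), ← sq_abs (g x), sq, ← mul_assoc]
      exact mul_le_mul_of_nonneg_right (min_le_right _ _) (abs_nonneg _)
    · filter_upwards [hlim] with x hx
      have h1 : Tendsto (fun n => |f n x - f' x|) atTop (𝓝 0) := by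
        simpa using (hx.sub_const (f' x)).abs
      have h2 := (h1.min (tendsto_const_nhds (x := R * |g x|))).mul_const |g x|
      rwa [min_eq_left (by positivity), zero_mul] at h2
  rw [integral_zero, Metric.tendsto_atTop] at hdom
  obtain ⟨N, hN⟩ := hdom (ε / 2) (by positivity)
  refine ⟨N, fun n hn => ?_⟩
  have h1 := hN n hn
  rw [Real.dist_0_eq_abs, abs_of_nonneg (integral_nonneg fun x => by positivity)] at h1
  have i1 := integrable_mul_of_sq (hf n) hg (hf2 n) hg2
  have i2 := integrable_mul_of_sq hf' hg hf'2 hg2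
  have i3 : Integrable (fun x => min |f n x - f' x| (R * |g x|) * |g x|) μ :=
    (hg2.const_mul R).mono' (((((hf n).sub hf').abs.min (hg.abs.const_mul R)).mul
      hg.abs).aestronglyMeasurable) (Eventually.of_forall fun x => by
        rw [Real.norm_of_nonneg (by positivity), ← sq_abs (g x), sq, ← mul_assoc]
        exact mul_le_mul_of_nonneg_right (min_le_right _ _) (abs_nonneg _))
  rw [Real.dist_eq, ← integral_sub i1 i2]
  calc _ ≤ ∫ x, |f n x * g x - f' x * g x| ∂μ := abs_integral_le_integral_abs
    _ ≤ ∫ x, (min |f n x - f' x| (R * |g x|) * |g x| + (f n x - f' x) ^ 2 / R) ∂μ := by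
        refine integral_mono (i1.sub i2).abs (i3.add ((hdi n).div_const R)) fun x => ?_
        simp only [← sub_mul]
        exact abs_mul_le_min_add hR0
    _ ≤ ∫ x, min |f n x - f' x| (R * |g x|) * |g x| ∂μ + A / R := by
        rw [integral_add i3 ((hdi n).div_const R), integral_div]
        gcongr
        exact hdA n
    _ < ε / 2 + ε / 2 := by
        refine add_lt_add h1 ?_
        rw [hR, div_div_eq_mul_div, div_lt_div_iff₀ (by positivity) (by norm_num)]
        nlinarith
    _ = ε := add_halves ε

end WeakConvergence

section Energy

variable {Ω : Type*} [MeasurableSpace Ω] {ν : Measure Ω} {Λ : Measure (Ω × Ω)} {m : ℝ}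

/-- The energy of `u ^ m`. -/
def powEnergy (Λ : Measure (Ω × Ω)) (m : ℝ) (u : Ω → ℝ) : ℝ :=
  jumpForm Λ (fun x => u x ^ m) (fun x => u x ^ m)

lemma powEnergy_nonneg (u : Ω → ℝ) : 0 ≤ powEnergy Λ m u := jumpForm_self_nonneg _

lemma jumpForm_sub_right {v ψ₁ ψ₂ : Ω → ℝ} (hv : FormTest ν Λ m v) (h₁ : FormTest ν Λ m ψ₁)
    (h₂ : FormTest ν Λ m ψ₂) :
    jumpForm Λ v (fun x => ψ₁ x - ψ₂ x) = jumpForm Λ v ψ₁ - jumpForm Λ v ψ₂ := by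
  simp only [jumpForm]
  rw [← integral_sub (integrable_mul_of_sq (measurable_incr hv.meas) (measurable_incr h₁.meas)
    hv.energy h₁.energy) (integrable_mul_of_sq (measurable_incr hv.meas)
    (measurable_incr h₂.meas) hv.energy h₂.energy)]
  congr 1; ext p; simp only [incr]; ring

lemma Datum.potential_sub_le (hm : 1 < m) {B : ℝ} {f g : Ω → ℝ} (hf : Datum ν B f)
    (hg : Datum ν B g) : |potential ν m f - potential ν m g| ≤ B ^ m * dist1 ν f g := by
  have i1 := hf.int_rpow (r := m + 1) (by linarith)
  have i2 := hg.int_rpow (r := m + 1) (by linarith)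
  rw [potential, potential, ← mul_sub, ← integral_sub i1 i2, abs_mul,
    abs_of_pos (by positivity : 0 < 1 / (m + 1)), dist1, ← integral_const_mul]
  calc _ ≤ 1 / (m + 1) * ∫ x, |f x ^ (m + 1) - g x ^ (m + 1)| ∂ν := by
        gcongr; exact abs_integral_le_integral_abs
    _ ≤ _ := by
        rw [← integral_const_mul]
        refine integral_mono ((i1.sub i2).abs.const_mul _)
          ((integrable_abs_sub hf.int hg.int).const_mul _) fun x => ?_
        have := abs_rpow_sub_le (r := m + 1) (by linarith) (hf.nonneg x) (hg.nonneg x)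
          (hf.le x) (hg.le x)
        simp only
        rw [div_mul_eq_mul_div, one_mul, div_le_iff₀ (by linarith)]
        rw [add_sub_cancel_right] at this
        linarith

lemma Resolvent.energy_decay (hm : 1 < m) {h B : ℝ} (hh : 0 < h) {f f' u : Ω → ℝ}
    (hf : Resolvent ν Λ m h B f' f) (hu : Resolvent ν Λ m h B f u) :
    ∫ x, (u x ^ ((m + 1) / 2) - f x ^ ((m + 1) / 2)) ^ 2 ∂ν
      ≤ (m + 1) / 4 * h * (powEnergy Λ m f - powEnergy Λ m u) := by
  have hf' := hf.sol.formTest hm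
  have hu' := hu.sol.formTest hm
  have e := hu.eqn_mul hh (hf'.sub hm hu')
  rw [jumpForm_sub_right hu' hf' hu'] at e
  have h1 := jumpForm_le hu' hf' one_pos
  have i1 := hu.datum.int_sub_mul_rpow hm hf.datum hu.datum
  have i2 := hu.datum.int_sub_mul_rpow hm hf.datum hf.datum
  have i3 : Integrable (fun x => (f x - u x) * (f x ^ m - u x ^ m)) ν := by
    refine (i1.sub i2).congr (Eventually.of_forall fun x => ?_)
    simp only [Pi.sub_apply]; ring
  have h2 : ∫ x, (u x ^ ((m + 1) / 2) - f x ^ ((m + 1) / 2)) ^ 2 ∂ν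
      ≤ (m + 1) / 2 * ∫ x, (f x - u x) * (f x ^ m - u x ^ m) ∂ν := by
    rw [← integral_const_mul]
    refine integral_mono_of_nonneg (Eventually.of_forall fun x => sq_nonneg _)
      (i3.const_mul _) (Eventually.of_forall fun x => ?_)
    refine (half_power_sq_le hm (hu.sol.nonneg x) (hf.sol.nonneg x)).trans_eq ?_
    simp only; ring
  rw [e] at h2
  refine h2.trans ?_
  rw [powEnergy, powEnergy]
  have h3 : (m + 1) / 2 * (h * (jumpForm Λ (fun x => u x ^ m) (fun x => f x ^ m)
      - jumpForm Λ (fun x => u x ^ m) (fun x => u x ^ m)))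
      ≤ (m + 1) / 2 * (h * ((1 : ℝ) / 2 * jumpForm Λ (fun x => u x ^ m) (fun x => u x ^ m)
        + 1 / (2 * 1) * jumpForm Λ (fun x => f x ^ m) (fun x => f x ^ m)
        - jumpForm Λ (fun x => u x ^ m) (fun x => u x ^ m))) := by gcongr
  linarith

lemma Resolvent.powEnergy_le (hm : 1 < m) {h B : ℝ} (hh : 0 < h) {f f' u : Ω → ℝ}
    (hf : Resolvent ν Λ m h B f' f) (hu : Resolvent ν Λ m h B f u) :
    powEnergy Λ m u ≤ powEnergy Λ m f := by
  have h1 := hf.energy_decay hm hh hu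
  have h2 := (integral_nonneg (μ := ν) fun x =>
    sq_nonneg (u x ^ ((m + 1) / 2) - f x ^ ((m + 1) / 2))).trans h1
  have h3 : 0 < (m + 1) / 4 * h := by positivity
  have := (mul_nonneg_iff_of_pos_left h3).1 h2
  linarith

lemma Scheme.mul_powEnergy_le (hm : 1 < m) {h B : ℝ} (hh : 0 < h) {U : ℕ → Ω → ℝ}
    (hU : Scheme ν Λ m h B U) (i k : ℕ) :
    k * h * powEnergy Λ m (U (i + k)) ≤ potential ν m (U i) - potential ν m (U (i + k)) := by
  induction k with
  | zero => simp
  | succ k ih =>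
    have h1 := (hU.step (i + k)).energy_le hm hh (hU.datum _)
    have h2 : k * h * powEnergy Λ m (U (i + k + 1)) ≤ k * h * powEnergy Λ m (U (i + k)) := by
      rcases Nat.eq_zero_or_pos (i + k) with hik | hik
      · have : k = 0 := by omega
        simp [this]
      · obtain ⟨j, hj⟩ := Nat.exists_eq_succ_of_ne_zero hik.ne'
        have hs := hU.step (i + k)
        rw [hj] at hs ⊢
        gcongr
        exact (hU.step j).powEnergy_le hm hh hs
    rw [← add_assoc]
    rw [← powEnergy] at h1
    push_cast
    linarith

lemma Scheme.powEnergy_grid_le (hm : 1 < m) {h B : ℝ} (hh : 0 < h) {U : ℕ → Ω → ℝ}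
    (hU : Scheme ν Λ m h B U) {s t : ℝ} (hs : 0 ≤ s) :
    (t - s - h) * powEnergy Λ m (U (grid h t)) ≤ potential ν m (U (grid h s)) := by
  have hΦ := fun n => potential_nonneg hm (ν := ν) (hU.datum n).nonneg
  have he := powEnergy_nonneg (Λ := Λ) (m := m) (U (grid h t))
  rcases le_or_gt (t - s - h) 0 with h0 | h0
  · exact (mul_nonpos_of_nonpos_of_nonneg h0 he).trans (hΦ _)
  · have hij := grid_mono hh (by linarith : s ≤ t)
    obtain ⟨k, hk⟩ := Nat.exists_eq_add_of_le hij
    have h1 := hU.mul_powEnergy_le hm hh (grid h s) k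
    rw [← hk] at h1
    have h2 := grid_mul_lt hh s
    have h3 := le_grid_mul hh t
    rw [max_eq_left hs] at h2
    have h4 := le_max_left t 0
    rw [hk] at h3
    push_cast at h3
    have h5 : t - s - h ≤ k * h := by linarith
    have := mul_le_mul_of_nonneg_right h5 he
    linarith [hΦ (grid h t)]

lemma Scheme.mul_powEnergy_grid_le (hm : 1 < m) {h B : ℝ} (hh : 0 < h) {U : ℕ → Ω → ℝ}
    (hU : Scheme ν Λ m h B U) (t : ℝ) :
    t * powEnergy Λ m (U (grid h t)) ≤ potential ν m (U 0) := by
  have h1 := hU.mul_powEnergy_le hm hh 0 (grid h t)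
  rw [zero_add] at h1
  have h3 := (le_max_left _ _).trans (le_grid_mul hh t)
  have := mul_le_mul_of_nonneg_right h3 (powEnergy_nonneg (Λ := Λ) (m := m) (U (grid h t)))
  linarith [potential_nonneg hm (ν := ν) (hU.datum (grid h t)).nonneg]

end Energy

section LimitEnergy

variable {Ω : Type*} [MeasurableSpace Ω] {ν : Measure Ω} {Λ : Measure (Ω × Ω)} {m B : ℝ}
  {h : ℕ → ℝ} {U : ℕ → ℕ → Ω → ℝ} {u : ℝ → Ω → ℝ}

lemma EulerLimit.step (E : EulerLimit ν Λ m B h U u) (n : ℕ) {t : ℝ} (ht : 0 < t) :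
    Resolvent ν Λ m (h n) B (U n (grid (h n) (t - h n))) (U n (grid (h n) t)) := by
  rw [grid_sub (E.pos n) ht]
  exact (E.scheme n).step _

lemma EulerLimit.formTest_step (E : EulerLimit ν Λ m B h U u) (hm : 1 < m) (n : ℕ) {t : ℝ}
    (ht : 0 < t) : FormTest ν Λ m (fun x => U n (grid (h n) t) x ^ m) :=
  (E.step n ht).sol.formTest hm

lemma EulerLimit.powEnergy_step_le (E : EulerLimit ν Λ m B h U u) (hm : 1 < m) (n : ℕ) {t : ℝ}
    (ht : 0 < t) : powEnergy Λ m (U n (grid (h n) t)) ≤ potential ν m (U 0 0) / t := by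
  have := (E.scheme n).mul_powEnergy_grid_le hm (E.pos n) t
  rw [E.start] at this
  rw [le_div_iff₀ ht]; linarith

lemma EulerLimit.ae_lim_rpow (E : EulerLimit ν Λ m B h U u) {r : ℝ} (hr : 0 < r) (t : ℝ) :
    ∀ᵐ x ∂ν, Tendsto (fun n => U n (grid (h n) t) x ^ r) atTop (𝓝 (u t x ^ r)) := by
  filter_upwards [E.ae_lim t] with x hx
  exact hx.rpow_const (Or.inr hr.le)

lemma FormTest.ofReal_jumpForm {v : Ω → ℝ} (hv : FormTest ν Λ m v) :
    ∫⁻ p, ENNReal.ofReal (incr v p ^ 2) ∂Λ = ENNReal.ofReal (jumpForm Λ v v) := by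
  rw [lintegral_ofReal_eq hv.energy fun _ => sq_nonneg _, jumpForm]
  simp only [sq]

lemma EulerLimit.lintegral_incr_le (E : EulerLimit ν Λ m B h U u) (hJ : JumpSpace ν Λ m)
    (hm : 1 < m) {t : ℝ} (ht : 0 < t) :
    ∫⁻ p, ENNReal.ofReal (incr (fun x => u t x ^ m) p ^ 2) ∂Λ
      ≤ liminf (fun n => ENNReal.ofReal (powEnergy Λ m (U n (grid (h n) t)))) atTop := by
  have h1 := lintegral_ofReal_le_liminf (μ := Λ)
    (F := fun n p => incr (fun x => U n (grid (h n) t) x ^ m) p ^ 2)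
    (f := fun p => incr (fun x => u t x ^ m) p ^ 2)
    (fun n => (measurable_incr (E.formTest_step hm n ht).meas).pow_const 2)
    (by filter_upwards [hJ.ae_tendsto_incr (E.ae_lim_rpow (by linarith : 0 < m) t)] with p hp
        exact hp.pow 2)
  simp only [(E.formTest_step hm _ ht).ofReal_jumpForm] at h1
  exact h1

lemma EulerLimit.formTest (E : EulerLimit ν Λ m B h U u) (hJ : JumpSpace ν Λ m) (hm : 1 < m)
    {t : ℝ} (ht : 0 < t) : FormTest ν Λ m (fun x => u t x ^ m) where
  meas := (E.datum t).meas.pow_const m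
  int := by
    refine ((E.datum t).int_rpow (r := m + 1) (by linarith)).congr
      (Eventually.of_forall fun x => ?_)
    simp only
    have hx := (E.datum t).nonneg x
    rw [abs_of_nonneg (Real.rpow_nonneg hx _), ← Real.rpow_mul hx]
    congr 1; field_simp
  energy := by
    refine integrable_of_lintegral_ofReal_ne_top
      ((measurable_incr ((E.datum t).meas.pow_const m)).pow_const 2) (fun _ => sq_nonneg _)
      (ne_top_of_le_ne_top (ENNReal.ofReal_ne_top (r := potential ν m (U 0 0) / t))
        ((E.lintegral_incr_le hJ hm ht).trans ?_))
    exact liminf_le_of_frequently_le' (Frequently.of_forall fun n =>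
      ENNReal.ofReal_le_ofReal (E.powEnergy_step_le hm n ht))

lemma EulerLimit.powEnergy_le_liminf (E : EulerLimit ν Λ m B h U u) (hJ : JumpSpace ν Λ m)
    (hm : 1 < m) {t : ℝ} (ht : 0 < t) :
    ENNReal.ofReal (powEnergy Λ m (u t))
      ≤ liminf (fun n => ENNReal.ofReal (powEnergy Λ m (U n (grid (h n) t)))) atTop := by
  have := E.lintegral_incr_le hJ hm ht
  rwa [(E.formTest hJ hm ht).ofReal_jumpForm] at this

lemma EulerLimit.powEnergy_le (E : EulerLimit ν Λ m B h U u) (hJ : JumpSpace ν Λ m)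
    (hm : 1 < m) {t : ℝ} (ht : 0 < t) : powEnergy Λ m (u t) ≤ potential ν m (U 0 0) / t := by
  have h0 := potential_nonneg hm (ν := ν) ((E.scheme 0).datum 0).nonneg
  refine (ENNReal.ofReal_le_ofReal_iff (by positivity)).1
    ((E.powEnergy_le_liminf hJ hm ht).trans ?_)
  exact liminf_le_of_frequently_le' (Frequently.of_forall fun n =>
    ENNReal.ofReal_le_ofReal (E.powEnergy_step_le hm n ht))

lemma EulerLimit.tendsto_jumpForm (E : EulerLimit ν Λ m B h U u) (hJ : JumpSpace ν Λ m)
    (hm : 1 < m) {t : ℝ} (ht : 0 < t) {ψ : Ω → ℝ} (hψ : FormTest ν Λ m ψ) :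
    Tendsto (fun n => jumpForm Λ (fun x => U n (grid (h n) t) x ^ m) ψ) atTop
      (𝓝 (jumpForm Λ (fun x => u t x ^ m) ψ)) := by
  refine tendsto_integral_mul_of_ae_tendsto (M := potential ν m (U 0 0) / t)
    (fun n => measurable_incr (E.formTest_step hm n ht).meas)
    (measurable_incr (E.formTest hJ hm ht).meas) (measurable_incr hψ.meas)
    (fun n => (E.formTest_step hm n ht).energy) (fun n => ?_) (E.formTest hJ hm ht).energy
    hψ.energy (hJ.ae_tendsto_incr (E.ae_lim_rpow (by linarith : 0 < m) t))
  have := E.powEnergy_step_le hm n ht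
  simpa only [powEnergy, jumpForm, sq] using this

lemma abs_jumpForm_le {v ψ : Ω → ℝ} (hv : FormTest ν Λ m v) (hψ : FormTest ν Λ m ψ) :
    |jumpForm Λ v ψ| ≤ 1 / 2 * jumpForm Λ v v + 1 / 2 * jumpForm Λ ψ ψ := by
  have h1 := jumpForm_le hv hψ one_pos
  have h2 := jumpForm_le hv hψ.neg one_pos
  rw [jumpForm_neg_right] at h2
  have e : jumpForm Λ (fun x => -ψ x) (fun x => -ψ x) = jumpForm Λ ψ ψ := by
    simp only [jumpForm, incr]; congr 1; ext p; ring
  rw [e] at h2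
  rw [abs_le]; constructor <;> linarith

lemma EulerLimit.dist1_le (E : EulerLimit ν Λ m B h U u) (t : ℝ) {ε : ℝ} (hε : 0 < ε) :
    ∃ δ, 0 < δ ∧ ∀ s, |s - t| < δ → dist1 ν (u s) (u t) ≤ ε := by
  obtain ⟨δ, hδ, N, hN⟩ := E.modulus t (ε / 2) (by positivity)
  refine ⟨δ, hδ, fun s hs => ?_⟩
  obtain ⟨δ', hδ', N', hN'⟩ := E.modulus s (ε / 2) (by positivity)
  have h1 := hN (max N N') (le_max_left _ _) s hs
  have h2 := hN' (max N N') (le_max_right _ _) s (by simpa using hδ')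
  have hd := ((E.scheme (max N N')).datum (grid (h (max N N')) s)).int
  have h3 := dist1_triangle (E.datum s).int hd (E.datum t).int
  rw [dist1_comm (u s) (U _ _)] at h3
  linarith

lemma EulerLimit.ae_eq_start (E : EulerLimit ν Λ m B h U u) : u 0 =ᵐ[ν] U 0 0 := by
  filter_upwards [E.ae_lim 0] with x hx
  have : ∀ n, U n (grid (h n) 0) x = U 0 0 x := fun n => by
    rw [grid_of_nonpos (E.pos n) le_rfl, E.start]
  simp only [this] at hx
  exact tendsto_nhds_unique hx tendsto_const_nhds

/-- Functions that are continuous for the `L¹` distance are continuous along the flow. -/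
lemma EulerLimit.continuous_of_dist1 (E : EulerLimit ν Λ m B h U u) {G : (Ω → ℝ) → ℝ} {C : ℝ}
    (hC : 0 ≤ C) (hG : ∀ f g, Datum ν B f → Datum ν B g → |G f - G g| ≤ C * dist1 ν f g) :
    Continuous fun t => G (u t) := by
  rw [Metric.continuous_iff]
  intro t ε hε
  obtain ⟨δ, hδ, hd⟩ := E.dist1_le t (ε := ε / (2 * (C + 1))) (by positivity)
  refine ⟨δ, hδ, fun s hs => ?_⟩
  rw [Real.dist_eq] at hs ⊢
  refine (hG _ _ (E.datum s) (E.datum t)).trans_lt ?_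
  refine (mul_le_mul_of_nonneg_left (hd s hs) hC).trans_lt ?_
  rw [mul_div_assoc', div_lt_iff₀ (by positivity)]; nlinarith

lemma EulerLimit.modulus_of_dist1 (E : EulerLimit ν Λ m B h U u) {G : (Ω → ℝ) → ℝ} {C : ℝ}
    (hC : 0 ≤ C) (hG : ∀ f g, Datum ν B f → Datum ν B g → |G f - G g| ≤ C * dist1 ν f g)
    (t ε : ℝ) (hε : 0 < ε) :
    ∃ δ, 0 < δ ∧ ∃ N, ∀ n ≥ N, ∀ s, |s - t| < δ →
      |G (U n (grid (h n) s)) - G (u t)| ≤ ε := by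
  obtain ⟨δ, hδ, N, hN⟩ := E.modulus t (ε / (C + 1)) (by positivity)
  refine ⟨δ, hδ, N, fun n hn s hs => ?_⟩
  refine (hG _ _ ((E.scheme n).datum _) (E.datum t)).trans ?_
  refine (mul_le_mul_of_nonneg_left (hN n hn s hs) hC).trans ?_
  rw [mul_div_assoc', div_le_iff₀ (by positivity)]; nlinarith

end LimitEnergy

section Averages

lemma tendsto_average {G : ℕ → ℝ → ℝ} {g s : ℝ} {h a : ℕ → ℝ} (hpos : ∀ n, 0 < h n)
    (hlim : Tendsto h atTop (𝓝 0)) (ha : ∀ n, |a n - s| ≤ h n)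
    (hmod : ∀ ε : ℝ, 0 < ε → ∃ δ : ℝ, 0 < δ ∧ ∃ N, ∀ n ≥ N, ∀ t, |t - s| < δ → |G n t - g| ≤ ε)
    (hint : ∀ n a b, IntervalIntegrable (G n) volume a b) :
    Tendsto (fun n => (∫ t in a n..a n + h n, G n t) / h n) atTop (𝓝 g) := by
  rw [Metric.tendsto_atTop]
  intro ε hε
  obtain ⟨δ, hδ, N, hN⟩ := hmod (ε / 2) (by positivity)
  obtain ⟨N', hN'⟩ := (Metric.tendsto_atTop.1 hlim) (δ / 2) (by positivity)
  refine ⟨max N N', fun n hn => ?_⟩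
  have hh := hN' n ((le_max_right _ _).trans hn)
  rw [Real.dist_0_eq_abs, abs_of_pos (hpos n)] at hh
  have e : (∫ t in a n..a n + h n, G n t) / h n - g
      = (∫ t in a n..a n + h n, (G n t - g)) / h n := by
    rw [intervalIntegral.integral_sub (hint n _ _) intervalIntegrable_const,
      intervalIntegral.integral_const, add_sub_cancel_left, smul_eq_mul]
    have := (hpos n).ne'
    field_simp
  have hb : ‖∫ t in a n..a n + h n, (G n t - g)‖ ≤ ε / 2 * |a n + h n - a n| := by
    refine intervalIntegral.norm_integral_le_of_norm_le_const fun t ht => ?_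
    rw [uIoc_of_le (by linarith [hpos n])] at ht
    refine hN n ((le_max_left _ _).trans hn) t ?_
    have h1 := abs_le.1 (ha n)
    have h2 := ht.1
    have h3 := ht.2
    rw [abs_lt]; constructor <;> linarith
  rw [add_sub_cancel_left, abs_of_pos (hpos n), Real.norm_eq_abs] at hb
  rw [Real.dist_eq, e, abs_div, abs_of_pos (hpos n), div_lt_iff₀ (hpos n)]
  nlinarith [hpos n]

lemma intervalIntegrable_grid (e : ℕ → ℝ) (h : ℝ) (hh : 0 < h) (a b : ℝ) :
    IntervalIntegrable (fun t => e (grid h t)) volume a b := by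
  have hm : Measurable (fun t => e (grid h t)) := (measurable_from_nat).comp (measurable_grid h)
  rw [intervalIntegrable_iff]
  refine Measure.integrableOn_of_bounded (M := ∑ k ∈ Finset.range (grid h (max a b) + 1), |e k|)
    (by simp) hm.aestronglyMeasurable ?_
  filter_upwards [ae_restrict_mem measurableSet_uIoc] with t ht
  refine Finset.single_le_sum (f := fun k => |e k|) (fun _ _ => abs_nonneg _) ?_
  rw [Finset.mem_range, Nat.lt_succ_iff]
  exact grid_mono hh ht.2

lemma integral_sub_shift {G : ℝ → ℝ} (hG : ∀ a b, IntervalIntegrable G volume a b) (a b h : ℝ) :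
    ∫ t in a..b, (G (t - h) - G t) = (∫ t in a - h..a, G t) - ∫ t in b - h..b, G t := by
  rw [intervalIntegral.integral_sub _ (hG a b), intervalIntegral.integral_comp_sub_right (f := G)]
  · rw [← intervalIntegral.integral_add_adjacent_intervals (hG (a - h) a) (hG a (b - h)),
      ← intervalIntegral.integral_add_adjacent_intervals (hG a (b - h)) (hG (b - h) b)]
    ring
  · have := (hG (a - h) (b - h)).comp_sub_right h
    simpa using this

end Averages

section EnergyIdentity

variable {Ω : Type*} [MeasurableSpace Ω] {ν : Measure Ω} {Λ : Measure (Ω × Ω)} {m B : ℝ}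
  {h : ℕ → ℝ} {U : ℕ → ℕ → Ω → ℝ} {u : ℝ → Ω → ℝ}

lemma EulerLimit.tendsto_average_dist1 (E : EulerLimit ν Λ m B h U u) {G : (Ω → ℝ) → ℝ} {C : ℝ}
    (hC : 0 ≤ C) (hG : ∀ f g, Datum ν B f → Datum ν B g → |G f - G g| ≤ C * dist1 ν f g)
    (t : ℝ) :
    Tendsto (fun n => (∫ s in t - h n..t, G (U n (grid (h n) s))) / h n) atTop (𝓝 (G (u t))) := by
  have := tendsto_average (G := fun n s => G (U n (grid (h n) s))) (g := G (u t)) (s := t)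
    (a := fun n => t - h n) E.pos E.lim (fun n => by
      rw [sub_sub_cancel_left, abs_neg, abs_of_pos (E.pos n)])
    (E.modulus_of_dist1 hC hG t)
    (fun n => intervalIntegrable_grid (fun k => G (U n k)) (h n) (E.pos n))
  simpa only [sub_add_cancel] using this

lemma EulerLimit.measurable_incr_rpow (E : EulerLimit ν Λ m B h U u) :
    Measurable (fun q : ℝ × (Ω × Ω) => incr (fun x => u q.1 x ^ m) q.2) :=
  ((E.meas.comp ((measurable_fst.comp measurable_snd).prodMk measurable_fst)).pow_const m).sub
    ((E.meas.comp ((measurable_snd.comp measurable_snd).prodMk measurable_fst)).pow_const m)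

variable [SFinite Λ]

lemma EulerLimit.measurable_powEnergy (E : EulerLimit ν Λ m B h U u) :
    Measurable (fun t => powEnergy Λ m (u t)) :=
  ((E.measurable_incr_rpow.mul E.measurable_incr_rpow).stronglyMeasurable.integral_prod_right'
    (ν := Λ)).measurable

lemma EulerLimit.measurable_jumpForm (E : EulerLimit ν Λ m B h U u) {ψ : Ω → ℝ}
    (hψ : Measurable ψ) : Measurable (fun t => jumpForm Λ (fun x => u t x ^ m) ψ) :=
  ((E.measurable_incr_rpow.mul ((measurable_incr hψ).comp
    measurable_snd)).stronglyMeasurable.integral_prod_right' (ν := Λ)).measurable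

lemma EulerLimit.intervalIntegrable_powEnergy (E : EulerLimit ν Λ m B h U u)
    (hJ : JumpSpace ν Λ m) (hm : 1 < m) {a b : ℝ} (ha : 0 < a) (hb : 0 < b) :
    IntervalIntegrable (fun t => powEnergy Λ m (u t)) volume a b := by
  rw [intervalIntegrable_iff]
  refine Measure.integrableOn_of_bounded (M := potential ν m (U 0 0) / min a b)
    (by simp) E.measurable_powEnergy.aestronglyMeasurable ?_
  filter_upwards [ae_restrict_mem measurableSet_uIoc] with t ht
  have h0 : 0 < min a b := lt_min ha hb
  rw [Real.norm_of_nonneg (powEnergy_nonneg _)]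
  refine (E.powEnergy_le hJ hm (h0.trans ht.1)).trans ?_
  have := potential_nonneg hm (ν := ν) ((E.scheme 0).datum 0).nonneg
  gcongr
  exact ht.1.le

lemma abs_potential_sub_le (hm : 1 < m) (f g : Ω → ℝ) (hf : Datum ν B f) (hg : Datum ν B g) :
    |potential ν m f - potential ν m g| ≤ B ^ m * dist1 ν f g := hf.potential_sub_le hm hg

lemma EulerLimit.energy_le (E : EulerLimit ν Λ m B h U u) (hJ : JumpSpace ν Λ m) (hm : 1 < m)
    (hB : 0 ≤ B) {a b : ℝ} (ha : 0 < a) (hab : a < b) :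
    ∫ t in a..b, powEnergy Λ m (u t) ≤ potential ν m (u a) - potential ν m (u b) := by
  have hlim := (E.tendsto_average_dist1 (Real.rpow_nonneg hB m)
    (abs_potential_sub_le (ν := ν) hm) a).sub (E.tendsto_average_dist1 (Real.rpow_nonneg hB m)
    (abs_potential_sub_le (ν := ν) hm) b)
  have hen : ∀ n, IntervalIntegrable (fun t => powEnergy Λ m (U n (grid (h n) t))) volume a b :=
    fun n => intervalIntegrable_grid (fun k => powEnergy Λ m (U n k)) (h n) (E.pos n) a b
  have hF : ∀ n a b, IntervalIntegrable (fun t => potential ν m (U n (grid (h n) t))) volume a b :=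
    fun n => intervalIntegrable_grid (fun k => potential ν m (U n k)) (h n) (E.pos n)
  have hn : ∀ n, ∫ t in a..b, powEnergy Λ m (U n (grid (h n) t))
      ≤ (∫ s in a - h n..a, potential ν m (U n (grid (h n) s))) / h n
        - (∫ s in b - h n..b, potential ν m (U n (grid (h n) s))) / h n := by
    intro n
    rw [← sub_div, ← integral_sub_shift (hF n), le_div_iff₀ (E.pos n),
      ← intervalIntegral.integral_mul_const]
    refine intervalIntegral.integral_mono_on hab.le ((hen n).mul_const _) ?_ fun t ht => ?_
    · have := (hF n (a - h n) (b - h n)).comp_sub_right (h n)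
      simp only [sub_add_cancel] at this
      exact this.sub (hF n a b)
    · rw [mul_comm]
      exact (E.step n (ha.trans_le ht.1)).energy_le hm (E.pos n) ((E.scheme n).datum _)
  have h0 : 0 ≤ potential ν m (u a) - potential ν m (u b) := by
    refine ge_of_tendsto' hlim fun n => le_trans ?_ (hn n)
    exact intervalIntegral.integral_nonneg hab.le fun t _ => powEnergy_nonneg _
  have hi := (E.intervalIntegrable_powEnergy hJ hm ha (ha.trans hab))
  rw [intervalIntegrable_iff_integrableOn_Ioc_of_le hab.le] at hi
  rw [intervalIntegral.integral_of_le hab.le]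
  refine (ENNReal.ofReal_le_ofReal_iff h0).1 ?_
  rw [← lintegral_ofReal_eq hi fun _ => powEnergy_nonneg _]
  calc _ ≤ ∫⁻ t in Ioc a b, liminf (fun n =>
          ENNReal.ofReal (powEnergy Λ m (U n (grid (h n) t)))) atTop := by
        refine setLIntegral_mono' measurableSet_Ioc fun t ht => ?_
        exact E.powEnergy_le_liminf hJ hm (ha.trans ht.1)
    _ ≤ liminf (fun n => ∫⁻ t in Ioc a b,
          ENNReal.ofReal (powEnergy Λ m (U n (grid (h n) t)))) atTop :=
        lintegral_liminf_le fun n => ((measurable_from_nat (f := fun k =>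
          powEnergy Λ m (U n k))).comp (measurable_grid (h n))).ennreal_ofReal
    _ ≤ liminf (fun n => ENNReal.ofReal
          ((∫ s in a - h n..a, potential ν m (U n (grid (h n) s))) / h n
            - (∫ s in b - h n..b, potential ν m (U n (grid (h n) s))) / h n)) atTop := by
        refine liminf_le_liminf (Eventually.of_forall fun n => ?_)
        have h1 := hen n
        rw [intervalIntegrable_iff_integrableOn_Ioc_of_le hab.le] at h1
        rw [lintegral_ofReal_eq h1 fun _ => powEnergy_nonneg _,
          ← intervalIntegral.integral_of_le hab.le]
        exact ENNReal.ofReal_le_ofReal (hn n)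
    _ = _ := ((ENNReal.continuous_ofReal.tendsto _).comp hlim).liminf_eq

lemma Datum.abs_integral_mul_sub_le {f g ψ : Ω → ℝ} {C : ℝ} (hψm : Measurable ψ)
    (hψ : ∀ x, |ψ x| ≤ C) (hf : Datum ν B f) (hg : Datum ν B g) :
    |∫ x, f x * ψ x ∂ν - ∫ x, g x * ψ x ∂ν| ≤ C * dist1 ν f g := by
  have i1 := integrable_mul_bdd hf.int hψm hψ
  have i2 := integrable_mul_bdd hg.int hψm hψ
  rw [← integral_sub i1 i2, dist1, ← integral_const_mul]
  refine abs_integral_le_integral_abs.trans (integral_mono (i1.sub i2).abs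
    ((integrable_abs_sub hf.int hg.int).const_mul C) fun x => ?_)
  simp only
  rw [← sub_mul, abs_mul, mul_comm]
  exact mul_le_mul_of_nonneg_right (hψ x) (abs_nonneg _)

/-- The equation tested with a function of the space variable. -/
lemma EulerLimit.integral_mul_sub (E : EulerLimit ν Λ m B h U u) (hJ : JumpSpace ν Λ m)
    (hm : 1 < m) {ψ : Ω → ℝ} (hψ : FormTest ν Λ m ψ) {C : ℝ} (hC : 0 ≤ C)
    (hψC : ∀ x, |ψ x| ≤ C) {a b : ℝ} (ha : 0 < a) (hab : a < b) :
    ∫ x, u a x * ψ x ∂ν - ∫ x, u b x * ψ x ∂ν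
      = ∫ t in a..b, jumpForm Λ (fun x => u t x ^ m) ψ := by
  have hG := fun f g => Datum.abs_integral_mul_sub_le (ν := ν) (B := B) (f := f) (g := g)
    hψ.meas hψC
  have hlim := (E.tendsto_average_dist1 (G := fun f => ∫ x, f x * ψ x ∂ν) hC hG a).sub
    (E.tendsto_average_dist1 (G := fun f => ∫ x, f x * ψ x ∂ν) hC hG b)
  refine tendsto_nhds_unique hlim ?_
  have hF : ∀ n a b, IntervalIntegrable (fun t => ∫ x, U n (grid (h n) t) x * ψ x ∂ν) volume a b :=
    fun n => intervalIntegrable_grid (fun k => ∫ x, U n k x * ψ x ∂ν) (h n) (E.pos n)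
  have e : ∀ n, (∫ s in a - h n..a, ∫ x, U n (grid (h n) s) x * ψ x ∂ν) / h n
        - (∫ s in b - h n..b, ∫ x, U n (grid (h n) s) x * ψ x ∂ν) / h n
      = ∫ t in a..b, jumpForm Λ (fun x => U n (grid (h n) t) x ^ m) ψ := by
    intro n
    rw [← sub_div, ← integral_sub_shift (hF n), div_eq_iff (E.pos n).ne',
      ← intervalIntegral.integral_mul_const]
    refine intervalIntegral.integral_congr fun t ht => ?_
    rw [uIcc_of_le hab.le] at ht
    have hs := E.step n (ha.trans_le ht.1)
    have i1 := integrable_mul_bdd ((E.scheme n).datum (grid (h n) (t - h n))).int hψ.meas hψC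
    have i2 := integrable_mul_bdd ((E.scheme n).datum (grid (h n) t)).int hψ.meas hψC
    rw [mul_comm, ← hs.eqn_mul (E.pos n) hψ, ← integral_sub i1 i2]
    simp only [sub_mul]
  simp only [e]
  have h0 := potential_nonneg hm (ν := ν) ((E.scheme 0).datum 0).nonneg
  refine intervalIntegral.tendsto_integral_filter_of_dominated_convergence
    (fun _ => 1 / 2 * (potential ν m (U 0 0) / a) + 1 / 2 * jumpForm Λ ψ ψ)
    (Eventually.of_forall fun n => ((measurable_from_nat (f := fun k =>
      jumpForm Λ (fun x => U n k x ^ m) ψ)).comp (measurable_grid (h n))).aestronglyMeasurable)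
    (Eventually.of_forall fun n => Eventually.of_forall fun t ht => ?_)
    intervalIntegrable_const (Eventually.of_forall fun t ht => ?_)
  · rw [uIoc_of_le hab.le] at ht
    have ht0 := ha.trans ht.1
    refine (abs_jumpForm_le (E.formTest_step hm n ht0) hψ).trans ?_
    gcongr
    refine (E.powEnergy_step_le hm n ht0).trans ?_
    gcongr
    exact ht.1.le
  · rw [uIoc_of_le hab.le] at ht
    exact E.tendsto_jumpForm hJ hm (ha.trans ht.1) hψ

end EnergyIdentity

section EnergyEquality

variable {Ω : Type*} [MeasurableSpace Ω] {ν : Measure Ω} {Λ : Measure (Ω × Ω)} {m B : ℝ}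
  {h : ℕ → ℝ} {U : ℕ → ℕ → Ω → ℝ} {u : ℝ → Ω → ℝ}

lemma Datum.potential_sub_le_integral (hm : 1 < m) {f g : Ω → ℝ} (hf : Datum ν B f)
    (hg : Datum ν B g) :
    potential ν m f - potential ν m g ≤ ∫ x, f x * f x ^ m ∂ν - ∫ x, g x * f x ^ m ∂ν := by
  have hb := hf.rpow_le (r := m) (by linarith)
  have i1 := integrable_mul_bdd hf.int (hf.meas.pow_const m) hb
  have i2 := integrable_mul_bdd hg.int (hf.meas.pow_const m) hb
  have j1 := (hf.int_rpow (r := m + 1) (by linarith)).const_mul (1 / (m + 1))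
  have j2 := (hg.int_rpow (r := m + 1) (by linarith)).const_mul (1 / (m + 1))
  rw [potential, potential, ← integral_const_mul, ← integral_const_mul, ← integral_sub j1 j2,
    ← integral_sub i1 i2]
  refine integral_mono (j1.sub j2) (i1.sub i2) fun x => ?_
  have := power_tangent hm (hg.nonneg x) (hf.nonneg x)
  simp only
  linarith

variable [SFinite Λ]

lemma EulerLimit.le_energy (E : EulerLimit ν Λ m B h U u) (hJ : JumpSpace ν Λ m) (hm : 1 < m)
    (hB : 0 ≤ B) {a b : ℝ} (ha : 0 < a) (hab : a < b) :
    potential ν m (u a) - potential ν m (u b) ≤ ∫ t in a..b, powEnergy Λ m (u t) := by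
  set e : ℝ → ℝ := fun t => powEnergy Λ m (u (max t a)) with he
  have hem : Measurable e := E.measurable_powEnergy.comp (measurable_id.max measurable_const)
  have hΦ := potential_nonneg hm (ν := ν) ((E.scheme 0).datum 0).nonneg
  have hei : ∀ c d, IntervalIntegrable e volume c d := fun c d => by
    rw [intervalIntegrable_iff]
    refine Measure.integrableOn_of_bounded (M := potential ν m (U 0 0) / a)
      (by simp) hem.aestronglyMeasurable (Eventually.of_forall fun t => ?_)
    have h0 : 0 < max t a := ha.trans_le (le_max_right _ _)
    rw [Real.norm_of_nonneg (powEnergy_nonneg _)]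
    refine (E.powEnergy_le hJ hm h0).trans ?_
    gcongr
    exact le_max_right _ _
  have hee : ∀ t, a ≤ t → e t = powEnergy Λ m (u t) := fun t ht => by
    simp only [he, max_eq_left ht]
  have hE : ∫ t in a..b, powEnergy Λ m (u t) = ∫ t in a..b, e t := by
    refine intervalIntegral.integral_congr fun t ht => ?_
    rw [uIcc_of_le hab.le] at ht
    exact (hee t ht.1).symm
  set K : ℝ → ℝ := fun t => potential ν m (u t) + 1 / 2 * ∫ τ in a..t, e τ with hK
  have hKc : Continuous K :=
    (E.continuous_of_dist1 (Real.rpow_nonneg hB m) (abs_potential_sub_le hm)).add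
      ((intervalIntegral.continuous_primitive hei a).const_mul _)
  have hpt : ∀ t δ, a ≤ t → 0 < δ → K t - K (t + δ) ≤ 1 / 2 * δ * e t := by
    intro t δ hat hδ
    have ht0 := ha.trans_le hat
    have hψ := E.formTest hJ hm ht0
    have h1 := (E.datum t).potential_sub_le_integral hm (E.datum (t + δ))
    rw [E.integral_mul_sub hJ hm hψ (Real.rpow_nonneg hB m)
      ((E.datum t).rpow_le (by linarith)) ht0 (by linarith : t < t + δ)] at h1
    have h2 : ∫ τ in t..t + δ, jumpForm Λ (fun x => u τ x ^ m) (fun x => u t x ^ m)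
        ≤ ∫ τ in t..t + δ, (1 / 2 * e τ + 1 / 2 * e t) := by
      refine intervalIntegral.integral_mono_on_of_le_Ioo (by linarith) ?_
        (((hei _ _).const_mul _).add intervalIntegrable_const) fun τ hτ => ?_
      · rw [intervalIntegrable_iff]
        refine Measure.integrableOn_of_bounded (M := 1 / 2 * (potential ν m (U 0 0) / a)
          + 1 / 2 * (potential ν m (U 0 0) / a)) (by simp)
          (E.measurable_jumpForm hψ.meas).aestronglyMeasurable ?_
        filter_upwards [ae_restrict_mem measurableSet_uIoc] with τ hτ
        rw [uIoc_of_le (by linarith)] at hτ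
        refine (abs_jumpForm_le (E.formTest hJ hm (ht0.trans hτ.1)) hψ).trans ?_
        have k1 := E.powEnergy_le hJ hm (ht0.trans hτ.1)
        have k2 := E.powEnergy_le hJ hm ht0
        rw [powEnergy] at k1 k2
        have k3 : potential ν m (U 0 0) / τ ≤ potential ν m (U 0 0) / a := by
          gcongr; linarith [hτ.1]
        have k4 : potential ν m (U 0 0) / t ≤ potential ν m (U 0 0) / a := by gcongr
        linarith
      · rw [hee τ (hat.trans hτ.1.le), hee t hat]
        have := jumpForm_le (E.formTest hJ hm (ht0.trans hτ.1)) hψ one_pos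
        rw [powEnergy, powEnergy]
        linarith
    rw [intervalIntegral.integral_add ((hei _ _).const_mul _) intervalIntegrable_const,
      intervalIntegral.integral_const_mul, intervalIntegral.integral_const, smul_eq_mul,
      add_sub_cancel_left] at h2
    have h3 := intervalIntegral.integral_add_adjacent_intervals (hei a t) (hei t (t + δ))
    simp only [hK, ← h3]
    linarith
  have hKi : ∀ c d, IntervalIntegrable K volume c d := fun c d => hKc.intervalIntegrable c d
  have havg : ∀ c, Tendsto (fun n => (∫ t in c..c + h n, K t) / h n) atTop (𝓝 (K c)) := fun c => by
    refine tendsto_average (G := fun _ => K) (a := fun _ => c) (s := c) E.pos E.lim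
      (fun n => by simpa using (E.pos n).le) (fun ε hε => ?_) (fun _ => hKi)
    obtain ⟨δ, hδ, hd⟩ := Metric.continuous_iff.1 hKc c ε hε
    exact ⟨δ, hδ, 0, fun n _ t ht => (hd t ht).le⟩
  have hfin : K a - K b ≤ 1 / 2 * ∫ t in a..b, e t := by
    refine le_of_tendsto' ((havg a).sub (havg b)) fun n => ?_
    rw [← sub_div, div_le_iff₀ (E.pos n)]
    have h1 := integral_sub_shift hKi a b (-h n)
    simp only [sub_neg_eq_add] at h1
    rw [intervalIntegral.integral_symm a (a + h n), intervalIntegral.integral_symm b (b + h n)] at h1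
    have hs : IntervalIntegrable (fun t => K (t + h n)) volume a b :=
      (hKc.comp (continuous_add_const (h n))).intervalIntegrable a b
    have h2 : ∫ t in a..b, (K t - K (t + h n)) ≤ ∫ t in a..b, 1 / 2 * h n * e t :=
      intervalIntegral.integral_mono_on hab.le ((hKi a b).sub hs) ((hei a b).const_mul _)
        fun t ht => hpt t (h n) ht.1 (E.pos n)
    rw [intervalIntegral.integral_const_mul] at h2
    have h3 : ∫ t in a..b, (K t - K (t + h n)) = -∫ t in a..b, (K (t + h n) - K t) := by
      rw [← intervalIntegral.integral_neg]
      simp only [neg_sub]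
    rw [h3, h1] at h2
    linarith
  simp only [hK, intervalIntegral.integral_same, mul_zero, add_zero] at hfin
  rw [hE]
  linarith

/-- The energy identity. -/
theorem EulerLimit.energy_eq (E : EulerLimit ν Λ m B h U u) (hJ : JumpSpace ν Λ m) (hm : 1 < m)
    (hB : 0 ≤ B) {a b : ℝ} (ha : 0 < a) (hab : a < b) :
    ∫ t in a..b, powEnergy Λ m (u t) = potential ν m (u a) - potential ν m (u b) :=
  le_antisymm (E.energy_le hJ hm hB ha hab) (E.le_energy hJ hm hB ha hab)

end EnergyEquality

section SummationByParts

variable {Ω : Type*} [MeasurableSpace Ω] {ν : Measure Ω} {Λ : Measure (Ω × Ω)} {m B : ℝ}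
  {h : ℕ → ℝ} {U : ℕ → ℕ → Ω → ℝ} {u : ℝ → Ω → ℝ}

/-- Space-time test functions `φ` with time derivative `φ'`, supported in `[a, b] × K`. -/
structure TimeTest (ν : Measure Ω) (Λ : Measure (Ω × Ω)) (m : ℝ) (φ φ' : ℝ → Ω → ℝ) (a b C : ℝ)
    (K : Set Ω) : Prop where
  pos : 0 < a
  measK : MeasurableSet K
  finK : ν K ≠ ⊤
  zero : ∀ t x, t ∉ Icc a b ∨ x ∉ K → φ t x = 0
  zero' : ∀ t x, t ∉ Icc a b ∨ x ∉ K → φ' t x = 0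
  meas : Measurable (Function.uncurry φ)
  meas' : Measurable (Function.uncurry φ')
  bdd : ∀ t x, |φ t x| ≤ C
  bdd' : ∀ t x, |φ' t x| ≤ C
  deriv : ∀ t x, HasDerivAt (fun τ => φ τ x) (φ' t x) t
  form : ∀ t, FormTest ν Λ m (φ t)
  energy : ∀ t, jumpForm Λ (φ t) (φ t) ≤ C

lemma integrable_of_bdd_of_support {α : Type*} [MeasurableSpace α] {μ : Measure α} {f : α → ℝ}
    {S : Set α} {C : ℝ} (hf : Measurable f) (hS : MeasurableSet S) (hμ : μ S ≠ ⊤)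
    (hC : ∀ x, |f x| ≤ C) (h0 : ∀ x, x ∉ S → f x = 0) : Integrable f μ := by
  have : Integrable (S.indicator fun _ => C) μ :=
    (integrable_indicator_iff hS).2 (integrableOn_const hμ)
  refine this.mono' hf.aestronglyMeasurable (Eventually.of_forall fun x => ?_)
  by_cases hx : x ∈ S
  · rw [indicator_of_mem hx]; exact hC x
  · rw [h0 x hx, indicator_of_notMem hx, norm_zero]

variable {φ φ' : ℝ → Ω → ℝ} {a b C : ℝ} {K : Set Ω}

lemma TimeTest.measure_ne_top [SFinite ν] (T : TimeTest ν Λ m φ φ' a b C K) (a' b' : ℝ) :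
    ((volume : Measure ℝ).prod ν) (Icc a' b' ×ˢ K) ≠ ⊤ := by
  rw [Measure.prod_prod]
  exact ENNReal.mul_ne_top (by simp) T.finK

lemma TimeTest.integrable_mul [SFinite ν] (T : TimeTest ν Λ m φ φ' a b C K) {D : ℝ}
    {F : ℝ × Ω → ℝ} (hF : Measurable F) (hD : ∀ p, |F p| ≤ D) :
    Integrable (fun p => F p * φ p.1 p.2) ((volume : Measure ℝ).prod ν) := by
  refine integrable_of_bdd_of_support (S := Icc a b ×ˢ K) (C := D * C) (hF.mul T.meas)
    (measurableSet_Icc.prod T.measK) (T.measure_ne_top a b) (fun p => ?_) fun p hp => ?_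
  · rw [abs_mul]
    exact mul_le_mul (hD p) (T.bdd _ _) (abs_nonneg _) ((abs_nonneg _).trans (hD p))
  · rw [T.zero, mul_zero]
    rw [mem_prod, not_and_or] at hp
    exact hp

lemma TimeTest.integrable_mul_deriv [SFinite ν] (T : TimeTest ν Λ m φ φ' a b C K) {D : ℝ}
    {F : ℝ × Ω → ℝ} (hF : Measurable F) (hD : ∀ p, |F p| ≤ D) :
    Integrable (fun p => F p * φ' p.1 p.2) ((volume : Measure ℝ).prod ν) := by
  refine integrable_of_bdd_of_support (S := Icc a b ×ˢ K) (C := D * C) (hF.mul T.meas')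
    (measurableSet_Icc.prod T.measK) (T.measure_ne_top a b) (fun p => ?_) fun p hp => ?_
  · rw [abs_mul]
    exact mul_le_mul (hD p) (T.bdd' _ _) (abs_nonneg _) ((abs_nonneg _).trans (hD p))
  · rw [T.zero', mul_zero]
    rw [mem_prod, not_and_or] at hp
    exact hp

lemma TimeTest.abs_sub_le (T : TimeTest ν Λ m φ φ' a b C K) (t δ : ℝ) (x : Ω) :
    |φ (t + δ) x - φ t x| ≤ C * |δ| := by
  have := Convex.norm_image_sub_le_of_norm_hasDerivWithin_le (s := univ) (f := fun τ => φ τ x)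
    (x := t) (y := t + δ) (fun τ _ => (T.deriv τ x).hasDerivWithinAt) (fun τ _ => T.bdd' τ x)
    convex_univ (mem_univ _) (mem_univ _)
  simpa using this

/-- Discrete integration by parts in time. -/
lemma TimeTest.integral_diff_quot [SFinite ν] (T : TimeTest ν Λ m φ φ' a b C K) {D : ℝ}
    {y : ℝ × Ω → ℝ} (hy : Measurable y) (hD : ∀ p, |y p| ≤ D) (δ : ℝ) :
    ∫ p, (y p - y (p.1 - δ, p.2)) / δ * φ p.1 p.2 ∂((volume : Measure ℝ).prod ν)
      = -∫ p, y p * ((φ (p.1 + δ) p.2 - φ p.1 p.2) / δ) ∂((volume : Measure ℝ).prod ν) := by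
  have hP : MeasurePreserving (fun p : ℝ × Ω => (p.1 + δ, p.2)) ((volume : Measure ℝ).prod ν)
      ((volume : Measure ℝ).prod ν) :=
    (measurePreserving_add_right volume δ).prod (MeasurePreserving.id ν)
  have hs : Measurable fun p : ℝ × Ω => (p.1 - δ, p.2) := by fun_prop
  have i1 := T.integrable_mul hy hD
  have i2 := T.integrable_mul (F := fun p => y (p.1 - δ, p.2)) (hy.comp hs) fun p => hD _
  have hi3 := hP.integrable_comp_of_integrable i2
  have e3 : (fun p : ℝ × Ω => y (p.1 - δ, p.2) * φ p.1 p.2) ∘ (fun p : ℝ × Ω => (p.1 + δ, p.2))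
      = fun p => y p * φ (p.1 + δ) p.2 := by
    ext p; simp
  rw [e3] at hi3
  have e2 : ∫ p, y (p.1 - δ, p.2) * φ p.1 p.2 ∂((volume : Measure ℝ).prod ν)
      = ∫ p, y p * φ (p.1 + δ) p.2 ∂((volume : Measure ℝ).prod ν) := by
    conv_lhs => rw [← hP.map_eq]
    rw [integral_map hP.measurable.aemeasurable (by rw [hP.map_eq]; exact i2.aestronglyMeasurable)]
    simp
  calc _ = ∫ p, (y p * φ p.1 p.2 - y (p.1 - δ, p.2) * φ p.1 p.2) / δ
        ∂((volume : Measure ℝ).prod ν) := by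
        congr 1; ext p; ring
    _ = -(∫ p, (y p * φ (p.1 + δ) p.2 - y p * φ p.1 p.2) / δ ∂((volume : Measure ℝ).prod ν)) := by
        rw [integral_div, integral_div, integral_sub i1 i2, integral_sub hi3 i1, e2]
        ring
    _ = _ := by congr 2; ext p; ring

lemma ae_prod_tendsto [SFinite ν] {y : ℕ → ℝ × Ω → ℝ} {y' : ℝ × Ω → ℝ}
    (hy : ∀ n, Measurable (y n)) (hy' : Measurable y')
    (hlim : ∀ t, ∀ᵐ x ∂ν, Tendsto (fun n => y n (t, x)) atTop (𝓝 (y' (t, x)))) :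
    ∀ᵐ p ∂((volume : Measure ℝ).prod ν), Tendsto (fun n => y n p) atTop (𝓝 (y' p)) :=
  (Measure.ae_prod_iff_ae_ae (measurableSet_tendsto_fun hy hy')).2 (Eventually.of_forall hlim)

lemma TimeTest.tendsto_diff_quot [SFinite ν] (T : TimeTest ν Λ m φ φ' a b C K) {D : ℝ}
    {y : ℕ → ℝ × Ω → ℝ} {y' : ℝ × Ω → ℝ} (hy : ∀ n, Measurable (y n)) (hy' : Measurable y')
    (hD : ∀ n p, |y n p| ≤ D)
    (hlim : ∀ t, ∀ᵐ x ∂ν, Tendsto (fun n => y n (t, x)) atTop (𝓝 (y' (t, x))))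
    (hpos : ∀ n, 0 < h n) (hh : Tendsto h atTop (𝓝 0)) :
    Tendsto (fun n => ∫ p, (y n p - y n (p.1 - h n, p.2)) / h n * φ p.1 p.2
      ∂((volume : Measure ℝ).prod ν)) atTop
      (𝓝 (-∫ p, y' p * φ' p.1 p.2 ∂((volume : Measure ℝ).prod ν))) := by
  simp only [T.integral_diff_quot (hy _) (hD _)]
  refine Tendsto.neg ?_
  refine tendsto_integral_filter_of_dominated_convergence
    ((Icc (a - 1) b ×ˢ K).indicator fun _ => D * C) ?_ ?_ ?_ ?_
  · refine Eventually.of_forall fun n => Measurable.aestronglyMeasurable ?_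
    have hs : Measurable fun p : ℝ × Ω => (p.1 + h n, p.2) := by fun_prop
    exact (hy n).mul (((T.meas.comp hs).sub T.meas).div_const _)
  · filter_upwards [hh.eventually_lt_const zero_lt_one] with n hn
    refine Eventually.of_forall fun p => ?_
    have hp := hpos n
    by_cases hS : p ∈ Icc (a - 1) b ×ˢ K
    · rw [indicator_of_mem hS, Real.norm_eq_abs, abs_mul, abs_div]
      have h1 := T.abs_sub_le p.1 (h n) p.2
      refine mul_le_mul (hD n p) ?_ (by positivity) ((abs_nonneg _).trans (hD n p))
      rwa [div_le_iff₀ (by positivity)]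
    · rw [indicator_of_notMem hS]
      rw [mem_prod, not_and_or] at hS
      have z1 : φ p.1 p.2 = 0 := T.zero _ _ (hS.imp_left fun hS hc => hS ⟨by linarith [hc.1], hc.2⟩)
      have z2 : φ (p.1 + h n) p.2 = 0 :=
        T.zero _ _ (hS.imp_left fun hS hc => hS ⟨by linarith [hc.1], by linarith [hc.2]⟩)
      simp [z1, z2]
  · exact (integrable_indicator_iff (measurableSet_Icc.prod T.measK)).2
      (integrableOn_const (T.measure_ne_top _ _))
  · filter_upwards [ae_prod_tendsto hy hy' hlim] with p hp
    refine hp.mul ?_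
    have h1 := (T.deriv p.1 p.2).tendsto_slope_zero_right.comp
      (tendsto_nhdsWithin_iff.2 ⟨hh, Eventually.of_forall hpos⟩)
    refine h1.congr fun n => ?_
    simp only [Function.comp, smul_eq_mul]
    ring

end SummationByParts

section WeakFormulation

variable {Ω : Type*} [MeasurableSpace Ω] {ν : Measure Ω} {Λ : Measure (Ω × Ω)} {m B : ℝ}
  {h : ℕ → ℝ} {U : ℕ → ℕ → Ω → ℝ} {u : ℝ → Ω → ℝ} {φ φ' : ℝ → Ω → ℝ} {a b C : ℝ} {K : Set Ω}

lemma EulerLimit.measurable_grid (E : EulerLimit ν Λ m B h U u) (n : ℕ) :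
    Measurable (fun p : ℝ × Ω => U n (grid (h n) p.1) p.2) :=
  (measurable_from_prod_countable_left (f := fun q : Ω × ℕ => U n q.2 q.1)
    (fun k => ((E.scheme n).datum k).meas)).comp
    (measurable_snd.prodMk ((_root_.measurable_grid _).comp measurable_fst))

lemma EulerLimit.measurable_swap (E : EulerLimit ν Λ m B h U u) :
    Measurable (fun p : ℝ × Ω => u p.1 p.2) :=
  E.meas.comp (measurable_snd.prodMk measurable_fst)

lemma jumpForm_zero_right (v : Ω → ℝ) {ψ : Ω → ℝ} (hψ : ∀ x, ψ x = 0) : jumpForm Λ v ψ = 0 := by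
  simp [jumpForm, incr, hψ]

lemma TimeTest.eq_zero (T : TimeTest ν Λ m φ φ' a b C K) {t : ℝ} (ht : t ∉ Icc a b) (x : Ω) :
    φ t x = 0 := T.zero t x (Or.inl ht)

lemma EulerLimit.integral_step (E : EulerLimit ν Λ m B h U u)
    (T : TimeTest ν Λ m φ φ' a b C K) (n : ℕ) (t : ℝ) :
    ∫ x, (U n (grid (h n) t) x - U n (grid (h n) (t - h n)) x) / h n * φ t x ∂ν
      = -jumpForm Λ (fun x => U n (grid (h n) t) x ^ m) (φ t) := by
  by_cases ht : t ∈ Icc a b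
  · have h1 := (E.step n (T.pos.trans_le ht.1)).eqn_mul (E.pos n) (T.form t)
    have hn := (E.pos n).ne'
    rw [← mul_right_inj' (neg_ne_zero.2 hn), neg_mul_neg, ← h1, ← integral_const_mul]
    congr 1; ext x; field_simp; ring
  · rw [jumpForm_zero_right _ (T.eq_zero ht)]
    simp [T.eq_zero ht]

variable [SFinite ν]

/-- The weak formulation of the evolution equation. -/
theorem EulerLimit.weakForm (E : EulerLimit ν Λ m B h U u) (hJ : JumpSpace ν Λ m) (hm : 1 < m)
    (T : TimeTest ν Λ m φ φ' a b C K) :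
    ∫ t, ∫ x, u t x * φ' t x ∂ν = ∫ t, jumpForm Λ (fun x => u t x ^ m) (φ t) := by
  have hDu : ∀ t x, |u t x| ≤ B := fun t x =>
    abs_le.2 ⟨by linarith [(E.datum t).nonneg x, (E.datum t).le x], (E.datum t).le x⟩
  have hDU : ∀ n k x, |U n k x| ≤ B := fun n k x => abs_le.2
    ⟨by linarith [((E.scheme n).datum k).nonneg x, ((E.scheme n).datum k).le x],
      ((E.scheme n).datum k).le x⟩
  have hΦ := potential_nonneg hm (ν := ν) ((E.scheme 0).datum 0).nonneg
  have lim1 := T.tendsto_diff_quot (y := fun n p => U n (grid (h n) p.1) p.2)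
    (y' := fun p => u p.1 p.2) E.measurable_grid E.measurable_swap (fun n p => hDU _ _ _)
    (fun t => E.ae_lim t) E.pos E.lim
  have hqm : ∀ n, Measurable fun p : ℝ × Ω =>
      (U n (grid (h n) p.1) p.2 - U n (grid (h n) (p.1 - h n)) p.2) / h n := fun n => by
    have hs : Measurable fun p : ℝ × Ω => (p.1 - h n, p.2) := by fun_prop
    exact ((E.measurable_grid n).sub ((E.measurable_grid n).comp hs)).div_const _
  have hqi : ∀ n, Integrable (fun p : ℝ × Ω =>
      (U n (grid (h n) p.1) p.2 - U n (grid (h n) (p.1 - h n)) p.2) / h n * φ p.1 p.2)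
      ((volume : Measure ℝ).prod ν) := fun n => by
    refine T.integrable_mul (D := (B + B) / h n) (hqm n) fun p => ?_
    have := E.pos n
    rw [abs_div, abs_of_pos this]
    gcongr
    exact (abs_sub _ _).trans (add_le_add (hDU _ _ _) (hDU _ _ _))
  have e1 : ∀ n, ∫ p : ℝ × Ω, (U n (grid (h n) p.1) p.2 - U n (grid (h n) (p.1 - h n)) p.2) / h n
      * φ p.1 p.2 ∂((volume : Measure ℝ).prod ν)
      = ∫ t, -jumpForm Λ (fun x => U n (grid (h n) t) x ^ m) (φ t) := fun n => by
    rw [integral_prod _ (hqi n)]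
    simp only [E.integral_step T]
  simp only [e1] at lim1
  have lim2 : Tendsto (fun n => ∫ t, -jumpForm Λ (fun x => U n (grid (h n) t) x ^ m) (φ t)) atTop
      (𝓝 (∫ t, -jumpForm Λ (fun x => u t x ^ m) (φ t))) := by
    refine tendsto_integral_of_dominated_convergence
      ((Icc a b).indicator fun _ => 1 / 2 * (potential ν m (U 0 0) / a) + 1 / 2 * C) ?_ ?_ ?_ ?_
    · intro n
      have := ((hqm n).mul T.meas).stronglyMeasurable.integral_prod_right' (ν := ν)
      refine (this.aestronglyMeasurable).congr (Eventually.of_forall fun t => ?_)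
      exact E.integral_step T n t
    · exact (integrable_indicator_iff measurableSet_Icc).2 (integrableOn_const (by simp))
    · refine fun n => Eventually.of_forall fun t => ?_
      by_cases ht : t ∈ Icc a b
      · rw [indicator_of_mem ht, norm_neg, Real.norm_eq_abs]
        have ht0 := T.pos.trans_le ht.1
        refine (abs_jumpForm_le (E.formTest_step hm n ht0) (T.form t)).trans ?_
        have k1 := E.powEnergy_step_le hm n ht0
        rw [powEnergy] at k1
        have k3 : potential ν m (U 0 0) / t ≤ potential ν m (U 0 0) / a :=
          div_le_div_of_nonneg_left hΦ T.pos ht.1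
        linarith [T.energy t]
      · rw [indicator_of_notMem ht, jumpForm_zero_right _ (T.eq_zero ht), neg_zero, norm_zero]
    · refine Eventually.of_forall fun t => ?_
      by_cases ht : t ∈ Icc a b
      · exact (E.tendsto_jumpForm hJ hm (T.pos.trans_le ht.1) (T.form t)).neg
      · simp only [jumpForm_zero_right _ (T.eq_zero ht)]
        exact tendsto_const_nhds
  have := tendsto_nhds_unique lim1 lim2
  rw [integral_neg, neg_inj, integral_prod _ (T.integrable_mul_deriv E.measurable_swap
    fun p => hDu _ _)] at this
  exact this

end WeakFormulation

section WeakLimits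

variable {α : Type*} [MeasurableSpace α] {μ : Measure α}

lemma memLp_two_of_sq {f : α → ℝ} (hf : Measurable f) (hf2 : Integrable (fun x => f x ^ 2) μ) :
    MemLp f 2 μ := (memLp_two_iff_integrable_sq hf.aestronglyMeasurable).2 hf2

lemma inner_toLp_eq {f g : α → ℝ} (hf : MemLp f 2 μ) (hg : MemLp g 2 μ) :
    inner ℝ (hf.toLp f) (hg.toLp g) = ∫ x, f x * g x ∂μ := by
  rw [L2.inner_def]
  refine integral_congr_ae ?_
  filter_upwards [hf.coeFn_toLp, hg.coeFn_toLp] with x h1 h2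
  rw [h1, h2]
  simp [mul_comm]

/-- Bounded sequences of square integrable functions have weak limits along an ultrafilter. -/
lemma exists_weak_limit {w : ℕ → α → ℝ} {M : ℝ} (hw : ∀ n, Measurable (w n))
    (hw2 : ∀ n, Integrable (fun x => w n x ^ 2) μ) (hM : ∀ n, ∫ x, w n x ^ 2 ∂μ ≤ M) :
    ∃ 𝒰 : Ultrafilter ℕ, (𝒰 : Filter ℕ) ≤ atTop ∧ ∃ w' : α → ℝ, Measurable w' ∧
      Integrable (fun x => w' x ^ 2) μ ∧ ∀ g : α → ℝ, Measurable g →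
        Integrable (fun x => g x ^ 2) μ →
        Tendsto (fun n => ∫ x, w n x * g x ∂μ) 𝒰 (𝓝 (∫ x, w' x * g x ∂μ)) := by
  have hL := fun n => memLp_two_of_sq (hw n) (hw2 n)
  set X : ℕ → Lp ℝ 2 μ := fun n => (hL n).toLp (w n) with hX
  have hXn : ∀ n, ‖X n‖ ≤ √M := fun n => by
    refine Real.le_sqrt_of_sq_le ?_
    rw [← real_inner_self_eq_norm_sq, hX]
    simp only
    rw [inner_toLp_eq]
    simpa only [sq] using hM n
  set F : ℕ → WeakDual ℝ (Lp ℝ 2 μ) := fun n => StrongDual.toWeakDual (innerSL ℝ (X n)) with hF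
  obtain ⟨f, -, hf⟩ := (WeakDual.isCompact_closedBall (𝕜 := ℝ) (E := Lp ℝ 2 μ) 0
    (√M)).exists_mapClusterPt (u := F) (f := atTop) (by
      refine tendsto_principal.2 (Eventually.of_forall fun n => ?_)
      rw [mem_preimage, mem_closedBall_zero_iff]
      simpa [hF] using hXn n)
  obtain ⟨𝒰, h𝒰, hlim⟩ := mapClusterPt_iff_ultrafilter.1 hf
  set x : Lp ℝ 2 μ := (InnerProductSpace.toDual ℝ (Lp ℝ 2 μ)).symm (WeakDual.toStrongDual f) with hx
  have hxm : MemLp (x : α → ℝ) 2 μ := Lp.memLp x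
  have hae : x =ᵐ[μ] hxm.1.mk x := hxm.1.ae_eq_mk
  have hm : Measurable (hxm.1.mk x) := hxm.1.stronglyMeasurable_mk.measurable
  have hm2 : MemLp (hxm.1.mk x) 2 μ := (memLp_congr_ae hae).1 hxm
  refine ⟨𝒰, h𝒰, hxm.1.mk x, hm, hm2.integrable_sq, fun g hg hg2 => ?_⟩
  have hgL := memLp_two_of_sq hg hg2
  have h1 := ((WeakDual.eval_continuous (𝕜 := ℝ) (hgL.toLp g)).tendsto f).comp hlim
  have e1 : ∀ n, (F n) (hgL.toLp g) = ∫ y, w n y * g y ∂μ := fun n => inner_toLp_eq (hL n) hgL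
  have e2 : f (hgL.toLp g) = ∫ y, hxm.1.mk x y * g y ∂μ := by
    rw [← inner_toLp_eq hm2 hgL]
    have : hm2.toLp _ = x := by
      refine Lp.ext ?_
      exact hm2.coeFn_toLp.trans hae.symm
    rw [this, hx, InnerProductSpace.toDual_symm_apply]
    rfl
  rw [e2] at h1
  exact h1.congr e1

lemma weak_limit_sq_le {w : ℕ → α → ℝ} {w' β : α → ℝ} {l : Filter ℕ} [l.NeBot] {D b : ℝ}
    {bn : ℕ → ℝ} (hw : ∀ n, Measurable (w n)) (hw2 : ∀ n, Integrable (fun x => w n x ^ 2) μ)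
    (hw' : Measurable w') (hw'2 : Integrable (fun x => w' x ^ 2) μ) (hβ : Measurable β)
    (hβ0 : ∀ x, 0 ≤ β x) (hβD : ∀ x, β x ≤ D)
    (hlim : ∀ g : α → ℝ, Measurable g → Integrable (fun x => g x ^ 2) μ →
      Tendsto (fun n => ∫ x, w n x * g x ∂μ) l (𝓝 (∫ x, w' x * g x ∂μ)))
    (hb : Tendsto bn l (𝓝 b)) (hle : ∀ᶠ n in l, ∫ x, β x * w n x ^ 2 ∂μ ≤ bn n) :
    ∫ x, β x * w' x ^ 2 ∂μ ≤ b := by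
  have hβa : ∀ x, |β x| ≤ D := fun x => by rw [abs_of_nonneg (hβ0 x)]; exact hβD x
  have iβ : ∀ f : α → ℝ, Integrable (fun x => f x ^ 2) μ → Integrable (fun x => β x * f x ^ 2) μ :=
    fun f hf => by
      refine (integrable_mul_bdd hf hβ hβa).congr (Eventually.of_forall fun x => ?_)
      simp only [mul_comm]
  have hg2 : Integrable (fun x => (β x * w' x) ^ 2) μ := by
    refine (integrable_mul_bdd (iβ w' hw'2) hβ hβa).congr (Eventually.of_forall fun x => ?_)
    simp only; ring
  have h1 := hlim (fun x => β x * w' x) (hβ.mul hw') hg2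
  have e : ∫ x, w' x * (β x * w' x) ∂μ = ∫ x, β x * w' x ^ 2 ∂μ := by congr 1; ext x; ring
  rw [e] at h1
  have h2 := le_of_tendsto_of_tendsto (h1.const_mul 2)
    (hb.add_const (∫ x, β x * w' x ^ 2 ∂μ)) (by
      filter_upwards [hle] with n hn
      refine le_trans ?_ (add_le_add_left hn _)
      have ic : Integrable (fun x => w n x * (β x * w' x)) μ :=
        integrable_mul_of_sq (hw n) (hβ.mul hw') (hw2 n) hg2
      rw [← integral_add (iβ _ (hw2 n)) (iβ _ hw'2), ← integral_const_mul]
      refine integral_mono (ic.const_mul 2) ((iβ _ (hw2 n)).add (iβ _ hw'2)) fun x => ?_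
      simp only
      nlinarith [mul_nonneg (hβ0 x) (sq_nonneg (w n x - w' x))])
  linarith

end WeakLimits

section LocalWeakLimits

variable {α : Type*} [MeasurableSpace α] {μ : Measure α}

/-- A positive weight making all functions with prescribed local bounds globally integrable. -/
lemma exists_weight {A : ℕ → Set α} (hA : ∀ k, MeasurableSet (A k)) (M : ℕ → ℝ) :
    ∃ θ : α → ℝ, Measurable θ ∧ (∀ x, 0 ≤ θ x) ∧
      (∀ k, ∃ δ : ℝ, 0 < δ ∧ ∀ x ∈ A k, δ ≤ θ x ^ 2) ∧
      ∀ f : α → ℝ, Measurable f →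
        (∀ k, ∫⁻ x in A k, ENNReal.ofReal (f x ^ 2) ∂μ ≤ ENNReal.ofReal (M k)) →
        ∫⁻ x, ENNReal.ofReal ((θ x * f x) ^ 2) ∂μ ≤ 1 := by
  obtain ⟨δ, hδ, hsum⟩ := ENNReal.exists_pos_tsum_mul_lt_of_countable one_ne_zero
    (fun k => ENNReal.ofReal (M k) + 1) (fun k => by simp)
  set Θ : α → ℝ≥0∞ := fun x => ∑' k, (A k).indicator (fun _ => (δ k : ℝ≥0∞)) x with hΘ
  have hΘm : Measurable Θ := Measurable.tsum fun k => measurable_const.indicator (hA k)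
  have hΘ1 : ∀ x, Θ x ≤ 1 := fun x => by
    refine (ENNReal.tsum_le_tsum fun k => ?_).trans hsum.le
    refine (indicator_le_self' (fun _ _ => zero_le) x).trans ?_
    calc (δ k : ℝ≥0∞) = 1 * δ k := (one_mul _).symm
      _ ≤ _ := by gcongr; exact le_add_self
  have hΘt : ∀ x, Θ x ≠ ⊤ := fun x => ne_top_of_le_ne_top ENNReal.one_ne_top (hΘ1 x)
  refine ⟨fun x => √(Θ x).toReal, hΘm.ennreal_toReal.sqrt, fun x => Real.sqrt_nonneg _,
    fun k => ⟨δ k, NNReal.coe_pos.2 (hδ k), fun x hx => ?_⟩, fun f hf hM => ?_⟩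
  · rw [Real.sq_sqrt ENNReal.toReal_nonneg]
    have h1 : (A k).indicator (fun _ => (δ k : ℝ≥0∞)) x ≤ Θ x :=
      ENNReal.le_tsum (f := fun k => (A k).indicator (fun _ => (δ k : ℝ≥0∞)) x) k
    rw [indicator_of_mem hx] at h1
    exact ENNReal.toReal_mono (hΘt x) h1
  · have hfm : Measurable fun x => ENNReal.ofReal (f x ^ 2) := (hf.pow_const 2).ennreal_ofReal
    calc ∫⁻ x, ENNReal.ofReal ((√(Θ x).toReal * f x) ^ 2) ∂μ
        = ∫⁻ x, ∑' k, (A k).indicator (fun x => δ k * ENNReal.ofReal (f x ^ 2)) x ∂μ := by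
          refine lintegral_congr fun x => ?_
          rw [mul_pow, Real.sq_sqrt ENNReal.toReal_nonneg,
            ENNReal.ofReal_mul ENNReal.toReal_nonneg, ENNReal.ofReal_toReal (hΘt x), hΘ,
            ← ENNReal.tsum_mul_right]
          congr 1; ext k
          by_cases hx : x ∈ A k
          · simp [indicator_of_mem hx]
          · simp [indicator_of_notMem hx]
      _ = ∑' k, δ k * ∫⁻ x in A k, ENNReal.ofReal (f x ^ 2) ∂μ := by
          rw [lintegral_tsum fun k => ((hfm.const_mul _).indicator (hA k)).aemeasurable]
          congr 1; ext k
          rw [lintegral_indicator (hA k), lintegral_const_mul _ hfm]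
      _ ≤ ∑' k, (ENNReal.ofReal (M k) + 1) * δ k := by
          refine ENNReal.tsum_le_tsum fun k => ?_
          rw [mul_comm]
          gcongr
          exact (hM k).trans le_self_add
      _ ≤ 1 := hsum.le

/-- Sequences which are locally bounded in `L²` have local weak limits. -/
lemma exists_local_weak_limit {w : ℕ → α → ℝ} {A : ℕ → Set α} {M : ℕ → ℝ}
    (hw : ∀ n, Measurable (w n)) (hA : ∀ k, MeasurableSet (A k))
    (hM : ∀ k n, ∫⁻ x in A k, ENNReal.ofReal (w n x ^ 2) ∂μ ≤ ENNReal.ofReal (M k)) :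
    ∃ w' : α → ℝ, Measurable w' ∧
      (∀ (g : α → ℝ) (k : ℕ) (l : ℝ), Measurable g → Integrable (fun x => g x ^ 2) μ →
        (∀ x, x ∉ A k → g x = 0) → Tendsto (fun n => ∫ x, w n x * g x ∂μ) atTop (𝓝 l) →
        Integrable (fun x => w' x * g x) μ ∧ ∫ x, w' x * g x ∂μ = l) ∧
      (∀ (S : Set α) (k : ℕ) (b : ℝ) (bn : ℕ → ℝ), MeasurableSet S → S ⊆ A k →
        Tendsto bn atTop (𝓝 b) → (∀ᶠ n in atTop, ∫ x in S, w n x ^ 2 ∂μ ≤ bn n) →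
        IntegrableOn (fun x => w' x ^ 2) S μ ∧ ∫ x in S, w' x ^ 2 ∂μ ≤ b) := by
  obtain ⟨θ, hθm, hθ0, hθδ, hθM⟩ := exists_weight (μ := μ) hA M
  have hvm : ∀ n, Measurable fun x => θ x * w n x := fun n => hθm.mul (hw n)
  have hvl := fun n => hθM (w n) (hw n) fun k => hM k n
  have hv2 : ∀ n, Integrable (fun x => (θ x * w n x) ^ 2) μ := fun n =>
    integrable_of_lintegral_ofReal_ne_top ((hvm n).pow_const 2) (fun _ => sq_nonneg _)
      (ne_top_of_le_ne_top ENNReal.one_ne_top (hvl n))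
  have hv1 : ∀ n, ∫ x, (θ x * w n x) ^ 2 ∂μ ≤ 1 := fun n => by
    have := hvl n
    rw [lintegral_ofReal_eq (hv2 n) fun _ => sq_nonneg _] at this
    simpa using this
  obtain ⟨𝒰, h𝒰, v, hv, hvi, hlim⟩ := exists_weak_limit hvm hv2 hv1
  have hθne : ∀ k, ∀ x ∈ A k, θ x ≠ 0 := fun k x hx h0 => by
    obtain ⟨δ, hδ, hd⟩ := hθδ k
    have := hd x hx
    rw [h0] at this
    linarith
  refine ⟨fun x => v x / θ x, hv.div hθm, fun g k l hg hg2 hg0 hl => ?_,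
    fun S k b bn hS hSA hb hle => ?_⟩
  · obtain ⟨δ, hδ, hd⟩ := hθδ k
    have hgm : Measurable fun x => g x / θ x := hg.div hθm
    have hgi : Integrable (fun x => (g x / θ x) ^ 2) μ := by
      refine (hg2.div_const δ).mono' (hgm.pow_const 2).aestronglyMeasurable
        (Eventually.of_forall fun x => ?_)
      rw [Real.norm_of_nonneg (sq_nonneg _), div_pow]
      by_cases hx : x ∈ A k
      · exact div_le_div_of_nonneg_left (sq_nonneg _) hδ (hd x hx)
      · simp [hg0 x hx]
    have e1 : ∀ n x, θ x * w n x * (g x / θ x) = w n x * g x := fun n x => by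
      by_cases hx : x ∈ A k
      · have := hθne k x hx
        field_simp
      · simp [hg0 x hx]
    have e2 : ∀ x, v x * (g x / θ x) = v x / θ x * g x := fun x => by ring
    have h1 := hlim _ hgm hgi
    simp only [e1, e2] at h1
    have h2 := integrable_mul_of_sq hv hgm hvi hgi
    simp only [e2] at h2
    exact ⟨h2, tendsto_nhds_unique h1 (hl.mono_left h𝒰)⟩
  · obtain ⟨δ, hδ, hd⟩ := hθδ k
    set β : α → ℝ := S.indicator fun x => 1 / θ x ^ 2 with hβ
    have hβm : Measurable β := (measurable_const.div (hθm.pow_const 2)).indicator hS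
    have hβ0 : ∀ x, 0 ≤ β x := fun x => indicator_nonneg (fun x _ => by positivity) x
    have hβD : ∀ x, β x ≤ 1 / δ := fun x => by
      by_cases hx : x ∈ S
      · rw [hβ, indicator_of_mem hx]
        exact div_le_div_of_nonneg_left zero_le_one hδ (hd x (hSA hx))
      · rw [hβ, indicator_of_notMem hx]; positivity
    have e1 : ∀ n x, β x * (θ x * w n x) ^ 2 = S.indicator (fun x => w n x ^ 2) x := fun n x => by
      by_cases hx : x ∈ S
      · have := hθne k x (hSA hx)
        rw [hβ, indicator_of_mem hx, indicator_of_mem hx]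
        field_simp
      · rw [hβ, indicator_of_notMem hx, indicator_of_notMem hx, zero_mul]
    have e2 : ∀ x, β x * v x ^ 2 = S.indicator (fun x => (v x / θ x) ^ 2) x := fun x => by
      by_cases hx : x ∈ S
      · rw [hβ, indicator_of_mem hx, indicator_of_mem hx]
        ring
      · rw [hβ, indicator_of_notMem hx, indicator_of_notMem hx, zero_mul]
    have h1 := weak_limit_sq_le hvm hv2 hv hvi hβm hβ0 hβD hlim (hb.mono_left h𝒰) (by
      refine (hle.filter_mono h𝒰).mono fun n hn => ?_
      simp only [e1]
      rwa [integral_indicator hS])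
    simp only [e2] at h1
    rw [integral_indicator hS] at h1
    have h2 : Integrable (fun x => β x * v x ^ 2) μ :=
      (integrable_mul_bdd hvi hβm fun x => by rw [abs_of_nonneg (hβ0 x)]; exact hβD x).congr
        (Eventually.of_forall fun x => by simp only [mul_comm])
    simp only [e2] at h2
    exact ⟨(integrable_indicator_iff hS).1 h2, h1⟩

end LocalWeakLimits

section TimeDerivative

variable {Ω : Type*} [MeasurableSpace Ω] {ν : Measure Ω} {Λ : Measure (Ω × Ω)} {m B : ℝ}
  {h : ℕ → ℝ} {U : ℕ → ℕ → Ω → ℝ} {u : ℝ → Ω → ℝ} {φ φ' : ℝ → Ω → ℝ} {a b C : ℝ} {K : Set Ω}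

lemma EulerLimit.bound_nonneg (E : EulerLimit ν Λ m B h U u) (x : Ω) : 0 ≤ B :=
  ((E.datum 0).nonneg x).trans ((E.datum 0).le x)

/-- Backward difference quotients of `u ^ ((m + 1) / 2)` for the step functions. -/
def diffQuot (m : ℝ) (h : ℕ → ℝ) (U : ℕ → ℕ → Ω → ℝ) (n : ℕ) (p : ℝ × Ω) : ℝ :=
  (U n (grid (h n) p.1) p.2 ^ ((m + 1) / 2)
    - U n (grid (h n) (p.1 - h n)) p.2 ^ ((m + 1) / 2)) / h n

lemma EulerLimit.measurable_diffQuot (E : EulerLimit ν Λ m B h U u) (n : ℕ) :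
    Measurable (diffQuot m h U n) := by
  have hs : Measurable fun p : ℝ × Ω => (p.1 - h n, p.2) := by fun_prop
  exact (((E.measurable_grid n).pow_const _).sub
    (((E.measurable_grid n).comp hs).pow_const _)).div_const _

lemma Datum.integrable_sq_sub (hm : 1 < m) {f g : Ω → ℝ} (hf : Datum ν B f) (hg : Datum ν B g) :
    Integrable (fun x => (f x ^ ((m + 1) / 2) - g x ^ ((m + 1) / 2)) ^ 2) ν := by
  refine ((hf.int_rpow (r := m + 1) (by linarith)).add
    (hg.int_rpow (r := m + 1) (by linarith))).mono'
    (((hf.meas.pow_const _).sub (hg.meas.pow_const _)).pow_const 2).aestronglyMeasurable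
    (Eventually.of_forall fun x => ?_)
  have e : ∀ r : ℝ, 0 ≤ r → (r ^ ((m + 1) / 2)) ^ 2 = r ^ (m + 1) := fun r hr => by
    rw [← Real.rpow_natCast, ← Real.rpow_mul hr]; norm_num
  rw [Real.norm_of_nonneg (sq_nonneg _), Pi.add_apply, ← e _ (hf.nonneg x), ← e _ (hg.nonneg x)]
  nlinarith [mul_nonneg (Real.rpow_nonneg (hf.nonneg x) ((m + 1) / 2))
    (Real.rpow_nonneg (hg.nonneg x) ((m + 1) / 2))]

lemma EulerLimit.lintegral_diffQuot_le (E : EulerLimit ν Λ m B h U u) (hm : 1 < m) (n : ℕ) {t : ℝ}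
    (ht : h n < t) :
    ∫⁻ x, ENNReal.ofReal (diffQuot m h U n (t, x) ^ 2) ∂ν
      ≤ ENNReal.ofReal ((m + 1) / 4 / h n * (powEnergy Λ m (U n (grid (h n) (t - h n)))
        - powEnergy Λ m (U n (grid (h n) t)))) := by
  have hn := E.pos n
  have h1 := (E.step n (sub_pos.2 ht)).energy_decay hm hn (E.step n (hn.trans ht))
  have hi := ((E.scheme n).datum (grid (h n) t)).integrable_sq_sub hm
    ((E.scheme n).datum (grid (h n) (t - h n)))
  simp only [diffQuot, div_pow]
  rw [lintegral_ofReal_eq (hi.div_const _) (fun x => by positivity), integral_div]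
  refine ENNReal.ofReal_le_ofReal ?_
  rw [div_le_iff₀ (by positivity)]
  refine h1.trans_eq ?_
  field_simp

variable [SFinite ν]

lemma EulerLimit.lintegral_window_le (E : EulerLimit ν Λ m B h U u) (hm : 1 < m) (n : ℕ)
    {s t₁ : ℝ} (t₂ : ℝ) (hs : 0 ≤ s) (ht₁ : s + 2 * h n < t₁) :
    ∫⁻ p in Ioc t₁ t₂ ×ˢ univ, ENNReal.ofReal (diffQuot m h U n p ^ 2)
        ∂((volume : Measure ℝ).prod ν)
      ≤ ENNReal.ofReal ((m + 1) / 4 * (potential ν m (U n (grid (h n) s)) / (t₁ - s - 2 * h n))) := by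
  rcases le_or_gt t₂ t₁ with h12 | h12
  · simp [Ioc_eq_empty_of_le h12]
  have hn := E.pos n
  have hΦ := potential_nonneg hm (ν := ν) ((E.scheme n).datum (grid (h n) s)).nonneg
  set e : ℝ → ℝ := fun t => powEnergy Λ m (U n (grid (h n) t)) with he
  have hei : ∀ a b, IntervalIntegrable e volume a b :=
    fun a b => intervalIntegrable_grid (fun k => powEnergy Λ m (U n k)) (h n) hn a b
  have hes : IntervalIntegrable (fun t => e (t - h n)) volume t₁ t₂ := by
    simpa using (hei (t₁ - h n) (t₂ - h n)).comp_sub_right (h n)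
  have hdec : ∀ t, h n < t → e t ≤ e (t - h n) := fun t ht =>
    (E.step n (sub_pos.2 ht)).powEnergy_le hm hn (E.step n (hn.trans ht))
  have hmeas : Measurable fun p => ENNReal.ofReal (diffQuot m h U n p ^ 2) :=
    ((E.measurable_diffQuot n).pow_const 2).ennreal_ofReal
  have hint : ∫ t in t₁..t₂, (m + 1) / 4 / h n * (e (t - h n) - e t)
      ≤ (m + 1) / 4 * (potential ν m (U n (grid (h n) s)) / (t₁ - s - 2 * h n)) := by
    rw [intervalIntegral.integral_const_mul, integral_sub_shift hei]
    have h1 : ∫ t in t₁ - h n..t₁, e t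
        ≤ ∫ t in t₁ - h n..t₁, potential ν m (U n (grid (h n) s)) / (t₁ - s - 2 * h n) := by
      refine intervalIntegral.integral_mono_on (by linarith) (hei _ _) intervalIntegrable_const
        fun t ht => ?_
      rw [le_div_iff₀ (by linarith)]
      have h2 := (E.scheme n).powEnergy_grid_le hm hn (t := t) hs
      have h3 : 0 ≤ e t := powEnergy_nonneg _
      refine le_trans ?_ h2
      rw [mul_comm]
      exact mul_le_mul_of_nonneg_right (by linarith [ht.1]) h3
    have h2 : 0 ≤ ∫ t in t₂ - h n..t₂, e t :=
      intervalIntegral.integral_nonneg (by linarith) fun t _ => powEnergy_nonneg _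
    rw [intervalIntegral.integral_const, sub_sub_cancel, smul_eq_mul] at h1
    calc _ ≤ (m + 1) / 4 / h n
          * (h n * (potential ν m (U n (grid (h n) s)) / (t₁ - s - 2 * h n))) := by
          gcongr; linarith
      _ = _ := by field_simp
  have hprod : ((volume : Measure ℝ).prod ν).restrict (Ioc t₁ t₂ ×ˢ univ)
      = ((volume : Measure ℝ).restrict (Ioc t₁ t₂)).prod ν := by
    rw [← Measure.prod_restrict, Measure.restrict_univ]
  rw [hprod, lintegral_prod _ hmeas.aemeasurable]
  refine le_trans (setLIntegral_mono_ae' measurableSet_Ioc (Eventually.of_forall fun t ht =>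
    E.lintegral_diffQuot_le hm n (by linarith [ht.1]))) ?_
  have hfi : IntegrableOn (fun t => (m + 1) / 4 / h n * (e (t - h n) - e t)) (Ioc t₁ t₂) :=
    (intervalIntegrable_iff_integrableOn_Ioc_of_le h12.le).1 ((hes.sub (hei _ _)).const_mul _)
  rw [← ofReal_integral_eq_lintegral_ofReal hfi, ← intervalIntegral.integral_of_le h12.le]
  · exact ENNReal.ofReal_le_ofReal hint
  · filter_upwards [ae_restrict_mem measurableSet_Ioc] with t ht
    exact mul_nonneg (by positivity) (sub_nonneg.2 (hdec t (by linarith [ht.1])))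

lemma EulerLimit.tendsto_potential (E : EulerLimit ν Λ m B h U u) (hm : 1 < m) (hB : 0 ≤ B)
    (t : ℝ) : Tendsto (fun n => potential ν m (U n (grid (h n) t))) atTop
      (𝓝 (potential ν m (u t))) := by
  rw [Metric.tendsto_atTop]
  intro ε hε
  obtain ⟨δ, hδ, N, hN⟩ := E.modulus_of_dist1 (Real.rpow_nonneg hB m) (abs_potential_sub_le hm) t
    (ε / 2) (by positivity)
  exact ⟨N, fun n hn => (hN n hn t (by simpa using hδ)).trans_lt (by linarith)⟩

/-- The function `u ^ ((m + 1) / 2)` has a weak time derivative in `L²`, locally in time. -/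
theorem EulerLimit.exists_time_deriv (E : EulerLimit ν Λ m B h U u) (hm : 1 < m) (hB : 0 ≤ B) :
    ∃ w : ℝ × Ω → ℝ, Measurable w ∧
      (∀ φ φ' a b C K, TimeTest ν Λ m φ φ' a b C K →
        Integrable (fun p => w p * φ p.1 p.2) ((volume : Measure ℝ).prod ν) ∧
        ∫ p, w p * φ p.1 p.2 ∂((volume : Measure ℝ).prod ν)
          = -∫ p, u p.1 p.2 ^ ((m + 1) / 2) * φ' p.1 p.2 ∂((volume : Measure ℝ).prod ν)) ∧
      ∀ t₁ t₂, 0 < t₁ → t₁ < t₂ →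
        IntegrableOn (fun p => w p ^ 2) (Ioc t₁ t₂ ×ˢ univ) ((volume : Measure ℝ).prod ν) ∧
        ∫ p in Ioc t₁ t₂ ×ˢ univ, w p ^ 2 ∂((volume : Measure ℝ).prod ν)
          ≤ (m + 1) / 4 * (potential ν m (u (t₁ / 2)) / (t₁ / 2)) := by
  have hΦ := potential_nonneg hm (ν := ν) ((E.scheme 0).datum 0).nonneg
  set P := (volume : Measure ℝ).prod ν with hP
  set v : ℕ → ℝ × Ω → ℝ := fun n => (Ioi (4 * h n) ×ˢ univ).indicator (diffQuot m h U n) with hv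
  have hvm : ∀ n, Measurable (v n) := fun n =>
    (E.measurable_diffQuot n).indicator (measurableSet_Ioi.prod MeasurableSet.univ)
  have hveq : ∀ n p, 4 * h n < p.1 → v n p = diffQuot m h U n p := fun n p hp =>
    indicator_of_mem (s := Ioi (4 * h n) ×ˢ univ) ⟨hp, mem_univ _⟩ _
  set A : ℕ → Set (ℝ × Ω) := fun k => Ioc (1 / ((k : ℝ) + 1)) (k + 1) ×ˢ univ with hA
  have hAm : ∀ k, MeasurableSet (A k) := fun k => measurableSet_Ioc.prod MeasurableSet.univ
  have hAsub : ∀ t₁ t₂ : ℝ, 0 < t₁ → ∃ k : ℕ, 1 / ((k : ℝ) + 1) < t₁ ∧ t₂ ≤ k + 1 := by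
    intro t₁ t₂ ht₁
    obtain ⟨k, hk⟩ := exists_nat_gt (max (1 / t₁) t₂)
    refine ⟨k, ?_, by linarith [le_max_right (1 / t₁) t₂]⟩
    have : 1 / t₁ < k + 1 := by linarith [le_max_left (1 / t₁) t₂]
    rw [div_lt_comm₀ (by positivity) ht₁]; exact this
  obtain ⟨w, hw, hw1, hw2⟩ := exists_local_weak_limit (μ := P) (w := v) (A := A)
    (M := fun k => (m + 1) / 4 * (potential ν m (U 0 0) * (2 * (k + 1)))) hvm hAm (fun k n => by
      have hn := E.pos n
      set τ : ℝ := max (1 / ((k : ℝ) + 1)) (4 * h n) with hτ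
      have hk : (0 : ℝ) < 1 / (k + 1) := by positivity
      have h1 := E.lintegral_window_le hm n (s := 0) (t₁ := τ) (k + 1) le_rfl
        (by linarith [le_max_right (1 / ((k : ℝ) + 1)) (4 * h n)])
      calc ∫⁻ p in A k, ENNReal.ofReal (v n p ^ 2) ∂P
          = ∫⁻ p, (A k).indicator (fun p => ENNReal.ofReal (v n p ^ 2)) p ∂P :=
            (lintegral_indicator (hAm k) _).symm
        _ ≤ ∫⁻ p, (Ioc τ (k + 1) ×ˢ univ).indicator
              (fun p => ENNReal.ofReal (diffQuot m h U n p ^ 2)) p ∂P := by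
            refine lintegral_mono fun p => ?_
            by_cases hp : p ∈ A k
            · rw [indicator_of_mem hp]
              by_cases h4 : 4 * h n < p.1
              · rw [indicator_of_mem (show p ∈ Ioc τ ((k : ℝ) + 1) ×ˢ univ from
                  ⟨⟨max_lt hp.1.1 h4, hp.1.2⟩, mem_univ _⟩), hveq n p h4]
              · have : v n p = 0 := indicator_of_notMem (fun hc => h4 hc.1) _
                simp [this]
            · rw [indicator_of_notMem hp]; exact zero_le
        _ = ∫⁻ p in Ioc τ (k + 1) ×ˢ univ, ENNReal.ofReal (diffQuot m h U n p ^ 2) ∂P :=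
            lintegral_indicator (measurableSet_Ioc.prod MeasurableSet.univ) _
        _ ≤ _ := h1
        _ ≤ _ := by
            refine ENNReal.ofReal_le_ofReal ?_
            rw [grid_of_nonpos hn le_rfl, E.start]
            have h2 : 1 / (2 * ((k : ℝ) + 1)) ≤ τ - 0 - 2 * h n := by
              have e : 1 / (2 * ((k : ℝ) + 1)) = 1 / ((k : ℝ) + 1) / 2 := by field_simp
              rw [e]
              linarith [le_max_right (1 / ((k : ℝ) + 1)) (4 * h n),
                le_max_left (1 / ((k : ℝ) + 1)) (4 * h n)]
            gcongr
            rw [div_le_iff₀ (lt_of_lt_of_le (by positivity) h2), mul_assoc]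
            refine le_mul_of_one_le_right hΦ ?_
            rwa [div_le_iff₀' (by positivity)] at h2)
  refine ⟨w, hw, fun φ φ' a b C K T => ?_, fun t₁ t₂ ht₁ h12 => ?_⟩
  · obtain ⟨k, hk1, hk2⟩ := hAsub a b T.pos
    have hφ2 : Integrable (fun p : ℝ × Ω => φ p.1 p.2 ^ 2) P := by
      refine integrable_of_bdd_of_support (S := Icc a b ×ˢ K) (C := C ^ 2) (T.meas.pow_const 2)
        (measurableSet_Icc.prod T.measK) (T.measure_ne_top a b) (fun p => ?_) fun p hp => ?_
      · rw [abs_pow]; exact pow_le_pow_left₀ (abs_nonneg _) (T.bdd _ _) 2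
      · rw [mem_prod, not_and_or] at hp
        rw [T.zero _ _ hp]; norm_num
    refine hw1 (fun p => φ p.1 p.2) k _ T.meas hφ2 (fun p hp => T.zero _ _ (Or.inl fun hc => hp
      ⟨⟨hk1.trans_le hc.1, hc.2.trans hk2⟩, mem_univ _⟩)) ?_
    have hz : ∀ {f : Ω → ℝ}, Datum ν B f → ∀ x, |f x ^ ((m + 1) / 2)| ≤ B ^ ((m + 1) / 2) :=
      fun hf x => by
        rw [abs_of_nonneg (Real.rpow_nonneg (hf.nonneg x) _)]
        exact Real.rpow_le_rpow (hf.nonneg x) (hf.le x) (by positivity)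
    have hlim := T.tendsto_diff_quot (y := fun n p => U n (grid (h n) p.1) p.2 ^ ((m + 1) / 2))
      (y' := fun p => u p.1 p.2 ^ ((m + 1) / 2)) (fun n => (E.measurable_grid n).pow_const _)
      (E.measurable_swap.pow_const _) (fun n p => hz ((E.scheme n).datum _) _)
      (fun t => E.ae_lim_rpow (by positivity) t) E.pos E.lim
    refine hlim.congr' ?_
    have h4 : Tendsto (fun n => 4 * h n) atTop (𝓝 0) := by simpa using E.lim.const_mul 4
    filter_upwards [h4.eventually_lt_const T.pos] with n hn
    congr 1; ext p
    by_cases hp : a ≤ p.1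
    · rw [hveq n p (hn.trans_le hp), diffQuot]
    · rw [T.eq_zero fun hc => hp hc.1]; ring
  · obtain ⟨k, hk1, hk2⟩ := hAsub t₁ t₂ ht₁
    have h2 : Tendsto (fun n => 2 * h n) atTop (𝓝 0) := by simpa using E.lim.const_mul 2
    have h4 : Tendsto (fun n => 4 * h n) atTop (𝓝 0) := by simpa using E.lim.const_mul 4
    refine hw2 (Ioc t₁ t₂ ×ˢ univ) k _ (fun n => (m + 1) / 4 *
      (potential ν m (U n (grid (h n) (t₁ / 2))) / (t₁ - t₁ / 2 - 2 * h n)))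
      (measurableSet_Ioc.prod MeasurableSet.univ)
      (fun p hp => ⟨⟨hk1.trans hp.1.1, hp.1.2.trans hk2⟩, mem_univ _⟩) ?_ ?_
    · refine ((E.tendsto_potential hm hB (t₁ / 2)).div ?_ (by positivity)).const_mul _
      simpa [sub_half] using (tendsto_const_nhds (x := t₁ - t₁ / 2)).sub h2
    · filter_upwards [h4.eventually_lt_const ht₁] with n hn
      have hle := E.lintegral_window_le hm n (s := t₁ / 2) (t₁ := t₁) t₂ (by positivity)
        (by linarith)
      have hnn : 0 ≤ (m + 1) / 4 *
          (potential ν m (U n (grid (h n) (t₁ / 2))) / (t₁ - t₁ / 2 - 2 * h n)) := by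
        have := potential_nonneg hm (ν := ν) ((E.scheme n).datum (grid (h n) (t₁ / 2))).nonneg
        have h3 : 0 < t₁ - t₁ / 2 - 2 * h n := by linarith
        positivity
      have e : ∫ p in Ioc t₁ t₂ ×ˢ univ, v n p ^ 2 ∂P
          = ∫ p in Ioc t₁ t₂ ×ˢ univ, diffQuot m h U n p ^ 2 ∂P :=
        setIntegral_congr_fun (measurableSet_Ioc.prod MeasurableSet.univ) fun p hp => by
          simp only [hveq n p (hn.trans hp.1.1)]
      rw [e, integral_eq_lintegral_of_nonneg_ae (Eventually.of_forall fun _ => sq_nonneg _)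
        ((E.measurable_diffQuot n).pow_const 2).aestronglyMeasurable]
      exact ENNReal.toReal_le_of_le_ofReal hnn hle

end TimeDerivative

section RadialIntegrals

variable {d : ℕ}

lemma integrable_radial_of_le (hd : 0 < d) {f : ℝ → ℝ} (hf : Measurable f) {a b A B : ℝ}
    (ha : -1 < (d : ℝ) - 1 + a) (hb : (d : ℝ) - 1 + b < -1)
    (h0 : ∀ r, 0 < r → r ≤ 1 → |f r| ≤ A * r ^ a) (h1 : ∀ r, 1 < r → |f r| ≤ B * r ^ b) :
    Integrable (fun x : Ed d => f ‖x‖) := by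
  have hne : Nonempty (Fin d) := ⟨⟨0, hd⟩⟩
  have hpow : ∀ r : ℝ, 0 < r → ∀ c : ℝ, r ^ (d - 1) * r ^ c = r ^ ((d : ℝ) - 1 + c) := by
    intro r hr c
    rw [← Real.rpow_natCast, ← Real.rpow_add hr, Nat.cast_sub hd, Nat.cast_one]
  have hm : Measurable fun y : ℝ => y ^ (d - 1) * f y := (measurable_id.pow_const _).mul hf
  refine (integrable_fun_norm_addHaar (f := f) (volume : Measure (Ed d))).2 ?_
  simp only [finrank_euclideanSpace, Fintype.card_fin, smul_eq_mul]
  rw [← Ioc_union_Ioi_eq_Ioi zero_le_one]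
  refine IntegrableOn.union ?_ ?_
  · have i0 : IntegrableOn (fun r : ℝ => A * r ^ ((d : ℝ) - 1 + a)) (Ioc 0 1) :=
      ((intervalIntegral.intervalIntegrable_rpow' ha).1).const_mul A
    refine i0.mono' hm.aestronglyMeasurable
      ((ae_restrict_iff' measurableSet_Ioc).2 (Eventually.of_forall fun r hr => ?_))
    rw [← hpow r hr.1, Real.norm_eq_abs, abs_mul, abs_of_nonneg (pow_nonneg hr.1.le _),
      mul_left_comm]
    exact mul_le_mul_of_nonneg_left (h0 r hr.1 hr.2) (pow_nonneg hr.1.le _)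
  · have i1 : IntegrableOn (fun r : ℝ => B * r ^ ((d : ℝ) - 1 + b)) (Ioi 1) :=
      (integrableOn_Ioi_rpow_of_lt hb zero_lt_one).const_mul B
    refine i1.mono' hm.aestronglyMeasurable
      ((ae_restrict_iff' measurableSet_Ioi).2 (Eventually.of_forall fun r hr => ?_))
    have hr0 : (0 : ℝ) < r := zero_lt_one.trans hr
    rw [← hpow r hr0, Real.norm_eq_abs, abs_mul, abs_of_nonneg (pow_nonneg hr0.le _),
      mul_left_comm]
    exact mul_le_mul_of_nonneg_left (h1 r hr) (pow_nonneg hr0.le _)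

end RadialIntegrals

section GagliardoMeasure

variable {d : ℕ} {s κ : ℝ}

/-- The density of the Gagliardo measure as a function of the distance. -/
def gagliardoKernel (d : ℕ) (s κ r : ℝ) : ℝ := κ / 2 / r ^ ((d : ℝ) + 2 * s)

/-- The jump measure of the Gagliardo form. -/
def gagliardoMeasure (d : ℕ) (s κ : ℝ) : Measure (Ed d × Ed d) :=
  volume.withDensity fun p => ENNReal.ofReal (gagliardoKernel d s κ ‖p.1 - p.2‖)

instance : SFinite (gagliardoMeasure d s κ) := by unfold gagliardoMeasure; infer_instance

lemma measurable_gagliardoKernel : Measurable (gagliardoKernel d s κ) :=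
  measurable_const.div (measurable_id.pow_const _)

lemma gagliardoKernel_nonneg (hκ : 0 < κ) {r : ℝ} (hr : 0 ≤ r) : 0 ≤ gagliardoKernel d s κ r := by
  unfold gagliardoKernel; positivity

lemma measurable_ofReal_gagliardoKernel :
    Measurable fun p : Ed d × Ed d => ENNReal.ofReal (gagliardoKernel d s κ ‖p.1 - p.2‖) :=
  (measurable_gagliardoKernel.comp (measurable_fst.sub measurable_snd).norm).ennreal_ofReal

lemma gagliardoE_eq_jumpForm (hκ : 0 < κ) (v w : Ed d → ℝ) :
    gagliardoE d s κ v w = jumpForm (gagliardoMeasure d s κ) v w := by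
  rw [gagliardoE, jumpForm, gagliardoMeasure, integral_withDensity_eq_integral_toReal_smul
    measurable_ofReal_gagliardoKernel (Eventually.of_forall fun _ => ENNReal.ofReal_lt_top),
    ← integral_const_mul]
  refine integral_congr_ae (Eventually.of_forall fun p => ?_)
  simp only [smul_eq_mul]
  rw [ENNReal.toReal_ofReal (gagliardoKernel_nonneg hκ (norm_nonneg _)), gagliardoKernel, incr,
    incr]
  ring

lemma gagliardoSq_eq_lintegral (hκ : 0 < κ) {v : Ed d → ℝ} (hv : Measurable v) :
    gagliardoSq d s κ v = ∫⁻ p, ENNReal.ofReal (incr v p ^ 2) ∂gagliardoMeasure d s κ := by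
  have hi : Measurable fun p => ENNReal.ofReal (incr v p ^ 2) :=
    ((measurable_incr hv).pow_const 2).ennreal_ofReal
  have hk : Measurable fun p : Ed d × Ed d => ENNReal.ofReal
      ((v p.1 - v p.2) ^ 2 / ‖p.1 - p.2‖ ^ ((d : ℝ) + 2 * s)) :=
    (((measurable_incr hv).pow_const 2).div
      ((measurable_fst.sub measurable_snd).norm.pow_const _)).ennreal_ofReal
  rw [gagliardoSq, gagliardoMeasure,
    lintegral_withDensity_eq_lintegral_mul _ measurable_ofReal_gagliardoKernel hi,
    ← lintegral_const_mul _ hk]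
  refine lintegral_congr fun p => ?_
  rw [Pi.mul_apply, ← ENNReal.ofReal_mul (by positivity),
    ← ENNReal.ofReal_mul (gagliardoKernel_nonneg hκ (norm_nonneg _)), gagliardoKernel, incr]
  congr 1
  ring

lemma gagliardoSq_pow_eq {ν : Measure (Ed d)} {m : ℝ} (hκ : 0 < κ) {u : Ed d → ℝ}
    (hu : FormTest ν (gagliardoMeasure d s κ) m (fun x => u x ^ m)) :
    gagliardoSq d s κ (fun x => u x ^ m)
      = ENNReal.ofReal (powEnergy (gagliardoMeasure d s κ) m u) := by
  rw [gagliardoSq_eq_lintegral hκ hu.meas, hu.ofReal_jumpForm, powEnergy]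

lemma integrable_truncated_kernel (hs : 0 < s) (hs' : s < 1) (hd : 0 < d) (A L : ℝ) :
    Integrable fun z : Ed d =>
      min ((L * ‖z‖) ^ 2) ((2 * A) ^ 2) * gagliardoKernel d s κ ‖z‖ := by
  have hd1 : (1 : ℝ) ≤ d := by exact_mod_cast hd
  refine integrable_radial_of_le hd
    (f := fun r => min ((L * r) ^ 2) ((2 * A) ^ 2) * gagliardoKernel d s κ r)
    (a := 2 - (d + 2 * s)) (b := - (d + 2 * s)) (A := L ^ 2 * |κ / 2|) (B := (2 * A) ^ 2 * |κ / 2|)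
    ?_ (by linarith) (by linarith) (fun r hr _ => ?_) (fun r hr => ?_)
  · exact (((measurable_const.mul measurable_id).pow_const 2).min measurable_const).mul
      measurable_gagliardoKernel
  · rw [abs_mul, abs_of_nonneg (le_min (sq_nonneg _) (sq_nonneg _)), gagliardoKernel, abs_div,
      abs_of_pos (Real.rpow_pos_of_pos hr _), Real.rpow_sub hr, Real.rpow_two]
    refine (mul_le_mul_of_nonneg_right (min_le_left _ _) (by positivity)).trans_eq ?_
    ring
  · have hr0 : (0 : ℝ) < r := zero_lt_one.trans hr
    rw [abs_mul, abs_of_nonneg (le_min (sq_nonneg _) (sq_nonneg _)), gagliardoKernel, abs_div,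
      abs_of_pos (Real.rpow_pos_of_pos hr0 _), Real.rpow_neg hr0.le]
    refine (mul_le_mul_of_nonneg_right (min_le_right _ _) (by positivity)).trans_eq ?_
    ring

/-- Bounded Lipschitz functions with support of finite volume have finite Gagliardo energy. -/
lemma exists_gagliardo_energy_bound (hs : 0 < s) (hs' : s < 1) (hd : 0 < d) (hκ : 0 < κ)
    {K : Set (Ed d)} (hKm : MeasurableSet K) (hK : volume K ≠ ⊤) (A L : ℝ) :
    ∃ M : ℝ, 0 ≤ M ∧ ∀ g : Ed d → ℝ, Measurable g → (∀ x, |g x| ≤ A) →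
      (∀ x y, |g x - g y| ≤ L * ‖x - y‖) → (∀ x, x ∉ K → g x = 0) →
      ∫⁻ p, ENNReal.ofReal (incr g p ^ 2) ∂gagliardoMeasure d s κ ≤ ENNReal.ofReal M := by
  set H : Ed d → ℝ≥0∞ := fun z => ENNReal.ofReal
    (min ((L * ‖z‖) ^ 2) ((2 * A) ^ 2) * gagliardoKernel d s κ ‖z‖) with hH
  have hHm : Measurable H :=
    ((((measurable_const.mul measurable_norm).pow_const 2).min measurable_const).mul
      (measurable_gagliardoKernel.comp measurable_norm)).ennreal_ofReal
  have hHfin : ∫⁻ z, H z ≠ ⊤ :=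
    (integrable_truncated_kernel hs hs' hd A L).lintegral_lt_top.ne
  set I : Ed d → ℝ≥0∞ := K.indicator fun _ => 1 with hI
  have hIm : Measurable I := measurable_const.indicator hKm
  have hIint : ∫⁻ x, I x = volume K := by rw [hI, lintegral_indicator_const hKm, one_mul]
  refine ⟨(2 * (volume K * ∫⁻ z, H z)).toReal, ENNReal.toReal_nonneg, fun g hg hA hL h0 => ?_⟩
  rw [ENNReal.ofReal_toReal (ENNReal.mul_ne_top (by simp) (ENNReal.mul_ne_top hK hHfin)),
    gagliardoMeasure, lintegral_withDensity_eq_lintegral_mul _ measurable_ofReal_gagliardoKernel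
      ((measurable_incr hg).pow_const 2).ennreal_ofReal]
  have hm1 : Measurable fun p : Ed d × Ed d => I p.1 * H (p.1 - p.2) :=
    (hIm.comp measurable_fst).mul (hHm.comp (measurable_fst.sub measurable_snd))
  have hm2 : Measurable fun p : Ed d × Ed d => I p.2 * H (p.1 - p.2) :=
    (hIm.comp measurable_snd).mul (hHm.comp (measurable_fst.sub measurable_snd))
  have hpt : ∀ p : Ed d × Ed d, ENNReal.ofReal (gagliardoKernel d s κ ‖p.1 - p.2‖)
      * ENNReal.ofReal (incr g p ^ 2) ≤ I p.1 * H (p.1 - p.2) + I p.2 * H (p.1 - p.2) := by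
    intro p
    by_cases h : p.1 ∈ K ∨ p.2 ∈ K
    · have h1 : (1 : ℝ≥0∞) ≤ I p.1 + I p.2 := by
        rcases h with h | h
        · exact le_add_right (by rw [hI, indicator_of_mem h])
        · exact le_add_left (by rw [hI, indicator_of_mem h])
      have h2 : ENNReal.ofReal (gagliardoKernel d s κ ‖p.1 - p.2‖)
          * ENNReal.ofReal (incr g p ^ 2) ≤ H (p.1 - p.2) := by
        rw [← ENNReal.ofReal_mul (gagliardoKernel_nonneg hκ (norm_nonneg _)), mul_comm]
        refine ENNReal.ofReal_le_ofReal (mul_le_mul_of_nonneg_right (le_min ?_ ?_)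
          (gagliardoKernel_nonneg hκ (norm_nonneg _)))
        · rw [incr, ← sq_abs]
          exact pow_le_pow_left₀ (abs_nonneg _) (hL _ _) 2
        · rw [incr, ← sq_abs]
          refine pow_le_pow_left₀ (abs_nonneg _) ((abs_sub _ _).trans ?_) 2
          linarith [hA p.1, hA p.2]
      calc _ ≤ 1 * H (p.1 - p.2) := by rwa [one_mul]
        _ ≤ (I p.1 + I p.2) * H (p.1 - p.2) := by gcongr
        _ = _ := add_mul _ _ _
    · push Not at h
      rw [incr, h0 _ h.1, h0 _ h.2]
      simp
  refine (lintegral_mono hpt).trans ?_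
  rw [lintegral_add_left hm1, two_mul, Measure.volume_eq_prod, lintegral_prod _ hm1.aemeasurable,
    lintegral_prod_symm' _ hm2]
  refine (add_le_add (le_of_eq ?_) (le_of_eq ?_))
  · have : ∀ x, ∫⁻ y, I x * H (x - y) = I x * ∫⁻ z, H z := fun x => by
      rw [lintegral_const_mul _ (show Measurable fun y => H (x - y) from
          hHm.comp (measurable_const.sub measurable_id)),
        lintegral_sub_left_eq_self H x]
    simp only [this]
    rw [lintegral_mul_const _ hIm, hIint]
  · have : ∀ y, ∫⁻ x, I y * H (x - y) = I y * ∫⁻ z, H z := fun y => by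
      rw [lintegral_const_mul _ (show Measurable fun x => H (x - y) from
          hHm.comp (measurable_id.sub measurable_const)),
        lintegral_sub_right_eq_self H y]
    simp only [this]
    rw [lintegral_mul_const _ hIm, hIint]

end GagliardoMeasure

section WeightMeasure

variable {d : ℕ} {s κ m : ℝ} {ρ : Ed d → ℝ}

/-- The measure with density `ρ`. -/
def weightMeasure (ρ : Ed d → ℝ) : Measure (Ed d) :=
  volume.withDensity fun x => ENNReal.ofReal (ρ x)

instance : SFinite (weightMeasure ρ) := by unfold weightMeasure; infer_instance

lemma integral_weightMeasure (hρ : Measurable ρ) (h0 : ∀ x, 0 < ρ x) (f : Ed d → ℝ) :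
    ∫ x, f x ∂weightMeasure ρ = ∫ x, f x * ρ x := by
  rw [weightMeasure, integral_withDensity_eq_integral_toReal_smul hρ.ennreal_ofReal
    (Eventually.of_forall fun _ => ENNReal.ofReal_lt_top)]
  refine integral_congr_ae (Eventually.of_forall fun x => ?_)
  simp only [smul_eq_mul]
  rw [ENNReal.toReal_ofReal (h0 x).le, mul_comm]

lemma integrable_weightMeasure_iff (hρ : Measurable ρ) (h0 : ∀ x, 0 < ρ x) {f : Ed d → ℝ} :
    Integrable f (weightMeasure ρ) ↔ Integrable fun x => f x * ρ x := by
  rw [weightMeasure, integrable_withDensity_iff_integrable_smul' hρ.ennreal_ofReal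
    (Eventually.of_forall fun _ => ENNReal.ofReal_lt_top)]
  refine integrable_congr (Eventually.of_forall fun x => ?_)
  simp only [smul_eq_mul]
  rw [ENNReal.toReal_ofReal (h0 x).le, mul_comm]

lemma absolutelyContinuous_weightMeasure (hρ : Measurable ρ) (h0 : ∀ x, 0 < ρ x) :
    volume ≪ weightMeasure ρ :=
  withDensity_absolutelyContinuous' hρ.ennreal_ofReal.aemeasurable
    (Eventually.of_forall fun x => (ENNReal.ofReal_pos.2 (h0 x)).ne')

lemma AdmissibleWeight.isFiniteMeasureOnCompacts {γ₀ γ c C : ℝ} (hd : 0 < d) (hγ : 0 ≤ γ)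
    (hγ₀ : γ₀ < d) (h : AdmissibleWeight d ρ γ₀ γ c C) :
    IsFiniteMeasureOnCompacts (weightMeasure ρ) := by
  obtain ⟨hc, hcC, hρ, h0, h1, h2⟩ := h
  have hC : 0 < C := hc.trans hcC
  have hd1 : (1 : ℝ) ≤ d := by exact_mod_cast hd
  have hF : Integrable fun x : Ed d => (Iic (1 : ℝ)).indicator (fun r => r ^ (-γ₀)) ‖x‖ := by
    refine integrable_radial_of_le hd (f := (Iic (1 : ℝ)).indicator fun r => r ^ (-γ₀))
      (a := -γ₀) (b := -d - 1) (A := 1) (B := 0)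
      ((measurable_id.pow_const _).indicator measurableSet_Iic) (by linarith) (by linarith)
      (fun r hr hr1 => ?_) (fun r hr => ?_)
    · rw [indicator_of_mem (mem_Iic.2 hr1), one_mul, abs_of_pos (Real.rpow_pos_of_pos hr _)]
    · rw [indicator_of_notMem (by simpa using hr)]; simp
  refine ⟨fun K hK => ?_⟩
  rw [weightMeasure, withDensity_apply _ hK.measurableSet]
  have hi : IntegrableOn (fun x : Ed d =>
      C * (Iic (1 : ℝ)).indicator (fun r => r ^ (-γ₀)) ‖x‖ + C) K :=
    (hF.const_mul C).integrableOn.add (integrableOn_const hK.measure_lt_top.ne)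
  refine (lintegral_mono_ae ?_).trans_lt hi.lintegral_lt_top
  filter_upwards [ae_restrict_of_ae h1, ae_restrict_of_ae h2] with x hx1 hx2
  refine ENNReal.ofReal_le_ofReal ?_
  rcases le_or_gt ‖x‖ 1 with hx | hx
  · rw [indicator_of_mem (mem_Iic.2 hx)]
    linarith [(hx1 hx).2]
  · rw [indicator_of_notMem (by simpa using hx), mul_zero, zero_add]
    refine (hx2 hx).2.trans ?_
    have := Real.rpow_le_one_of_one_le_of_nonpos hx.le (neg_nonpos.2 hγ)
    nlinarith

lemma exists_formTest_bound {ν : Measure (Ed d)} [IsFiniteMeasureOnCompacts ν] (hm : 1 < m)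
    (hs : 0 < s) (hs' : s < 1) (hd : 0 < d) (hκ : 0 < κ) {K : Set (Ed d)} (hK : IsCompact K)
    (A L : ℝ) :
    ∃ M : ℝ, ∀ g : Ed d → ℝ, Measurable g → (∀ x, |g x| ≤ A) →
      (∀ x y, |g x - g y| ≤ L * ‖x - y‖) → (∀ x, x ∉ K → g x = 0) →
      FormTest ν (gagliardoMeasure d s κ) m g ∧ jumpForm (gagliardoMeasure d s κ) g g ≤ M := by
  obtain ⟨M, hM0, hM⟩ := exists_gagliardo_energy_bound hs hs' hd hκ hK.measurableSet
    hK.measure_lt_top.ne A L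
  refine ⟨M, fun g hg hA hL h0 => ?_⟩
  have hE := hM g hg hA hL h0
  have hm0 : (0 : ℝ) < 1 + 1 / m := by positivity
  have hF : FormTest ν (gagliardoMeasure d s κ) m g := by
    refine ⟨hg, ?_, ?_⟩
    · refine integrable_of_bdd_of_support (C := A ^ (1 + 1 / m)) (S := K)
        (hg.abs.pow_const _) hK.measurableSet hK.measure_lt_top.ne (fun x => ?_) (fun x hx => ?_)
      · rw [abs_of_nonneg (by positivity)]
        exact Real.rpow_le_rpow (abs_nonneg _) (hA x) hm0.le
      · rw [h0 x hx, abs_zero, Real.zero_rpow hm0.ne']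
    · exact integrable_of_lintegral_ofReal_ne_top ((measurable_incr hg).pow_const 2)
        (fun _ => sq_nonneg _) (hE.trans_lt ENNReal.ofReal_lt_top).ne
  refine ⟨hF, ?_⟩
  rw [hF.ofReal_jumpForm] at hE
  exact (ENNReal.ofReal_le_ofReal_iff hM0).1 hE

lemma jumpSpace_gagliardo (hm : 1 < m) (hs : 0 < s) (hs' : s < 1) (hd : 0 < d) (hκ : 0 < κ)
    {ν : Measure (Ed d)} [IsFiniteMeasureOnCompacts ν] (hν : volume ≪ ν) :
    JumpSpace ν (gagliardoMeasure d s κ) m := by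
  have hΛ : gagliardoMeasure d s κ ≪ (volume : Measure (Ed d)).prod volume :=
    withDensity_absolutelyContinuous _ _
  refine ⟨Measure.quasiMeasurePreserving_fst.mono hΛ hν,
    Measure.quasiMeasurePreserving_snd.mono hΛ hν, fun f hf ε hε => ?_⟩
  obtain ⟨g, hgc, hgd, hge⟩ := (memLp_one_iff_integrable.2 hf).exist_eLpNorm_sub_le
    ENNReal.one_ne_top le_rfl hε
  obtain ⟨A, hA⟩ := hgc.exists_bound_of_continuous hgd.continuous
  obtain ⟨L, hL⟩ := hgd.lipschitzWith_of_hasCompactSupport hgc (by simp)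
  obtain ⟨M, hM⟩ := exists_formTest_bound (ν := ν) hm hs hs' hd hκ hgc A L
  have hgi : Integrable g ν := hgd.continuous.integrable_of_hasCompactSupport hgc
  have hi : Integrable (fun x => |f x - g x|) ν := (hf.sub hgi).abs
  refine ⟨g, (hM g hgd.continuous.measurable hA (fun x y => ?_) (fun x hx =>
    image_eq_zero_of_notMem_tsupport hx)).1, ⟨A, hA⟩, hi, ?_⟩
  · rw [← Real.dist_eq, ← dist_eq_norm]
    exact hL.dist_le_mul x y
  · rw [eLpNorm_one_eq_lintegral_enorm] at hge
    simp only [Pi.sub_apply, Real.enorm_eq_ofReal_abs] at hge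
    rw [lintegral_ofReal_eq hi fun _ => abs_nonneg _] at hge
    exact (ENNReal.ofReal_le_ofReal_iff hε.le).1 hge

end WeightMeasure

section TestFunctions

variable {d : ℕ} {s κ m : ℝ} {φ : Ed d × ℝ → ℝ}

lemma IsTestFn.hasDerivAt (h : IsTestFn d φ) (x : Ed d) (t : ℝ) :
    HasDerivAt (fun τ => φ (x, τ)) (fderiv ℝ φ (x, t) (0, 1)) t := by
  have h1 : HasFDerivAt φ (fderiv ℝ φ (x, t)) (x, t) :=
    (h.1.differentiable (by simp) (x, t)).hasFDerivAt
  exact h1.comp_hasDerivAt t ((hasDerivAt_const t x).prodMk (hasDerivAt_id t))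

lemma IsTestFn.deriv_eq (h : IsTestFn d φ) (x : Ed d) (t : ℝ) :
    deriv (fun τ => φ (x, τ)) t = fderiv ℝ φ (x, t) (0, 1) :=
  (h.hasDerivAt x t).deriv

lemma exists_Icc_of_isCompact {S : Set ℝ} (hS : IsCompact S) (h : S ⊆ Ioi 0) :
    ∃ a b, 0 < a ∧ S ⊆ Icc a b := by
  rcases S.eq_empty_or_nonempty with rfl | hne
  · exact ⟨1, 1, one_pos, empty_subset _⟩
  · refine ⟨sInf S, sSup S, h (hS.sInf_mem hne), fun x hx =>
      ⟨csInf_le hS.bddBelow hx, le_csSup hS.bddAbove hx⟩⟩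

lemma IsTestFn.exists_timeTest {ν : Measure (Ed d)} [IsFiniteMeasureOnCompacts ν] (hm : 1 < m)
    (hs : 0 < s) (hs' : s < 1) (hd : 0 < d) (hκ : 0 < κ) (h : IsTestFn d φ) :
    ∃ a b C K, TimeTest ν (gagliardoMeasure d s κ) m (fun t x => φ (x, t))
      (fun t x => deriv (fun τ => φ (x, τ)) t) a b C K := by
  have hc : IsCompact (tsupport φ) := h.2.1
  have hcont : Continuous φ := h.1.continuous
  have hcont' : Continuous fun p => fderiv ℝ φ p (0, 1) :=
    (h.1.continuous_fderiv (by simp)).clm_apply continuous_const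
  have hS : IsCompact (Prod.snd '' tsupport φ) := hc.image continuous_snd
  have hK : IsCompact (Prod.fst '' tsupport φ) := hc.image continuous_fst
  obtain ⟨a, b, ha, hab⟩ := exists_Icc_of_isCompact hS (by
    rintro _ ⟨p, hp, rfl⟩; exact (h.2.2 hp).2)
  obtain ⟨A, hA⟩ := h.2.1.exists_bound_of_continuous hcont
  obtain ⟨A', hA'⟩ := (h.2.1.fderiv_apply (𝕜 := ℝ) (0, 1)).exists_bound_of_continuous hcont'
  obtain ⟨L, hL⟩ := h.1.lipschitzWith_of_hasCompactSupport h.2.1 (by simp)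
  obtain ⟨M, hM⟩ := exists_formTest_bound (ν := ν) hm hs hs' hd hκ hK A L
  have hout : ∀ t x, t ∉ Icc a b ∨ x ∉ Prod.fst '' tsupport φ → (x, t) ∉ tsupport φ := by
    rintro t x (ht | hx) hp
    · exact ht (hab ⟨_, hp, rfl⟩)
    · exact hx ⟨_, hp, rfl⟩
  have hform : ∀ t, FormTest ν (gagliardoMeasure d s κ) m (fun x => φ (x, t)) ∧
      jumpForm (gagliardoMeasure d s κ) (fun x => φ (x, t)) (fun x => φ (x, t)) ≤ M := by
    intro t
    refine hM _ (hcont.comp (by fun_prop)).measurable (fun x => hA _) (fun x y => ?_)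
      (fun x hx => image_eq_zero_of_notMem_tsupport (hout t x (Or.inr hx)))
    rw [← Real.dist_eq, ← dist_eq_norm]
    refine (hL.dist_le_mul _ _).trans_eq ?_
    rw [Prod.dist_eq, dist_self, max_eq_left dist_nonneg]
  refine ⟨a, b, max (max A A') M, Prod.fst '' tsupport φ, ha, hK.measurableSet,
    hK.measure_lt_top.ne, fun t x htx => image_eq_zero_of_notMem_tsupport (hout t x htx),
    fun t x htx => ?_, (hcont.comp continuous_swap).measurable, ?_,
    fun t x => (hA _).trans ((le_max_left _ _).trans (le_max_left _ _)), fun t x => ?_,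
    fun t x => ?_, fun t => (hform t).1, fun t => (hform t).2.trans (le_max_right _ _)⟩
  · rw [h.deriv_eq, fderiv_of_notMem_tsupport ℝ (hout t x htx)]
    rfl
  · simp only [h.deriv_eq]
    exact (hcont'.comp continuous_swap).measurable
  · rw [h.deriv_eq]
    exact (hA' _).trans ((le_max_right _ _).trans (le_max_left _ _))
  · rw [h.deriv_eq]
    exact h.hasDerivAt x t

end TestFunctions

section WeakSolution

lemma Scheme.integral_le {Ω : Type*} [MeasurableSpace Ω] {ν : Measure Ω} {Λ : Measure (Ω × Ω)}
    {m B h : ℝ} {U : ℕ → Ω → ℝ} (hm : 1 < m) (hh : 0 < h) (hU : Scheme ν Λ m h B U) (k : ℕ) :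
    ∫ x, U k x ∂ν ≤ ∫ x, U 0 x ∂ν := by
  induction k with
  | zero => exact le_rfl
  | succ k ih => exact ((hU.step k).integral_le hm hh (hU.datum k)).trans ih

lemma EulerLimit.integral_le {Ω : Type*} [MeasurableSpace Ω] {ν : Measure Ω}
    {Λ : Measure (Ω × Ω)} {m B : ℝ} {h : ℕ → ℝ} {U : ℕ → ℕ → Ω → ℝ} {u : ℝ → Ω → ℝ}
    (E : EulerLimit ν Λ m B h U u) (hm : 1 < m) (t : ℝ) :
    ∫ x, u t x ∂ν ≤ ∫ x, U 0 0 x ∂ν + 1 := by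
  obtain ⟨δ, hδ, N, hN⟩ := E.modulus t 1 one_pos
  have h1 := hN N le_rfl t (by simpa using hδ)
  have h2 := (E.scheme N).integral_le hm (E.pos N) (grid (h N) t)
  rw [E.start] at h2
  have hd := (E.scheme N).datum (grid (h N) t)
  have h3 : ∫ x, u t x ∂ν - ∫ x, U N (grid (h N) t) x ∂ν ≤ dist1 ν (U N (grid (h N) t)) (u t) := by
    rw [dist1, ← integral_sub (E.datum t).int hd.int]
    refine integral_mono ((E.datum t).int.sub hd.int) (hd.int.sub (E.datum t).int).abs fun x => ?_
    simp only
    rw [abs_sub_comm]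
    exact le_abs_self _
  linarith

variable {d : ℕ} {s κ m B : ℝ} {ρ : Ed d → ℝ} {h : ℕ → ℝ} {U : ℕ → ℕ → Ed d → ℝ}
  {u : ℝ → Ed d → ℝ}

lemma EulerLimit.lintegral_gagliardoSq {ν : Measure (Ed d)}
    (E : EulerLimit ν (gagliardoMeasure d s κ) m B h U u)
    (hJ : JumpSpace ν (gagliardoMeasure d s κ) m) (hm : 1 < m) (hκ : 0 < κ) {a b : ℝ}
    (ha : 0 < a) (hab : a < b) :
    ∫⁻ t in Ioc a b, gagliardoSq d s κ (fun x => u t x ^ m)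
      = ENNReal.ofReal (∫ t in a..b, powEnergy (gagliardoMeasure d s κ) m (u t)) := by
  have h1 : ∫⁻ t in Ioc a b, gagliardoSq d s κ (fun x => u t x ^ m)
      = ∫⁻ t in Ioc a b, ENNReal.ofReal (powEnergy (gagliardoMeasure d s κ) m (u t)) :=
    setLIntegral_congr_fun measurableSet_Ioc fun t ht =>
      gagliardoSq_pow_eq hκ (E.formTest hJ hm (ha.trans ht.1))
  rw [h1, lintegral_ofReal_eq (E.intervalIntegrable_powEnergy hJ hm ha (ha.trans hab)).1
    fun t => powEnergy_nonneg _, intervalIntegral.integral_of_le hab.le]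

lemma TimeTest.setIntegral_Ioi {Ω : Type*} [MeasurableSpace Ω] {ν : Measure Ω}
    {Λ : Measure (Ω × Ω)} {φ φ' : ℝ → Ω → ℝ} {a b C : ℝ} {K : Set Ω}
    (T : TimeTest ν Λ m φ φ' a b C K) {F : ℝ → ℝ}
    (hF : ∀ t, (∀ x, φ t x = 0) → (∀ x, φ' t x = 0) → F t = 0) :
    ∫ t in Ioi 0, F t = ∫ t, F t := by
  refine setIntegral_eq_integral_of_forall_compl_eq_zero fun t ht => ?_
  have : t ∉ Icc a b := fun h' => ht (T.pos.trans_le h'.1)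
  exact hF t (fun x => T.zero t x (Or.inl this)) fun x => T.zero' t x (Or.inl this)

theorem EulerLimit.weakSolCore [IsFiniteMeasureOnCompacts (weightMeasure ρ)]
    (E : EulerLimit (weightMeasure ρ) (gagliardoMeasure d s κ) m B h U u)
    (hm : 1 < m) (hs : 0 < s) (hs' : s < 1) (hd : 0 < d) (hκ : 0 < κ) (hρ : Measurable ρ)
    (h0 : ∀ x, 0 < ρ x) : WeakSolCore d s m κ ρ fun x t => u t x := by
  have hJ : JumpSpace (weightMeasure ρ) (gagliardoMeasure d s κ) m :=
    jumpSpace_gagliardo hm hs hs' hd hκ (absolutelyContinuous_weightMeasure hρ h0)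
  refine ⟨E.meas, fun x t => (E.datum t).nonneg x,
    ⟨∫ x, U 0 0 x ∂weightMeasure ρ + 1, Eventually.of_forall fun t => ⟨?_, ?_⟩⟩,
    fun τ _ => ⟨B, Eventually.of_forall fun p _ => (E.datum p.2).le p.1⟩, ?_, ?_, ?_⟩
  · exact (integrable_weightMeasure_iff hρ h0).1 (E.datum t).int
  · rw [← integral_weightMeasure hρ h0]
    exact E.integral_le hm t
  · refine (ae_restrict_iff' measurableSet_Ioi).2 (Eventually.of_forall fun t ht => ?_)
    rw [gagliardoSq_pow_eq hκ (E.formTest hJ hm ht)]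
    exact ENNReal.ofReal_lt_top
  · intro t₁ t₂ ht₁ ht
    rw [E.lintegral_gagliardoSq hJ hm hκ ht₁ ht]
    exact ENNReal.ofReal_ne_top
  · intro φ hφ
    obtain ⟨a, b, C, K, T⟩ := hφ.exists_timeTest (ν := weightMeasure ρ) hm hs hs' hd hκ
    have hw := E.weakForm hJ hm T
    simp only [integral_weightMeasure hρ h0, ← gagliardoE_eq_jumpForm hκ] at hw
    rw [T.setIntegral_Ioi, T.setIntegral_Ioi, hw, neg_add_cancel]
    · intro t h1 _
      simp [gagliardoE, h1]
    · intro t _ h1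
      simp [h1]

theorem EulerLimit.hasInitialTrace {Λ : Measure (Ed d × Ed d)}
    (E : EulerLimit (weightMeasure ρ) Λ m B h U u) (hρ : Measurable ρ) (h0 : ∀ x, 0 < ρ x)
    {u₀ : Ed d → ℝ} (hu₀ : U 0 0 =ᵐ[volume] u₀) :
    HasInitialTrace d ρ (fun x t => u t x)
      (volume.withDensity fun x => ENNReal.ofReal (u₀ x * ρ x)) := by
  refine ⟨∅, measure_empty, fun φ hφ hb => ?_⟩
  obtain ⟨C, hC⟩ := hb
  have hC0 : 0 ≤ C := (abs_nonneg _).trans (hC 0)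
  have hae : (fun x => ENNReal.ofReal (u₀ x * ρ x))
      =ᵐ[volume] fun x => ENNReal.ofReal (u 0 x * ρ x) := by
    filter_upwards [hu₀, (absolutelyContinuous_weightMeasure hρ h0).ae_eq E.ae_eq_start]
      with x h1 h2
    rw [h2, h1]
  have hmeas : Measurable fun x => ENNReal.ofReal (u 0 x * ρ x) :=
    ((E.datum 0).meas.mul hρ).ennreal_ofReal
  have hlim : ∫ x, φ x ∂(volume.withDensity fun x => ENNReal.ofReal (u₀ x * ρ x))
      = ∫ x, u 0 x * φ x ∂weightMeasure ρ := by
    rw [withDensity_congr_ae hae, integral_withDensity_eq_integral_toReal_smul hmeas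
      (Eventually.of_forall fun _ => ENNReal.ofReal_lt_top), integral_weightMeasure hρ h0]
    refine integral_congr_ae (Eventually.of_forall fun x => ?_)
    simp only [smul_eq_mul]
    rw [ENNReal.toReal_ofReal (mul_nonneg ((E.datum 0).nonneg x) (h0 x).le)]
    ring
  have hcont := E.continuous_of_dist1 (G := fun f => ∫ x, f x * φ x ∂weightMeasure ρ) hC0
    fun f g hf hg => hf.abs_integral_mul_sub_le hφ.measurable hC hg
  rw [hlim]
  refine ((hcont.tendsto 0).mono_left nhdsWithin_le_nhds).congr fun t => ?_
  rw [integral_weightMeasure hρ h0]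
  refine integral_congr_ae (Eventually.of_forall fun x => ?_)
  simp only
  ring

theorem EulerLimit.energy_identity
    (E : EulerLimit (weightMeasure ρ) (gagliardoMeasure d s κ) m B h U u)
    (hJ : JumpSpace (weightMeasure ρ) (gagliardoMeasure d s κ) m) (hm : 1 < m) (hκ : 0 < κ)
    (hρ : Measurable ρ) (h0 : ∀ x, 0 < ρ x) {a b : ℝ} (ha : 0 < a) (hab : a < b) :
    (∫⁻ t in Ioc a b, gagliardoSq d s κ (fun x => u t x ^ m)).toReal
      + (1 / (m + 1)) * ∫ x, u b x ^ (m + 1) * ρ x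
      = (1 / (m + 1)) * ∫ x, u a x ^ (m + 1) * ρ x := by
  rw [E.lintegral_gagliardoSq hJ hm hκ ha hab, ENNReal.toReal_ofReal
    (intervalIntegral.integral_nonneg hab.le fun t _ => powEnergy_nonneg _),
    E.energy_eq hJ hm (E.bound_nonneg 0) ha hab, potential, potential,
    integral_weightMeasure hρ h0, integral_weightMeasure hρ h0]
  ring

theorem EulerLimit.exists_weak_time_deriv [IsFiniteMeasureOnCompacts (weightMeasure ρ)]
    (E : EulerLimit (weightMeasure ρ) (gagliardoMeasure d s κ) m B h U u)
    (hm : 1 < m) (hs : 0 < s) (hs' : s < 1) (hd : 0 < d) (hκ : 0 < κ) (hρ : Measurable ρ)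
    (h0 : ∀ x, 0 < ρ x) :
    ∃ w : Ed d → ℝ → ℝ, Measurable (Function.uncurry w) ∧
      (∀ φ : Ed d × ℝ → ℝ, IsTestFn d φ →
        (∫ t in Ioi (0 : ℝ), ∫ x : Ed d,
            u t x ^ ((m + 1) / 2) * deriv (fun τ => φ (x, τ)) t * ρ x)
          = -(∫ t in Ioi (0 : ℝ), ∫ x : Ed d, w x t * φ (x, t) * ρ x)) ∧
      (∀ t₁ t₂ : ℝ, 0 < t₁ → t₁ < t₂ →
        (∫ t in Ioc t₁ t₂, ∫ x : Ed d, (w x t) ^ 2 * ρ x)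
          ≤ 1 / (2 * t₁) * ∫ x : Ed d, u (t₁ / 2) x ^ (m + 1) * ρ x) := by
  obtain ⟨w, hw, hweak, hbound⟩ := E.exists_time_deriv hm (E.bound_nonneg 0)
  refine ⟨fun x t => w (t, x), hw.comp (measurable_snd.prodMk measurable_fst), fun φ hφ => ?_, fun t₁ t₂ ht₁ ht => ?_⟩
  · obtain ⟨a, b, C, K, T⟩ := hφ.exists_timeTest (ν := weightMeasure ρ) hm hs hs' hd hκ
    obtain ⟨hi, heq⟩ := hweak _ _ _ _ _ _ T
    have hi' := T.integrable_mul_deriv (F := fun p => u p.1 p.2 ^ ((m + 1) / 2))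
      (E.measurable_swap.pow_const _) fun p => (E.datum p.1).rpow_le (by linarith) p.2
    rw [integral_prod _ hi, integral_prod _ hi'] at heq
    simp only [integral_weightMeasure hρ h0] at heq
    rw [T.setIntegral_Ioi, T.setIntegral_Ioi, heq, neg_neg]
    · intro t h1 _
      simp [h1]
    · intro t _ h1
      simp [h1]
  · obtain ⟨hi, hle⟩ := hbound t₁ t₂ ht₁ ht
    rw [setIntegral_prod _ hi, potential] at hle
    simp only [Measure.restrict_univ, integral_weightMeasure hρ h0] at hle
    refine hle.trans_eq ?_
    have hm1 : m + 1 ≠ 0 := by linarith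
    field_simp
    ring

end WeakSolution

/-- A bounded nonnegative function which is integrable against `ρ` has a pointwise bounded
measurable representative. -/
lemma exists_datum_ae_eq {d : ℕ} {ρ u₀ : Ed d → ℝ} {B : ℝ} (hρ : Measurable ρ)
    (h0 : ∀ x, 0 < ρ x) (hu0 : ∀ x, 0 ≤ u₀ x) (hint : Integrable fun x => u₀ x * ρ x)
    (hB : ∀ᵐ x, u₀ x ≤ B) :
    ∃ f, Datum (weightMeasure ρ) (max B 1) f ∧ f =ᵐ[volume] u₀ := by
  have hm : AEMeasurable u₀ := by
    refine (hint.aemeasurable.div hρ.aemeasurable).congr (Eventually.of_forall fun x => ?_)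
    rw [Pi.div_apply, mul_div_cancel_right₀ _ (h0 x).ne']
  have hae : (fun x => min (max (hm.mk u₀ x) 0) (max B 1)) =ᵐ[volume] u₀ := by
    filter_upwards [hm.ae_eq_mk, hB] with x h1 h2
    rw [← h1, max_eq_left (hu0 x), min_eq_left (h2.trans (le_max_left _ _))]
  refine ⟨_, ⟨(hm.measurable_mk.max measurable_const).min measurable_const,
    fun x => le_min (le_max_right _ _) (zero_le_one.trans (le_max_right _ _)),
    fun x => min_le_right _ _, ?_⟩, hae⟩
  refine (integrable_weightMeasure_iff hρ h0).2 (hint.congr ?_)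
  filter_upwards [hae] with x hx
  rw [hx]

/-- **Existence for bounded integrable data, with energy estimates.** For `m > 1`
there is a constant `C′ = C′(t₁,t₂) > 0` (depending only on `m`, `t₁`, `t₂`)
such that for every admissible setting and every nonnegative initial datum
`u₀ ∈ L¹_ρ(ℝ^d) ∩ L^∞(ℝ^d)` there exists a weak solution `u` of
`ρ u_t + (-Δ)^s(u^m) = 0` with initial datum `u₀(x)ρ(x)dx`, satisfying
(a) the energy identity, and (b) the estimate on the weak time derivative of
`z := u^{(m+1)/2}`. -/
theorem existence_bounded_data_energy_estimates (m : ℝ) (hm : 1 < m) :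
    ∃ C' : ℝ → ℝ → ℝ, (∀ t₁ t₂ : ℝ, 0 < t₁ → t₁ < t₂ → 0 < C' t₁ t₂) ∧
      ∀ (d : ℕ) (s κ γ₀ γ c C : ℝ),
        0 < s → s < 1 → 2 * s < (d : ℝ) → 0 < κ →
        0 ≤ γ₀ → γ₀ ≤ γ → γ < 2 * s → γ ≤ (d : ℝ) - 2 * s →
        ∀ ρ : Ed d → ℝ, AdmissibleWeight d ρ γ₀ γ c C →
        ∀ u₀ : Ed d → ℝ, (∀ x, 0 ≤ u₀ x) →
          Integrable (fun x : Ed d => u₀ x * ρ x) →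
          (∃ B : ℝ, ∀ᵐ x ∂(volume : Measure (Ed d)), u₀ x ≤ B) →
        ∃ u : Ed d → ℝ → ℝ,
          IsWeakSolution d s m κ ρ
            (volume.withDensity fun x => ENNReal.ofReal (u₀ x * ρ x)) u ∧
          -- (a) energy identity
          (∀ᵐ p ∂(volume : Measure (ℝ × ℝ)), 0 < p.1 → p.1 < p.2 →
            (∫⁻ t in Ioc p.1 p.2, gagliardoSq d s κ (fun x => u x t ^ m)).toReal
              + (1 / (m + 1)) * ∫ x : Ed d, u x p.2 ^ (m + 1) * ρ x
              = (1 / (m + 1)) * ∫ x : Ed d, u x p.1 ^ (m + 1) * ρ x) ∧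
          -- (b) z := u^{(m+1)/2} has a weak time derivative w with the stated bound
          (∃ w : Ed d → ℝ → ℝ, Measurable (Function.uncurry w) ∧
            (∀ φ : Ed d × ℝ → ℝ, IsTestFn d φ →
              (∫ t in Ioi (0 : ℝ), ∫ x : Ed d,
                  u x t ^ ((m + 1) / 2) * deriv (fun τ => φ (x, τ)) t * ρ x)
                = -(∫ t in Ioi (0 : ℝ), ∫ x : Ed d, w x t * φ (x, t) * ρ x)) ∧
            (∀ t₁ t₂ : ℝ, 0 < t₁ → t₁ < t₂ →
              (∫ t in Ioc t₁ t₂, ∫ x : Ed d, (w x t) ^ 2 * ρ x)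
                ≤ C' t₁ t₂ * ∫ x : Ed d, u x (t₁ / 2) ^ (m + 1) * ρ x)) := by
  refine ⟨fun t₁ _ => 1 / (2 * t₁), fun t₁ _ h _ => by positivity, ?_⟩
  intro d s κ γ₀ γ c C hs hs' hd hκ hγ₀ hγ₀γ hγs hγ ρ hadm u₀ hu0 hint ⟨B₀, hB₀⟩
  have hdR : (0 : ℝ) < d := by linarith
  have hd0 : 0 < d := by exact_mod_cast hdR
  have := hadm.isFiniteMeasureOnCompacts hd0 (hγ₀.trans hγ₀γ) (by linarith)
  have hρ : Measurable ρ := hadm.2.2.1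
  have h0 : ∀ x, 0 < ρ x := hadm.2.2.2.1
  obtain ⟨f, hf, hfu⟩ := exists_datum_ae_eq hρ h0 hu0 hint hB₀
  have hJ : JumpSpace (weightMeasure ρ) (gagliardoMeasure d s κ) m :=
    jumpSpace_gagliardo hm hs hs' hd0 hκ (absolutelyContinuous_weightMeasure hρ h0)
  obtain ⟨h, U, u, E, hU⟩ := hf.exists_eulerLimit hJ hm (lt_max_of_lt_right one_pos)
  refine ⟨fun x t => u t x, ⟨E.weakSolCore hm hs hs' hd0 hκ hρ h0,
    E.hasInitialTrace hρ h0 (hU ▸ hfu)⟩,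
    Eventually.of_forall fun p hp hpp => E.energy_identity hJ hm hκ hρ h0 hp hpp,
    E.exists_weak_time_deriv hm hs hs' hd0 hκ hρ h0⟩
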